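/- Let (a_n)_{n≥1} be a strictly increasing sequence of positive integers and let (η(N))_{N≥1} be a sequence of non-negative reals. Let 𝒜 = {α ∈ [0,1] : δ_min^α(N) ≤ η(N) for infinitely many N}. If the series Σ_{k=1}^∞ φ(k) · sup_{b≥1} { (sup_{ℓ ≥ 𝒩(bk)} η(ℓ)) / (bk) } diverges, then the Lebesgue measure of 𝒜 equals 1. -/

import Mathlib

open MeasureTheory Filter
open scoped ENNReal NNReal

/-- Distance to the nearest integer. -/
noncomputable def nint (x : ℝ) : ℝ := |x - round x|

/-- `δ_min^α(N) = min { ‖(a_m - a_n) α‖ : 1 ≤ m, n ≤ N, m ≠ n }`. -/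
noncomputable def deltaMin (a : ℕ → ℕ) (α : ℝ) (N : ℕ) : ℝ :=
  sInf {x : ℝ | ∃ m n : ℕ, 1 ≤ m ∧ m ≤ N ∧ 1 ≤ n ∧ n ≤ N ∧ m ≠ n ∧
    x = nint (((a m : ℝ) - (a n : ℝ)) * α)}

/-- `C_N = #(A_N - A_N)` where `A_N = {a_1, …, a_N}`. -/
noncomputable def diffCard (a : ℕ → ℕ) (N : ℕ) : ℕ :=
  (((Finset.Icc 1 N) ×ˢ (Finset.Icc 1 N)).image
    (fun p : ℕ × ℕ => (a p.1 : ℤ) - (a p.2 : ℤ))).card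

/-- `log x`, read as `max {1, log x}`. -/
noncomputable def L (x : ℝ) : ℝ := max 1 (Real.log x)

/-- `log₂ x = log log x`, with the `max {1, ·}` convention. -/
noncomputable def LL (x : ℝ) : ℝ := L (L x)

/-- `k ∈ (A_M − A_M)⁺`, i.e. `k = a_m − a_n > 0` for some `1 ≤ m, n ≤ M`
(for a positive integer `k`, encoded as `a n + k = a m`). -/
def inDiffPos (a : ℕ → ℕ) (k M : ℕ) : Prop :=
  ∃ m n : ℕ, 1 ≤ m ∧ m ≤ M ∧ 1 ≤ n ∧ n ≤ M ∧ a n + k = a m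

/-- `𝒩(k) = min {M ≥ 1 : k ∈ (A_M − A_M)⁺}`, with value `⊤ = ∞` if no such `M` exists. -/
noncomputable def calN (a : ℕ → ℕ) (k : ℕ) : ℕ∞ :=
  ⨅ (M : ℕ) (_ : 1 ≤ M ∧ inDiffPos a k M), (M : ℕ∞)

/-- The `k`-th term `φ(k) · sup_{b ≥ 1} { (sup_{ℓ ≥ 𝒩(bk)} η(ℓ)) / (bk) }` of the series,
computed in `ℝ≥0∞` (empty suprema are `0`). -/
noncomputable def seriesTerm (a : ℕ → ℕ) (η : ℕ → ℝ) (k : ℕ) : ℝ≥0∞ :=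
  (Nat.totient k : ℝ≥0∞) *
    ⨆ (b : ℕ) (_ : 1 ≤ b),
      (⨆ (ℓ : ℕ) (_ : calN a (b * k) ≤ (ℓ : ℕ∞)), ENNReal.ofReal (η ℓ)) /
        ((b * k : ℕ) : ℝ≥0∞)

namespace DuffinSchaeffer

open Finset Topology

/-- The decay `r ^ |i - j|`. -/
noncomputable def decay (r : ℝ) (i j : ℕ) : ℝ := r ^ ((i - j) + (j - i))

lemma decay_nonneg {r : ℝ} (hr : 0 ≤ r) (i j : ℕ) : 0 ≤ decay r i j := pow_nonneg hr _

lemma decay_comm (r : ℝ) (i j : ℕ) : decay r i j = decay r j i := by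
  unfold decay; rw [add_comm]

lemma sum_pow_le_of_injOn {r : ℝ} (hr0 : 0 ≤ r) (hr1 : r < 1) (S : Finset ℕ) (g : ℕ → ℕ)
    (hg : Set.InjOn g S) (c : ℕ) (hc : ∀ j ∈ S, c ≤ g j) :
    ∑ j ∈ S, r ^ g j ≤ r ^ c / (1 - r) := by
  have h1 : ∑ j ∈ S, r ^ g j = r ^ c * ∑ j ∈ S, r ^ (g j - c) := by
    rw [mul_sum]
    refine sum_congr rfl fun j hj => ?_
    rw [← pow_add, Nat.add_sub_cancel' (hc j hj)]
  have h2 : ∑ j ∈ S, r ^ (g j - c) = ∑ k ∈ S.image (fun j => g j - c), r ^ k := by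
    rw [sum_image]
    intro x hx y hy hxy
    have := hc x hx; have := hc y hy
    simp only at hxy
    exact hg hx hy (by omega)
  have h3 : ∑ k ∈ S.image (fun j => g j - c), r ^ k ≤ (1 - r)⁻¹ := by
    rw [← tsum_geometric_of_lt_one hr0 hr1]
    exact (summable_geometric_of_lt_one hr0 hr1).sum_le_tsum _ fun i _ => pow_nonneg hr0 i
  rw [h1, h2, div_eq_mul_inv]
  gcongr

lemma sum_decay_erase_le {r : ℝ} (hr0 : 0 ≤ r) (hr1 : r < 1) (S : Finset ℕ) (i : ℕ) :
    ∑ j ∈ S.erase i, decay r i j ≤ 2 * r / (1 - r) := by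
  have h1 : ∑ j ∈ S.erase i, decay r i j =
      ∑ j ∈ S.erase i with j < i, decay r i j + ∑ j ∈ S.erase i with ¬ j < i, decay r i j :=
    (sum_filter_add_sum_filter_not _ _ _).symm
  have h2 : ∑ j ∈ S.erase i with j < i, decay r i j ≤ r ^ 1 / (1 - r) := by
    apply sum_pow_le_of_injOn hr0 hr1
    · intro x hx y hy hxy
      simp at hx hy hxy
      omega
    · intro j hj
      simp at hj
      omega
  have h3 : ∑ j ∈ S.erase i with ¬ j < i, decay r i j ≤ r ^ 1 / (1 - r) := by
    apply sum_pow_le_of_injOn hr0 hr1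
    · intro x hx y hy hxy
      simp at hx hy hxy
      omega
    · intro j hj
      simp at hj
      omega
  rw [h1]
  calc _ ≤ r ^ 1 / (1 - r) + r ^ 1 / (1 - r) := add_le_add h2 h3
    _ = _ := by ring

lemma sum_decay_le {r : ℝ} (hr0 : 0 ≤ r) (hr1 : r < 1) (S : Finset ℕ) (i : ℕ) :
    ∑ j ∈ S, decay r i j ≤ 2 / (1 - r) := by
  have h1 : ∑ j ∈ S, decay r i j ≤ decay r i i + ∑ j ∈ S.erase i, decay r i j := by
    by_cases h : i ∈ S
    · rw [add_sum_erase _ _ h]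
    · rw [erase_eq_of_notMem h]
      have := decay_nonneg hr0 i i
      linarith
  have h2 := sum_decay_erase_le hr0 hr1 S i
  have h3 : decay r i i = 1 := by simp [decay]
  have h4 : 0 < 1 - r := by linarith
  have h5 : (1 : ℝ) + 2 * r / (1 - r) ≤ 2 / (1 - r) := by
    have : 2 / (1 - r) = 2 + 2 * r / (1 - r) := by field_simp; ring
    linarith
  linarith

/-- Schur's test for a symmetric kernel, in a form with squares. -/
lemma schur_sq (k : ℕ → ℕ → ℝ) (hk : ∀ i j, 0 ≤ k i j) (hsymm : ∀ i j, k i j = k j i)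
    (S : Finset ℕ) (M : ℝ) (hM : ∀ i ∈ S, ∑ j ∈ S, k i j ≤ M) (u v : ℕ → ℝ) :
    (∑ i ∈ S, ∑ j ∈ S, k i j * (u i ^ 2 * v j ^ 2)) ^ 2 ≤
      (M * ∑ i ∈ S, u i ^ 4) * (M * ∑ j ∈ S, v j ^ 4) := by
  have h1 : (∑ p ∈ S ×ˢ S, (√(k p.1 p.2) * u p.1 ^ 2) * (√(k p.1 p.2) * v p.2 ^ 2)) ^ 2 ≤
      (∑ p ∈ S ×ˢ S, (√(k p.1 p.2) * u p.1 ^ 2) ^ 2) *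
        (∑ p ∈ S ×ˢ S, (√(k p.1 p.2) * v p.2 ^ 2) ^ 2) :=
    sum_mul_sq_le_sq_mul_sq _ _ _
  have h2 : ∑ p ∈ S ×ˢ S, (√(k p.1 p.2) * u p.1 ^ 2) * (√(k p.1 p.2) * v p.2 ^ 2) =
      ∑ i ∈ S, ∑ j ∈ S, k i j * (u i ^ 2 * v j ^ 2) := by
    rw [sum_product]
    refine sum_congr rfl fun i _ => sum_congr rfl fun j _ => ?_
    have := Real.mul_self_sqrt (hk i j)
    calc _ = (√(k i j) * √(k i j)) * (u i ^ 2 * v j ^ 2) := by ring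
      _ = _ := by rw [this]
  have h3 : ∑ p ∈ S ×ˢ S, (√(k p.1 p.2) * u p.1 ^ 2) ^ 2 ≤ M * ∑ i ∈ S, u i ^ 4 := by
    rw [sum_product, mul_sum]
    refine sum_le_sum fun i hi => ?_
    calc _ = (∑ j ∈ S, k i j) * u i ^ 4 := by
          rw [sum_mul]
          refine sum_congr rfl fun j _ => ?_
          rw [mul_pow, Real.sq_sqrt (hk i j)]; ring
      _ ≤ _ := by
          have := hM i hi
          gcongr
  have h4 : ∑ p ∈ S ×ˢ S, (√(k p.1 p.2) * v p.2 ^ 2) ^ 2 ≤ M * ∑ i ∈ S, v i ^ 4 := by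
    rw [sum_product_right, mul_sum]
    refine sum_le_sum fun i hi => ?_
    calc _ = (∑ j ∈ S, k i j) * v i ^ 4 := by
          rw [sum_mul]
          refine sum_congr rfl fun j _ => ?_
          rw [mul_pow, Real.sq_sqrt (hk j i), hsymm]; ring
      _ ≤ _ := by
          have := hM i hi
          gcongr
  rw [← h2]
  refine h1.trans (mul_le_mul h3 h4 (sum_nonneg fun _ _ => sq_nonneg _) ?_)
  exact (sum_nonneg fun _ _ => sq_nonneg _).trans h3

lemma le_of_pow_four_le {x y : ℝ} (hy : 0 ≤ y) (h : x ^ 4 ≤ y ^ 4) : x ≤ y :=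
  le_of_pow_le_pow_left₀ (by norm_num) hy h

lemma schur_four (k : ℕ → ℕ → ℝ) (hk : ∀ i j, 0 ≤ k i j) (hsymm : ∀ i j, k i j = k j i)
    (S : Finset ℕ) (M : ℝ) (hM0 : 0 ≤ M) (hM : ∀ i ∈ S, ∑ j ∈ S, k i j ≤ M) (u v : ℕ → ℝ)
    (hu : ∀ i, 0 ≤ u i) (hv : ∀ i, 0 ≤ v i) (a b : ℝ) (ha : 0 ≤ a) (hb : 0 ≤ b)
    (hua : ∑ i ∈ S, u i ^ 4 ≤ a ^ 4) (hvb : ∑ i ∈ S, v i ^ 4 ≤ b ^ 4) :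
    ∑ i ∈ S, ∑ j ∈ S, k i j * (u i ^ 3 * v j ^ 3) ≤ M * (a ^ 3 * b ^ 3) := by
  have hua' : ∀ i ∈ S, u i ≤ a := fun i hi => le_of_pow_four_le ha <|
    (single_le_sum (f := fun i => u i ^ 4) (fun j _ => pow_nonneg (hu j) 4) hi).trans hua
  have hvb' : ∀ i ∈ S, v i ≤ b := fun i hi => le_of_pow_four_le hb <|
    (single_le_sum (f := fun i => v i ^ 4) (fun j _ => pow_nonneg (hv j) 4) hi).trans hvb
  have h1 : ∑ i ∈ S, ∑ j ∈ S, k i j * (u i ^ 2 * v j ^ 2) ≤ M * (a ^ 2 * b ^ 2) := by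
    apply le_of_pow_le_pow_left₀ two_ne_zero (by positivity)
    refine (schur_sq k hk hsymm S M hM u v).trans ?_
    calc _ ≤ (M * a ^ 4) * (M * b ^ 4) := by gcongr
      _ = _ := by ring
  calc _ ≤ ∑ i ∈ S, ∑ j ∈ S, (a * b) * (k i j * (u i ^ 2 * v j ^ 2)) := by
        refine sum_le_sum fun i hi => sum_le_sum fun j hj => ?_
        have h2 : u i * v j ≤ a * b := mul_le_mul (hua' i hi) (hvb' j hj) (hv j) ha
        have h3 : 0 ≤ k i j * (u i ^ 2 * v j ^ 2) := mul_nonneg (hk i j) (by positivity)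
        calc _ = (u i * v j) * (k i j * (u i ^ 2 * v j ^ 2)) := by ring
          _ ≤ _ := by gcongr
    _ = (a * b) * ∑ i ∈ S, ∑ j ∈ S, k i j * (u i ^ 2 * v j ^ 2) := by
        simp_rw [mul_sum]
    _ ≤ (a * b) * (M * (a ^ 2 * b ^ 2)) := by gcongr
    _ = _ := by ring

lemma sum_sum_split (S : Finset ℕ) {m : ℕ} (hm : m ∈ S) (B : ℕ → ℕ → ℝ) :
    ∑ i ∈ S, ∑ j ∈ S, B i j = B m m + ∑ j ∈ S.erase m, B m j + ∑ i ∈ S.erase m, B i m +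
      ∑ i ∈ S.erase m, ∑ j ∈ S.erase m, B i j := by
  rw [← add_sum_erase S _ hm, ← add_sum_erase S (B m) hm]
  have : ∀ i ∈ S.erase m, ∑ j ∈ S, B i j = B i m + ∑ j ∈ S.erase m, B i j :=
    fun i _ => (add_sum_erase S (B i) hm).symm
  rw [sum_congr rfl this, sum_add_distrib]
  ring

/-- The entrywise bound on the matrix `B` in the local inequality. -/
def EntryBound (r f : ℝ) (u v : ℕ → ℝ) (B : ℕ → ℕ → ℝ) : Prop :=
  ∀ i j, B i j ≤ (if i = j then 1 else f) * (decay r i j * (u i ^ 3 * v j ^ 3))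

lemma EntryBound.le {r f : ℝ} {u v : ℕ → ℝ} {B : ℕ → ℕ → ℝ} (hB : EntryBound r f u v B)
    (hr : 0 ≤ r) (hf : 1 ≤ f) (hu : ∀ i, 0 ≤ u i) (hv : ∀ i, 0 ≤ v i) (i j : ℕ) :
    B i j ≤ f * (decay r i j * (u i ^ 3 * v j ^ 3)) := by
  refine (hB i j).trans ?_
  have h1 : 0 ≤ decay r i j * (u i ^ 3 * v j ^ 3) :=
    mul_nonneg (decay_nonneg hr i j) (mul_nonneg (pow_nonneg (hu i) 3) (pow_nonneg (hv j) 3))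
  apply mul_le_mul_of_nonneg_right _ h1
  split_ifs <;> linarith

lemma EntryBound.swap {r f : ℝ} {u v : ℕ → ℝ} {B : ℕ → ℕ → ℝ} (hB : EntryBound r f u v B) :
    EntryBound r f v u (fun i j => B j i) := by
  intro i j
  have := hB j i
  rw [decay_comm r i j]
  simp only [eq_comm (a := i) (b := j)]
  linarith [mul_comm (u j ^ 3) (v i ^ 3)]

lemma EntryBound.sum_le {r f : ℝ} {u v : ℕ → ℝ} {B : ℕ → ℕ → ℝ} (hB : EntryBound r f u v B)
    (hr : 0 ≤ r) (hr1 : r < 1) (hf : 1 ≤ f) (hu : ∀ i, 0 ≤ u i) (hv : ∀ i, 0 ≤ v i)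
    (S : Finset ℕ) (a b : ℝ) (ha : 0 ≤ a) (hb : 0 ≤ b)
    (hua : ∑ i ∈ S, u i ^ 4 ≤ a ^ 4) (hvb : ∑ i ∈ S, v i ^ 4 ≤ b ^ 4) :
    ∑ i ∈ S, ∑ j ∈ S, B i j ≤ f * (2 / (1 - r) * (a ^ 3 * b ^ 3)) := by
  have h := schur_four (decay r) (decay_nonneg hr) (decay_comm r) S (2 / (1 - r))
    (div_nonneg (by norm_num) (by linarith)) (fun i _ => sum_decay_le hr hr1 S i) u v hu hv a b
    ha hb hua hvb
  calc _ ≤ ∑ i ∈ S, ∑ j ∈ S, f * (decay r i j * (u i ^ 3 * v j ^ 3)) :=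
        sum_le_sum fun i _ => sum_le_sum fun j _ => hB.le hr hf hu hv i j
    _ = f * ∑ i ∈ S, ∑ j ∈ S, decay r i j * (u i ^ 3 * v j ^ 3) := by simp_rw [mul_sum]
    _ ≤ _ := by gcongr

lemma EntryBound.sum_le_of_diag {r f κ : ℝ} {u v : ℕ → ℝ} {B : ℕ → ℕ → ℝ}
    (hB : EntryBound r f u v B)
    (hr : 0 ≤ r) (hr1 : r ≤ 1 / 2) (hf8 : f ≤ 8) (hrκ : 32 * r ≤ κ)
    (hu : ∀ i, 0 ≤ u i) (hv : ∀ i, 0 ≤ v i)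
    (S : Finset ℕ) (hu1 : ∑ i ∈ S, u i ^ 4 = 1) (hv1 : ∑ i ∈ S, v i ^ 4 = 1)
    (hκ1 : κ ≤ 1) (hκ : ∀ i ∈ S, u i * v i ≤ 1 - κ) :
    ∑ i ∈ S, ∑ j ∈ S, B i j ≤ 1 := by
  have h := schur_four (fun i j => if i = j then 0 else decay r i j)
    (fun i j => by split_ifs; exacts [le_rfl, decay_nonneg hr i j])
    (fun i j => by simp only [decay_comm r i j, eq_comm (a := i)]) S (4 * r) (by positivity)
    (fun i _ => by
      have h1 := sum_decay_erase_le hr (by linarith) S i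
      have h2 : 2 * r / (1 - r) ≤ 4 * r := by
        rw [div_le_iff₀ (by linarith)]; nlinarith
      refine le_trans (le_of_eq ?_) (h1.trans h2)
      have : S.erase i = S.filter (fun j => i ≠ j) := by
        ext j; simp [eq_comm, and_comm]
      rw [this, sum_filter]
      exact sum_congr rfl fun j _ => by by_cases hij : i = j <;> simp [hij])
    u v hu hv 1 1 (by norm_num) (by norm_num) (by rw [hu1]; norm_num) (by rw [hv1]; norm_num)
  have hd : ∑ i ∈ S, u i ^ 3 * v i ^ 3 ≤ 1 - κ := by
    calc _ ≤ ∑ i ∈ S, (1 - κ) * ((u i ^ 4 + v i ^ 4) / 2) := by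
          refine sum_le_sum fun i hi => ?_
          have h1 : u i ^ 2 * v i ^ 2 ≤ (u i ^ 4 + v i ^ 4) / 2 := by
            nlinarith [sq_nonneg (u i ^ 2 - v i ^ 2)]
          calc _ = (u i * v i) * (u i ^ 2 * v i ^ 2) := by ring
            _ ≤ (1 - κ) * ((u i ^ 4 + v i ^ 4) / 2) :=
              mul_le_mul (hκ i hi) h1 (by positivity) (by linarith)
      _ = (1 - κ) * ((∑ i ∈ S, u i ^ 4 + ∑ i ∈ S, v i ^ 4) / 2) := by
          rw [← mul_sum, ← sum_div, sum_add_distrib]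
      _ = _ := by rw [hu1, hv1]; ring
  calc _ ≤ ∑ i ∈ S, ∑ j ∈ S, ((if i = j then u i ^ 3 * v i ^ 3 else 0) +
          f * ((if i = j then 0 else decay r i j) * (u i ^ 3 * v j ^ 3))) := by
        refine sum_le_sum fun i _ => sum_le_sum fun j _ => (hB i j).trans (le_of_eq ?_)
        by_cases hij : i = j
        · subst hij; simp [decay]
        · simp [hij]
    _ = ∑ i ∈ S, u i ^ 3 * v i ^ 3 + f * ∑ i ∈ S, ∑ j ∈ S,
          ((if i = j then 0 else decay r i j) * (u i ^ 3 * v j ^ 3)) := by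
        simp_rw [sum_add_distrib, ← mul_sum]
        congr 1
        refine sum_congr rfl fun i hi => ?_
        simp [hi]
    _ ≤ (1 - κ) + 8 * (4 * r * (1 ^ 3 * 1 ^ 3)) := by
        gcongr
        · exact sum_nonneg fun i _ => sum_nonneg fun j _ => mul_nonneg
            (by split_ifs; exacts [le_rfl, decay_nonneg hr i j])
            (mul_nonneg (pow_nonneg (hu i) 3) (pow_nonneg (hv j) 3))
    _ ≤ 1 := by linarith

lemma EntryBound.sum_row_le {r f : ℝ} {u v : ℕ → ℝ} {B : ℕ → ℕ → ℝ}
    (hB : EntryBound r f u v B)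
    (hr : 0 ≤ r) (hr1 : r ≤ 1 / 2) (hf : 1 ≤ f) (hf8 : f ≤ 8)
    (hu : ∀ i, 0 ≤ u i) (hv : ∀ i, 0 ≤ v i) (S : Finset ℕ) {m : ℕ} (hum : u m ≤ 1)
    (b : ℝ) (hb : 0 ≤ b) (hvb : ∑ i ∈ S.erase m, v i ^ 4 ≤ b ^ 4) :
    ∑ j ∈ S.erase m, B m j ≤ 32 * (r * b ^ 3) := by
  have hvb' : ∀ i ∈ S.erase m, v i ≤ b := fun i hi => le_of_pow_four_le hb <|
    (single_le_sum (f := fun i => v i ^ 4) (fun j _ => pow_nonneg (hv j) 4) hi).trans hvb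
  have h1 := sum_decay_erase_le hr (by linarith) S m
  have h2 : 2 * r / (1 - r) ≤ 4 * r := by
    rw [div_le_iff₀ (by linarith)]; nlinarith
  calc _ ≤ ∑ j ∈ S.erase m, 8 * (decay r m j * (1 ^ 3 * b ^ 3)) := by
        refine sum_le_sum fun j hj => (hB.le hr hf hu hv m j).trans ?_
        have := hu m; have := hv j; have := hvb' j hj; have := decay_nonneg hr m j
        gcongr
    _ = 8 * ((∑ j ∈ S.erase m, decay r m j) * b ^ 3) := by
        rw [← mul_sum, ← sum_mul]; ring
    _ ≤ 8 * ((4 * r) * b ^ 3) := by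
        have := h1.trans h2
        gcongr
    _ = _ := by ring

lemma EntryBound.sum_le_of_far {r f : ℝ} {u v : ℕ → ℝ} {B : ℕ → ℕ → ℝ}
    (hB : EntryBound r f u v B)
    (hr : 0 ≤ r) (hr1 : r ≤ 1 / 2) (hf : 1 ≤ f) (hf8 : f ≤ 8)
    (hu : ∀ i, 0 ≤ u i) (hv : ∀ i, 0 ≤ v i)
    (S : Finset ℕ) {m : ℕ} (hm : m ∈ S) (a b : ℝ) (ha : 0 ≤ a) (hb : 0 ≤ b)
    (hua : ∑ i ∈ S.erase m, u i ^ 4 = a ^ 4) (hvb : ∑ i ∈ S.erase m, v i ^ 4 = b ^ 4)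
    (hum : u m ^ 4 = 1 - a ^ 4) (hvm : v m ^ 4 = 1 - b ^ 4)
    (ha1 : 832 * a ^ 2 ≤ 1) (hb1 : 832 * b ^ 2 ≤ 1) (hfar : 512 * r ≤ max a b) :
    ∑ i ∈ S, ∑ j ∈ S, B i j ≤ 1 := by
  have hum1 : u m ≤ 1 := le_of_pow_four_le zero_le_one (by rw [hum]; nlinarith [pow_nonneg ha 4])
  have hvm1 : v m ≤ 1 := le_of_pow_four_le zero_le_one (by rw [hvm]; nlinarith [pow_nonneg hb 4])
  rw [sum_sum_split S hm]
  have h1 := hB.sum_row_le hr hr1 hf hf8 hu hv S hum1 b hb hvb.le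
  have h2 : ∑ i ∈ S.erase m, B i m ≤ 32 * (r * a ^ 3) :=
    hB.swap.sum_row_le hr hr1 hf hf8 hv hu S hvm1 a ha hua.le
  have h3 := hB.sum_le hr (by linarith) hf hu hv (S.erase m) a b ha hb hua.le hvb.le
  have h4 : B m m ≤ u m ^ 3 * v m ^ 3 := by
    have := hB m m
    simpa [decay] using this
  have h5 : ∀ x : ℝ, 0 ≤ x → 4 * x ^ 3 ≤ 1 + 3 * x ^ 4 := fun x hx => by
    nlinarith [mul_nonneg (sq_nonneg (x - 1)) (by positivity : 0 ≤ 3 * x ^ 2 + 2 * x + 1)]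
  have hu3 := h5 (u m) (hu m)
  have hv3 := h5 (v m) (hv m)
  have hu31 : u m ^ 3 ≤ 1 := pow_le_one₀ (hu m) hum1
  have hv31 : v m ^ 3 ≤ 1 := pow_le_one₀ (hv m) hvm1
  have hu30 := pow_nonneg (hu m) 3
  have hv30 := pow_nonneg (hv m) 3
  have h6 : u m ^ 3 * v m ^ 3 ≤ 1 - 3 / 8 * (a ^ 4 + b ^ 4) := by
    nlinarith
  set s := max a b with hs
  have has : a ≤ s := le_max_left _ _
  have hbs : b ≤ s := le_max_right _ _
  have hs0 : 0 ≤ s := ha.trans has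
  have hs2 : 832 * s ^ 2 ≤ 1 := by
    rcases max_choice a b with h | h <;> rw [hs, h] <;> assumption
  have hs4 : s ^ 4 ≤ a ^ 4 + b ^ 4 := by
    have := pow_nonneg ha 4; have := pow_nonneg hb 4
    rcases max_choice a b with h | h <;> rw [hs, h] <;> linarith
  have h7 : 2 / (1 - r) ≤ 4 := by
    rw [div_le_iff₀ (by linarith)]; linarith
  have h8 : f * (2 / (1 - r) * (a ^ 3 * b ^ 3)) ≤ 8 * (4 * (s ^ 3 * s ^ 3)) := by
    have : 0 ≤ 2 / (1 - r) := div_nonneg (by norm_num) (by linarith)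
    gcongr
  have h9 : 32 * (r * b ^ 3) ≤ 32 * (r * s ^ 3) := by gcongr
  have h10 : 32 * (r * a ^ 3) ≤ 32 * (r * s ^ 3) := by gcongr
  have h11 : 512 * (r * s ^ 3) ≤ s ^ 4 := by
    nlinarith [pow_nonneg hs0 3]
  have h12 : 832 * (s ^ 3 * s ^ 3) ≤ s ^ 4 := by
    nlinarith [pow_nonneg hs0 4]
  have h13 := h3.trans h8
  have h14 : 0 ≤ s ^ 4 := by positivity
  linarith

lemma EntryBound.sum_range_le {r f c : ℝ} {u v : ℕ → ℝ} {B : ℕ → ℕ → ℝ}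
    (hB : EntryBound r f u v B)
    (hr : 0 ≤ r) (hr1 : r ≤ 1 / 2) (hf : 1 ≤ f) (hf8 : f ≤ 8)
    (hu : ∀ i, 0 ≤ u i) (hv : ∀ i, 0 ≤ v i) {m : ℕ} (hum : u (m + 1) ≤ 1)
    (hc : 0 ≤ c) (hvc : ∀ j < m + 1, v j ≤ c * r) :
    ∑ j ∈ range (m + 1), B (m + 1) j ≤
      r ^ 4 / 4 + 3 / 4 * v m ^ 4 + 16 * c ^ 3 * r ^ 5 + c ^ 3 * ((f - 1) * r ^ 4) := by
  have h1 : ∑ j ∈ range m, decay r (m + 1) j ≤ r ^ 2 / (1 - r) := by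
    apply sum_pow_le_of_injOn hr (by linarith)
    · intro x hx y hy hxy
      simp at hx hy hxy
      omega
    · intro j hj
      simp at hj
      omega
  have h2 : r ^ 2 / (1 - r) ≤ 2 * r ^ 2 := by
    rw [div_le_iff₀ (by linarith)]; nlinarith [sq_nonneg r]
  rw [sum_range_succ]
  have h3 : ∑ j ∈ range m, B (m + 1) j ≤ 16 * c ^ 3 * r ^ 5 := by
    calc _ ≤ ∑ j ∈ range m, 8 * (decay r (m + 1) j * (1 ^ 3 * (c * r) ^ 3)) := by
          refine sum_le_sum fun j hj => (hB.le hr hf hu hv _ j).trans ?_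
          have := hu (m + 1); have := hv j
          have := hvc j (by simp at hj; omega)
          have := decay_nonneg hr (m + 1) j
          gcongr
      _ = 8 * ((∑ j ∈ range m, decay r (m + 1) j) * (c * r) ^ 3) := by
          rw [← mul_sum, ← sum_mul]; ring
      _ ≤ 8 * ((2 * r ^ 2) * (c * r) ^ 3) := by
          have := h1.trans h2
          gcongr
      _ = _ := by ring
  have h4 : B (m + 1) m ≤ f * (r * v m ^ 3) := by
    refine (hB.le hr hf hu hv _ m).trans ?_
    have : decay r (m + 1) m = r := by simp [decay]
    rw [this]
    have h5 : u (m + 1) ^ 3 ≤ 1 := pow_le_one₀ (hu _) hum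
    have := hv m
    have h6 : u (m + 1) ^ 3 * v m ^ 3 ≤ 1 * v m ^ 3 := by gcongr
    rw [one_mul] at h6
    gcongr
  have h5 : r * v m ^ 3 ≤ r ^ 4 / 4 + 3 / 4 * v m ^ 4 := by
    have h0 := hv m
    nlinarith [mul_nonneg (sq_nonneg (r - v m))
      (by positivity : 0 ≤ r ^ 2 + 2 * r * v m + 3 * v m ^ 2)]
  have h6 : (f - 1) * (r * v m ^ 3) ≤ c ^ 3 * ((f - 1) * r ^ 4) := by
    have := hvc m (by omega)
    have h0 := hv m
    have hf0 : 0 ≤ f - 1 := by linarith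
    calc _ ≤ (f - 1) * (r * (c * r) ^ 3) := by gcongr
      _ = _ := by ring
  linarith

/-- The bound for the blocks `min i j = m` in the local inequality. -/
def BlockBound (r : ℝ) (R : ℕ) (u v : ℕ → ℝ) (B : ℕ → ℕ → ℝ) : Prop :=
  ∀ (m : ℕ) (a b : ℝ), 0 ≤ a → 0 ≤ b → a ^ 4 = ∑ i ∈ Ico m R, u i ^ 4 →
    b ^ 4 = ∑ i ∈ Ico m R, v i ^ 4 →
    ∑ i ∈ range R, ∑ j ∈ range R, (if min i j = m then B i j else 0) ≤
      (if m = 0 then 1 else √(1 - r ^ 4)) * (a ^ 3 * b ^ 3)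

lemma exists_fourth_root {x : ℝ} (hx : 0 ≤ x) : ∃ a : ℝ, 0 ≤ a ∧ a ^ 4 = x :=
  ⟨√(√x), Real.sqrt_nonneg _, by
    rw [show (4 : ℕ) = 2 * 2 by norm_num, pow_mul, Real.sq_sqrt (Real.sqrt_nonneg _),
      Real.sq_sqrt hx]⟩

lemma sum_near_pointwise {R m : ℕ} (hm : m ∈ range R) (B : ℕ → ℕ → ℝ) :
    ∑ i ∈ range R, ∑ j ∈ range R, B i j ≤
      ∑ i ∈ range R, ∑ j ∈ range R, (if min i j = m then B i j else 0) +
      (∑ j ∈ range m, B m j + ∑ i ∈ range m, B i m) +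
      ∑ i ∈ (range R).erase m, ∑ j ∈ (range R).erase m, (if min i j = m then 0 else B i j) := by
  have h1 : ∑ i ∈ range R, ∑ j ∈ range R, B i j =
      ∑ i ∈ range R, ∑ j ∈ range R, (if min i j = m then B i j else 0) +
      ∑ i ∈ range R, ∑ j ∈ range R, (if min i j = m then 0 else B i j) := by
    simp_rw [← sum_add_distrib]
    refine sum_congr rfl fun i _ => sum_congr rfl fun j _ => ?_
    split_ifs <;> simp
  have hmR : m < R := by simpa using hm
  have hrow : ∀ g : ℕ → ℝ, ∑ j ∈ (range R).erase m, (if m ≤ j then 0 else g j) =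
      ∑ j ∈ range m, g j := by
    intro g
    have : range m = ((range R).erase m).filter (fun j => ¬ m ≤ j) := by
      ext j; simp; omega
    rw [this, sum_filter]
    exact sum_congr rfl fun j _ => by by_cases h : m ≤ j <;> simp [h]
  rw [h1, sum_sum_split (range R) hm (fun i j => if min i j = m then 0 else B i j)]
  have h2 : ∑ j ∈ (range R).erase m, (if min m j = m then 0 else B m j) =
      ∑ j ∈ range m, B m j := by
    rw [← hrow]; simp only [min_eq_left_iff]
  have h3 : ∑ j ∈ (range R).erase m, (if min j m = m then 0 else B j m) =
      ∑ j ∈ range m, B j m := by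
    rw [← hrow]; simp only [min_eq_right_iff]
  rw [h2, h3]
  simp only [min_self, if_true]
  linarith

lemma near_block_bound {q x y M : ℝ} (hq : 0 ≤ q) (hx : 0 ≤ x) (hy : 0 ≤ y) (hM : 0 ≤ M)
    (hxy : x * y ≤ M) (hqx : q * x ≤ M) (hqy : q * y ≤ M) :
    (1 - q / 2) * ((1 - 3 / 4 * x) * (1 - 3 / 4 * y)) ≤
      1 - q / 2 - 3 / 4 * x - 3 / 4 * y + 2 * M := by
  have h : 0 ≤ q * (x * y) := by positivity
  calc _ = 1 - q / 2 - 3 / 4 * x - 3 / 4 * y + 9 / 16 * (x * y) + 3 / 8 * (q * x) +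
        3 / 8 * (q * y) - 9 / 32 * (q * (x * y)) := by ring
    _ ≤ _ := by linarith

lemma EntryBound.sum_le_of_near {r f c : ℝ} {u v : ℕ → ℝ} {B : ℕ → ℕ → ℝ} {R : ℕ}
    (hB : EntryBound r f u v B) (hblock : BlockBound r R u v B) (hB0 : ∀ i j, 0 ≤ B i j)
    (hr : 0 ≤ r) (hr1 : r ≤ 1 / 2) (hf : 1 ≤ f) (hf8 : f ≤ 8)
    (hu : ∀ i, 0 ≤ u i) (hv : ∀ i, 0 ≤ v i)
    {m : ℕ} (hm : m ∈ range R) (a b : ℝ) (ha : 0 ≤ a) (hb : 0 ≤ b)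
    (hua : ∑ i ∈ (range R).erase m, u i ^ 4 = a ^ 4)
    (hvb : ∑ i ∈ (range R).erase m, v i ^ 4 = b ^ 4)
    (hum : u m ^ 4 = 1 - a ^ 4) (hvm : v m ^ 4 = 1 - b ^ 4)
    (hc : 1 ≤ c) (hac : a ≤ c * r) (hbc : b ≤ c * r) :
    ∑ i ∈ range R, ∑ j ∈ range R, B i j ≤
      1 + 100 * c ^ 8 * r ^ 5 + 2 * c ^ 3 * ((f - 1) * r ^ 4) := by
  have hum1 : u m ≤ 1 := le_of_pow_four_le zero_le_one (by rw [hum]; nlinarith [pow_nonneg ha 4])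
  have hvm1 : v m ≤ 1 := le_of_pow_four_le zero_le_one (by rw [hvm]; nlinarith [pow_nonneg hb 4])
  have hmR : m < R := by simpa using hm
  have h1 := sum_near_pointwise hm B
  have h2 : ∑ i ∈ (range R).erase m, ∑ j ∈ (range R).erase m,
      (if min i j = m then 0 else B i j) ≤ 32 * c ^ 8 * r ^ 5 := by
    calc _ ≤ ∑ i ∈ (range R).erase m, ∑ j ∈ (range R).erase m, B i j := by
          refine sum_le_sum fun i _ => sum_le_sum fun j _ => ?_
          split_ifs
          exacts [hB0 i j, le_rfl]
      _ ≤ f * (2 / (1 - r) * (a ^ 3 * b ^ 3)) :=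
          hB.sum_le hr (by linarith) hf hu hv _ a b ha hb hua.le hvb.le
      _ ≤ 8 * (4 * ((c * r) ^ 3 * (c * r) ^ 3)) := by
          have : 0 ≤ 2 / (1 - r) := div_nonneg (by norm_num) (by linarith)
          have h7 : 2 / (1 - r) ≤ 4 := by
            rw [div_le_iff₀ (by linarith)]; linarith
          gcongr
      _ = 32 * c ^ 6 * r ^ 6 := by ring
      _ ≤ _ := by
          have h3 : r ^ 6 ≤ r ^ 5 := pow_le_pow_of_le_one hr (by linarith) (by norm_num)
          have h4 : c ^ 6 ≤ c ^ 8 := pow_le_pow_right₀ hc (by norm_num)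
          gcongr
  obtain ⟨A, hA0, hA⟩ := exists_fourth_root
    (sum_nonneg (s := Ico m R) fun i _ => pow_nonneg (hu i) 4)
  obtain ⟨A', hA'0, hA'⟩ := exists_fourth_root
    (sum_nonneg (s := Ico m R) fun i _ => pow_nonneg (hv i) 4)
  have h3 := hblock m A A' hA0 hA'0 hA hA'
  have hu1 : ∑ i ∈ range R, u i ^ 4 = 1 := by
    rw [← add_sum_erase _ _ hm, hum, hua]; ring
  have hv1 : ∑ i ∈ range R, v i ^ 4 = 1 := by
    rw [← add_sum_erase _ _ hm, hvm, hvb]; ring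
  have hsplit : ∀ g : ℕ → ℝ, ∑ i ∈ range R, g i = ∑ i ∈ range m, g i + ∑ i ∈ Ico m R, g i :=
    fun g => (sum_range_add_sum_Ico g hmR.le).symm
  have hcr : 0 ≤ c ^ 8 * r ^ 5 := by positivity
  have hc0 : 0 ≤ c := by linarith
  have hfr : 0 ≤ c ^ 3 * ((f - 1) * r ^ 4) :=
    mul_nonneg (by positivity) (mul_nonneg (by linarith) (by positivity))
  rcases m with _ | m
  · have hA1 : A ^ 4 = 1 := by
      rw [hA, ← hu1, hsplit]; simp
    have hA'1 : A' ^ 4 = 1 := by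
      rw [hA', ← hv1, hsplit]; simp
    have hAle : A ≤ 1 := le_of_pow_four_le zero_le_one (by rw [hA1]; norm_num)
    have hA'le : A' ≤ 1 := le_of_pow_four_le zero_le_one (by rw [hA'1]; norm_num)
    have h4 : A ^ 3 * A' ^ 3 ≤ 1 :=
      mul_le_one₀ (pow_le_one₀ hA0 hAle) (by positivity) (pow_le_one₀ hA'0 hA'le)
    simp only [if_true, one_mul, range_zero, sum_empty, add_zero] at h1 h3
    linarith
  · set x := u m ^ 4 with hx
    set y := v m ^ 4 with hy
    have hva : ∀ j < m + 1, v j ≤ c * r := fun j hj => (le_of_pow_four_le hb (by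
      rw [← hvb]
      exact single_le_sum (f := fun i => v i ^ 4) (fun i _ => pow_nonneg (hv i) 4)
        (by simp; omega))).trans hbc
    have hua' : ∀ j < m + 1, u j ≤ c * r := fun j hj => (le_of_pow_four_le ha (by
      rw [← hua]
      exact single_le_sum (f := fun i => u i ^ 4) (fun i _ => pow_nonneg (hu i) 4)
        (by simp; omega))).trans hac
    have h4 := hB.sum_range_le hr hr1 hf hf8 hu hv hum1 hc0 hva
    have h5 : ∑ i ∈ range (m + 1), B i (m + 1) ≤ _ :=
      hB.swap.sum_range_le hr hr1 hf hf8 hv hu hvm1 hc0 hua'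
    have hAx : A ^ 4 ≤ 1 - x := by
      have h6 := hsplit (fun i => u i ^ 4)
      rw [hu1, ← hA] at h6
      have h7 : x ≤ ∑ i ∈ range (m + 1), u i ^ 4 :=
        single_le_sum (f := fun i => u i ^ 4) (fun i _ => pow_nonneg (hu i) 4) (by simp)
      linarith
    have hAy : A' ^ 4 ≤ 1 - y := by
      have h6 := hsplit (fun i => v i ^ 4)
      rw [hv1, ← hA'] at h6
      have h7 : y ≤ ∑ i ∈ range (m + 1), v i ^ 4 :=
        single_le_sum (f := fun i => v i ^ 4) (fun i _ => pow_nonneg (hv i) 4) (by simp)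
      linarith
    have hq : ∀ x : ℝ, 0 ≤ x → 4 * x ^ 3 ≤ 1 + 3 * x ^ 4 := fun x hx => by
      nlinarith [mul_nonneg (sq_nonneg (x - 1)) (by positivity : 0 ≤ 3 * x ^ 2 + 2 * x + 1)]
    have hA3 : A ^ 3 ≤ 1 - 3 / 4 * x := by linarith [hq A hA0]
    have hA'3 : A' ^ 3 ≤ 1 - 3 / 4 * y := by linarith [hq A' hA'0]
    have hr4 : r ^ 4 ≤ 1 := pow_le_one₀ hr (by linarith)
    have hρ : √(1 - r ^ 4) ≤ 1 - r ^ 4 / 2 := by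
      rw [Real.sqrt_le_left (by linarith)]
      nlinarith [sq_nonneg (r ^ 4)]
    have hx0 : 0 ≤ x := pow_nonneg (hu m) 4
    have hy0 : 0 ≤ y := pow_nonneg (hv m) 4
    have hxle : x ≤ c ^ 4 * r ^ 4 := by
      rw [← mul_pow]; exact pow_le_pow_left₀ (hu m) (hua' m (by omega)) 4
    have hyle : y ≤ c ^ 4 * r ^ 4 := by
      rw [← mul_pow]; exact pow_le_pow_left₀ (hv m) (hva m (by omega)) 4
    have hr40 : 0 ≤ r ^ 4 := by positivity
    have h6 : √(1 - r ^ 4) * (A ^ 3 * A' ^ 3) ≤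
        (1 - r ^ 4 / 2) * ((1 - 3 / 4 * x) * (1 - 3 / 4 * y)) := by
      have h7 : 0 ≤ 1 - 3 / 4 * x := (pow_nonneg hA0 3).trans hA3
      have h8 : 0 ≤ 1 - r ^ 4 / 2 := by linarith
      exact mul_le_mul hρ (mul_le_mul hA3 hA'3 (by positivity) h7) (by positivity) h8
    have hr8 : r ^ 8 ≤ r ^ 5 := pow_le_pow_of_le_one hr (by linarith) (by norm_num)
    have hc4 : 1 ≤ c ^ 4 := one_le_pow₀ hc
    have hxy : x * y ≤ c ^ 8 * r ^ 5 := by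
      calc x * y ≤ (c ^ 4 * r ^ 4) * (c ^ 4 * r ^ 4) := by gcongr
        _ = c ^ 8 * r ^ 8 := by ring
        _ ≤ _ := by gcongr
    have hrle : r ^ 4 ≤ c ^ 4 * r ^ 4 := le_mul_of_one_le_left hr40 hc4
    have hrx : r ^ 4 * x ≤ c ^ 8 * r ^ 5 := by
      calc r ^ 4 * x ≤ (c ^ 4 * r ^ 4) * (c ^ 4 * r ^ 4) := by gcongr
        _ = c ^ 8 * r ^ 8 := by ring
        _ ≤ _ := by gcongr
    have hry : r ^ 4 * y ≤ c ^ 8 * r ^ 5 := by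
      calc r ^ 4 * y ≤ (c ^ 4 * r ^ 4) * (c ^ 4 * r ^ 4) := by gcongr
        _ = c ^ 8 * r ^ 8 := by ring
        _ ≤ _ := by gcongr
    have hc3 : c ^ 3 * r ^ 5 ≤ c ^ 8 * r ^ 5 := by
      have : c ^ 3 ≤ c ^ 8 := pow_le_pow_right₀ hc (by norm_num)
      gcongr
    have h7 : (1 - r ^ 4 / 2) * ((1 - 3 / 4 * x) * (1 - 3 / 4 * y)) ≤
        1 - r ^ 4 / 2 - 3 / 4 * x - 3 / 4 * y + 2 * (c ^ 8 * r ^ 5) :=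
      near_block_bound hr40 hx0 hy0 hcr hxy hrx hry
    rw [if_neg (Nat.succ_ne_zero m)] at h3
    have h8 := h3.trans (h6.trans h7)
    linarith

theorem local_inequality_normalized : ∃ C : ℝ, 0 < C ∧ ∀ (r f : ℝ) (R : ℕ) (u v : ℕ → ℝ)
    (B : ℕ → ℕ → ℝ), 0 ≤ r → r ^ 4 ≤ 1 / 2 → 1 ≤ f → f ≤ 8 → (∀ i, 0 ≤ u i) → (∀ i, 0 ≤ v i) →
    ∑ i ∈ range R, u i ^ 4 = 1 → ∑ i ∈ range R, v i ^ 4 = 1 → (∀ i j, 0 ≤ B i j) →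
    EntryBound r f u v B → BlockBound r R u v B →
    ∑ i ∈ range R, ∑ j ∈ range R, B i j ≤ 1 + C * (r ^ 5 + (f - 1) * r ^ 4) := by
  refine ⟨10 ^ 50, by norm_num, fun r f R u v B hr hr4 hf hf8 hu hv hu1 hv1 hB0 hB hblock => ?_⟩
  have hfr : 0 ≤ (f - 1) * r ^ 4 := mul_nonneg (by linarith) (by positivity)
  have hr5 : 0 ≤ r ^ 5 := by positivity
  by_cases hr0 : r ≤ 1 / 10 ^ 9
  swap
  · push Not at hr0
    have hr85 : r ≤ 17 / 20 := le_of_pow_four_le (by norm_num) (by norm_num at hr4 ⊢; linarith)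
    have h1 := hB.sum_le hr (by linarith) hf hu hv (range R) 1 1 zero_le_one zero_le_one
      (by rw [hu1]; norm_num) (by rw [hv1]; norm_num)
    have h2 : 2 / (1 - r) ≤ 14 := by rw [div_le_iff₀ (by linarith)]; linarith
    have h3 : f * (2 / (1 - r) * (1 ^ 3 * 1 ^ 3)) ≤ 8 * (14 * (1 ^ 3 * 1 ^ 3)) := by
      have : 0 ≤ 2 / (1 - r) := div_nonneg (by norm_num) (by linarith)
      gcongr
    have h4 : (1 / 10 ^ 9 : ℝ) ^ 5 ≤ r ^ 5 := by gcongr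
    norm_num at h4 h3 ⊢
    linarith
  by_cases hdiag : ∀ i ∈ range R, u i * v i ≤ 1 - 1 / 10 ^ 7
  · have h1 := hB.sum_le_of_diag hr (by norm_num at hr0 ⊢; linarith) hf8
      (κ := 1 / 10 ^ 7) (by norm_num at hr0 ⊢; linarith) hu hv (range R) hu1 hv1 (by norm_num) hdiag
    linarith
  push Not at hdiag
  obtain ⟨m, hm, hmuv⟩ := hdiag
  obtain ⟨a, ha, hua⟩ := exists_fourth_root
    (sum_nonneg (s := (range R).erase m) fun i _ => pow_nonneg (hu i) 4)
  obtain ⟨b, hb, hvb⟩ := exists_fourth_root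
    (sum_nonneg (s := (range R).erase m) fun i _ => pow_nonneg (hv i) 4)
  have hum : u m ^ 4 = 1 - a ^ 4 := by
    rw [← add_sum_erase _ _ hm, ← hua] at hu1; linarith
  have hvm : v m ^ 4 = 1 - b ^ 4 := by
    rw [← add_sum_erase _ _ hm, ← hvb] at hv1; linarith
  have hum1 : u m ≤ 1 := le_of_pow_four_le zero_le_one (by rw [hum]; nlinarith [pow_nonneg ha 4])
  have hvm1 : v m ≤ 1 := le_of_pow_four_le zero_le_one (by rw [hvm]; nlinarith [pow_nonneg hb 4])
  have key : ∀ x y a : ℝ, 0 ≤ x → 0 ≤ y → x ≤ 1 → y ≤ 1 → 1 - 1 / 10 ^ 7 < x * y →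
      x ^ 4 = 1 - a ^ 4 → 832 * a ^ 2 ≤ 1 := by
    intro x y a hx hy hx1 hy1 hxy hxa
    have h1 : 1 - 1 / 10 ^ 7 < x := by nlinarith
    have h2 : (1 - 1 / 10 ^ 7 : ℝ) ^ 4 ≤ x ^ 4 := by
      apply pow_le_pow_left₀ (by norm_num) h1.le
    have h3 : a ^ 4 ≤ 1 - (1 - 1 / 10 ^ 7 : ℝ) ^ 4 := by linarith
    have h4 : (a ^ 2) ^ 2 ≤ (1 / 832 : ℝ) ^ 2 := by
      rw [← pow_mul]; norm_num at h3 ⊢; linarith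
    have := le_of_pow_le_pow_left₀ two_ne_zero (by norm_num) h4
    linarith
  by_cases hfar : 512 * r ≤ max a b
  · have h1 := hB.sum_le_of_far hr (by norm_num at hr0 ⊢; linarith) hf hf8 hu hv (range R) hm a b
      ha hb hua.symm hvb.symm hum hvm (key _ _ a (hu m) (hv m) hum1 hvm1 hmuv hum)
      (key _ _ b (hv m) (hu m) hvm1 hum1 (by rwa [mul_comm]) hvm) hfar
    linarith
  · push Not at hfar
    have h1 := hB.sum_le_of_near hblock hB0 hr (by norm_num at hr0 ⊢; linarith) hf hf8 hu hv hm a b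
      ha hb hua.symm hvb.symm hum hvm (c := 512) (by norm_num)
      ((le_max_left _ _).trans hfar.le) ((le_max_right _ _).trans hfar.le)
    norm_num at h1 ⊢
    nlinarith

theorem local_inequality : ∃ C : ℝ, 0 < C ∧ ∀ (r f K U V : ℝ) (R : ℕ) (u v : ℕ → ℝ)
    (B : ℕ → ℕ → ℝ), 0 ≤ r → r ^ 4 ≤ 1 / 2 → 1 ≤ f → f ≤ 8 → 0 ≤ K → 0 ≤ U → 0 ≤ V →
    (∀ i, 0 ≤ u i) → (∀ i, 0 ≤ v i) →
    ∑ i ∈ range R, u i ^ 4 = U ^ 4 → ∑ i ∈ range R, v i ^ 4 = V ^ 4 → (∀ i j, 0 ≤ B i j) →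
    (∀ i j, B i j ≤ K * ((if i = j then 1 else f) * (decay r i j * (u i ^ 3 * v j ^ 3)))) →
    (∀ (m : ℕ) (a b : ℝ), 0 ≤ a → 0 ≤ b → a ^ 4 = ∑ i ∈ Ico m R, u i ^ 4 →
      b ^ 4 = ∑ i ∈ Ico m R, v i ^ 4 →
      ∑ i ∈ range R, ∑ j ∈ range R, (if min i j = m then B i j else 0) ≤
        K * ((if m = 0 then 1 else √(1 - r ^ 4)) * (a ^ 3 * b ^ 3))) →
    ∑ i ∈ range R, ∑ j ∈ range R, B i j ≤
      (1 + C * (r ^ 5 + (f - 1) * r ^ 4)) * (K * (U ^ 3 * V ^ 3)) := by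
  obtain ⟨C, hC, h⟩ := local_inequality_normalized
  refine ⟨C, hC, fun r f K U V R u v B hr hr4 hf hf8 hK hU hV hu hv hu1 hv1 hB0 hB hblock => ?_⟩
  have hzero : ∀ (w : ℕ → ℝ) (W : ℝ), ∑ i ∈ range R, w i ^ 4 = W ^ 4 → (∀ i, 0 ≤ w i) → W = 0 →
      ∀ i ∈ range R, w i = 0 := by
    intro w W hw hw0 hW i hi
    rw [hW, zero_pow (by norm_num)] at hw
    have := (sum_eq_zero_iff_of_nonneg fun i _ => pow_nonneg (hw0 i) 4).1 hw i hi
    exact pow_eq_zero_iff (by norm_num) |>.1 this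
  by_cases hKUV : K = 0 ∨ U = 0 ∨ V = 0
  · have h0 : ∀ i ∈ range R, ∀ j ∈ range R, B i j ≤ 0 := by
      intro i hi j hj
      refine (hB i j).trans (le_of_eq ?_)
      rcases hKUV with h | h | h
      · simp [h]
      · simp [hzero u U hu1 hu h i hi]
      · simp [hzero v V hv1 hv h j hj]
    have h1 : K * (U ^ 3 * V ^ 3) = 0 := by rcases hKUV with h | h | h <;> simp [h]
    rw [h1, mul_zero]
    exact sum_nonpos fun i hi => sum_nonpos fun j hj => h0 i hi j hj
  push Not at hKUV
  obtain ⟨hK0, hU0, hV0⟩ := hKUV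
  replace hK : 0 < K := lt_of_le_of_ne hK hK0.symm
  replace hU : 0 < U := lt_of_le_of_ne hU hU0.symm
  replace hV : 0 < V := lt_of_le_of_ne hV hV0.symm
  set N := K * (U ^ 3 * V ^ 3) with hN
  have hN0 : 0 < N := by positivity
  have h1 := h r f R (fun i => u i / U) (fun i => v i / V) (fun i j => B i j / N) hr hr4 hf hf8
    (fun i => div_nonneg (hu i) hU.le) (fun i => div_nonneg (hv i) hV.le)
    (by simp_rw [div_pow]; rw [← sum_div, hu1, div_self (by positivity)])
    (by simp_rw [div_pow]; rw [← sum_div, hv1, div_self (by positivity)])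
    (fun i j => div_nonneg (hB0 i j) hN0.le)
    (fun i j => by
      dsimp only
      rw [div_le_iff₀ hN0]
      refine (hB i j).trans (le_of_eq ?_)
      rw [hN]; field_simp)
    (fun m a b ha hb hau hbv => by
      have h2 := hblock m (U * a) (V * b) (by positivity) (by positivity)
        (by rw [mul_pow, hau, mul_sum]
            exact sum_congr rfl fun i _ => by field_simp)
        (by rw [mul_pow, hbv, mul_sum]
            exact sum_congr rfl fun i _ => by field_simp)
      have h3 : ∑ i ∈ range R, ∑ j ∈ range R, (if min i j = m then B i j / N else 0) =
          (∑ i ∈ range R, ∑ j ∈ range R, (if min i j = m then B i j else 0)) / N := by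
        simp_rw [sum_div]
        refine sum_congr rfl fun i _ => sum_congr rfl fun j _ => ?_
        split_ifs <;> simp
      rw [h3, div_le_iff₀ hN0]
      refine h2.trans (le_of_eq ?_)
      rw [hN]; ring)
  simp_rw [← sum_div] at h1
  rwa [div_le_iff₀ hN0] at h1

lemma sum_edges_le_of_moment {E : Finset (ℕ × ℕ)} {V W : Finset ℕ} (hE : E ⊆ V ×ˢ W)
    {μ ν : ℕ → ℝ} (hμ : ∀ v, 0 ≤ μ v) {x y : ℕ → ℕ}
    (hy : Set.InjOn y W) (hy0 : ∀ w ∈ W, 0 < y w) {G : ℕ → ℝ} {C : ℝ}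
    (hG : ∀ X : ℕ, ∑ n ∈ Icc 1 X, G n ^ 2 / √n ≤ C * √X) (hC : 0 ≤ C)
    {T₁ T₂ : ℝ} (hT₁ : 0 ≤ T₁)
    (h₁ : ∀ e ∈ E, μ e.1 * y e.2 ≤ T₁) (h₂ : ∀ e ∈ E, ν e.2 * x e.1 ≤ T₂) :
    ∑ e ∈ E, μ e.1 * √(μ e.1) * √(ν e.2 * x e.1) * (G (y e.2) ^ 2 / √(y e.2)) ≤
      C * (√T₁ * √T₂) * ∑ v ∈ V, μ v := by
  classical
  have h3 : ∑ e ∈ E, μ e.1 * √(μ e.1) * √(ν e.2 * x e.1) * (G (y e.2) ^ 2 / √(y e.2)) ≤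
      ∑ e ∈ E, μ e.1 * √(μ e.1) * √T₂ * (G (y e.2) ^ 2 / √(y e.2)) := by
    refine sum_le_sum fun e he => ?_
    have := hμ e.1
    have := h₂ e he
    gcongr
  refine h3.trans ?_
  have h4 : ∑ e ∈ E, μ e.1 * √(μ e.1) * √T₂ * (G (y e.2) ^ 2 / √(y e.2)) =
      ∑ v ∈ V, ∑ w ∈ W with (v, w) ∈ E,
        μ v * √(μ v) * √T₂ * (G (y w) ^ 2 / √(y w)) := by
    have : E = (V ×ˢ W).filter (fun e => e ∈ E) := by
      ext e
      simp only [mem_filter]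
      exact ⟨fun h => ⟨hE h, h⟩, fun h => h.2⟩
    conv_lhs => rw [this]
    rw [sum_filter, sum_product]
    refine sum_congr rfl fun v _ => ?_
    rw [sum_filter]
  rw [h4, mul_sum]
  refine sum_le_sum fun v _ => ?_
  rcases (hμ v).eq_or_lt with h0 | h0
  · simp [← h0]
  rw [← mul_sum]
  have h5 : ∑ w ∈ W with (v, w) ∈ E, G (y w) ^ 2 / √(y w) ≤ C * √(T₁ / μ v) := by
    have h6 : ∑ w ∈ W with (v, w) ∈ E, G (y w) ^ 2 / √(y w) =
        ∑ n ∈ (W.filter (fun w => (v, w) ∈ E)).image y, G n ^ 2 / √n := by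
      rw [sum_image]
      intro w hw w' hw' h
      exact hy (mem_filter.1 hw).1 (mem_filter.1 hw').1 h
    have h7 : (W.filter (fun w => (v, w) ∈ E)).image y ⊆ Icc 1 ⌊T₁ / μ v⌋₊ := by
      intro n hn
      obtain ⟨w, hw, rfl⟩ := mem_image.1 hn
      rw [mem_filter] at hw
      have := h₁ _ hw.2
      rw [mem_Icc]
      refine ⟨hy0 w hw.1, Nat.le_floor ?_⟩
      rw [le_div_iff₀ h0, mul_comm]
      exact this
    rw [h6]
    refine (sum_le_sum_of_subset_of_nonneg h7 fun n _ _ => by positivity).trans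
      ((hG _).trans ?_)
    gcongr
    exact Nat.floor_le (by positivity)
  calc _ ≤ μ v * √(μ v) * √T₂ * (C * √(T₁ / μ v)) := by gcongr
    _ = μ v * √T₂ * C * (√(μ v) * √(T₁ / μ v)) := by ring
    _ = _ := by
      rw [← Real.sqrt_mul h0.le, mul_div_cancel₀ _ h0.ne']; ring

lemma sum_edges_le_sqrt {E : Finset (ℕ × ℕ)} {V W : Finset ℕ} (hE : E ⊆ V ×ˢ W)
    {μ : ℕ → ℝ} (hμ : ∀ v, 0 ≤ μ v) {x y : ℕ → ℕ}
    (hx : Set.InjOn x V) (hx0 : ∀ v ∈ V, 0 < x v)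
    (hy : Set.InjOn y W) (hy0 : ∀ w ∈ W, 0 < y w) {G : ℕ → ℝ} {C : ℝ}
    (hG : ∀ X : ℕ, ∑ n ∈ Icc 1 X, G n ^ 2 / √n ≤ C * √X) (hC : 0 ≤ C)
    {T₁ T₂ : ℝ} (hT₁ : 0 ≤ T₁) (hT₂ : 0 ≤ T₂)
    (h₁ : ∀ e ∈ E, μ e.1 * y e.2 ≤ T₁) (h₂ : ∀ e ∈ E, μ e.2 * x e.1 ≤ T₂) :
    ∑ e ∈ E, μ e.1 * μ e.2 * (G (x e.1) * G (y e.2)) ≤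
      C * (√T₁ * √T₂) * (√(∑ v ∈ V, μ v) * √(∑ w ∈ W, μ w)) := by
  classical
  have hP := sum_edges_le_of_moment hE hμ hy hy0 hG hC hT₁ h₁ h₂
  have hQ := sum_edges_le_of_moment (E := E.image Prod.swap) (V := W) (W := V) (μ := μ) (ν := μ)
    (x := y) (y := x) (T₁ := T₂) (T₂ := T₁) (by
      intro e he
      obtain ⟨e', he', rfl⟩ := mem_image.1 he
      have := mem_product.1 (hE he')
      simp [this.1, this.2]) hμ hx hx0 hG hC hT₂
    (by
      intro e he
      obtain ⟨e', he', rfl⟩ := mem_image.1 he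
      exact h₂ e' he')
    (by
      intro e he
      obtain ⟨e', he', rfl⟩ := mem_image.1 he
      exact h₁ e' he')
  rw [sum_image (fun a _ b _ h => Prod.swap_injective h)] at hQ
  simp only [Prod.fst_swap, Prod.snd_swap] at hQ
  set V' := ∑ v ∈ V, μ v
  set W' := ∑ w ∈ W, μ w
  have hV' : 0 ≤ V' := sum_nonneg fun v _ => hμ v
  have hW' : 0 ≤ W' := sum_nonneg fun v _ => hμ v
  apply le_of_pow_le_pow_left₀ two_ne_zero (by positivity)
  have hCS := sum_mul_sq_le_sq_mul_sq E
    (fun e => √(μ e.1 * √(μ e.1) * √(μ e.2 * x e.1) * (1 / √(y e.2))) * G (y e.2))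
    (fun e => √(μ e.2 * √(μ e.2) * √(μ e.1 * y e.2) * (1 / √(x e.1))) * G (x e.1))
  have e1 : ∑ e ∈ E, μ e.1 * μ e.2 * (G (x e.1) * G (y e.2)) = ∑ e ∈ E,
      (√(μ e.1 * √(μ e.1) * √(μ e.2 * x e.1) * (1 / √(y e.2))) * G (y e.2)) *
      (√(μ e.2 * √(μ e.2) * √(μ e.1 * y e.2) * (1 / √(x e.1))) * G (x e.1)) := by
    refine sum_congr rfl fun e he => ?_
    have hm := mem_product.1 (hE he)
    have hx' : (0 : ℝ) < x e.1 := by exact_mod_cast hx0 _ hm.1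
    have hy' : (0 : ℝ) < y e.2 := by exact_mod_cast hy0 _ hm.2
    have m1 := hμ e.1
    have m2 := hμ e.2
    have h3 : √(μ e.1 * √(μ e.1) * √(μ e.2 * x e.1) * (1 / √(y e.2))) *
        √(μ e.2 * √(μ e.2) * √(μ e.1 * y e.2) * (1 / √(x e.1))) = μ e.1 * μ e.2 := by
      rw [← Real.sqrt_mul (by positivity)]
      rw [Real.sqrt_eq_iff_mul_self_eq (by positivity) (by positivity)]
      rw [Real.sqrt_mul m2, Real.sqrt_mul m1]
      have s1 := Real.mul_self_sqrt m1
      have s2 := Real.mul_self_sqrt m2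
      have s3 : √(x e.1 : ℝ) ≠ 0 := (Real.sqrt_pos.2 hx').ne'
      have s4 : √(y e.2 : ℝ) ≠ 0 := (Real.sqrt_pos.2 hy').ne'
      field_simp
      linear_combination (μ e.1 * μ e.2 * (√(μ e.2) * √(μ e.2))) * s1 +
        (μ e.1 * μ e.2 * μ e.1) * s2
    calc _ = (μ e.1 * μ e.2) * (G (x e.1) * G (y e.2)) := rfl
      _ = _ := by rw [← h3]; ring
  rw [e1]
  refine hCS.trans ?_
  have e2 : ∀ e ∈ E, (√(μ e.1 * √(μ e.1) * √(μ e.2 * x e.1) * (1 / √(y e.2))) * G (y e.2)) ^ 2 =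
      μ e.1 * √(μ e.1) * √(μ e.2 * x e.1) * (G (y e.2) ^ 2 / √(y e.2)) := by
    intro e _
    have m1 := hμ e.1
    rw [mul_pow, Real.sq_sqrt (by positivity)]; ring
  have e3 : ∀ e ∈ E, (√(μ e.2 * √(μ e.2) * √(μ e.1 * y e.2) * (1 / √(x e.1))) * G (x e.1)) ^ 2 =
      μ e.2 * √(μ e.2) * √(μ e.1 * y e.2) * (G (x e.1) ^ 2 / √(x e.1)) := by
    intro e _
    have m1 := hμ e.2
    rw [mul_pow, Real.sq_sqrt (by positivity)]; ring
  rw [sum_congr rfl e2, sum_congr rfl e3]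
  calc _ ≤ (C * (√T₁ * √T₂) * V') * (C * (√T₂ * √T₁) * W') := by
        refine mul_le_mul hP hQ (sum_nonneg fun e _ => ?_) (by positivity)
        have := hμ e.2
        positivity
    _ = (C * (√T₁ * √T₂)) ^ 2 * (√V' ^ 2 * √W' ^ 2) := by
        rw [Real.sq_sqrt hV', Real.sq_sqrt hW']; ring
    _ = _ := by ring

/-- The fourth root. -/
noncomputable def root4 (x : ℝ) : ℝ := √(√x)

lemma root4_nonneg (x : ℝ) : 0 ≤ root4 x := Real.sqrt_nonneg _

lemma root4_pow {x : ℝ} (hx : 0 ≤ x) : root4 x ^ 4 = x := by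
  rw [root4, show (4 : ℕ) = 2 * 2 by norm_num, pow_mul, Real.sq_sqrt (Real.sqrt_nonneg _),
      Real.sq_sqrt hx]

lemma root4_sq (x : ℝ) : root4 x ^ 2 = √x := Real.sq_sqrt (Real.sqrt_nonneg _)

lemma root4_mul {x : ℝ} (hx : 0 ≤ x) (y : ℝ) : root4 (x * y) = root4 x * root4 y := by
  rw [root4, Real.sqrt_mul hx, Real.sqrt_mul (Real.sqrt_nonneg _)]; rfl

lemma root4_le_root4 {x y : ℝ} (h : x ≤ y) : root4 x ≤ root4 y :=
  Real.sqrt_le_sqrt (Real.sqrt_le_sqrt h)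

lemma eq_root4_of_pow {a x : ℝ} (ha : 0 ≤ a) (h : a ^ 4 = x) : a = root4 x := by
  subst h
  exact le_antisymm (le_of_pow_four_le (root4_nonneg _) (root4_pow (by positivity)).ge)
    (le_of_pow_four_le ha (root4_pow (by positivity)).le)

lemma sum_edges_le_root4 {E : Finset (ℕ × ℕ)} {V W : Finset ℕ} (hE : E ⊆ V ×ˢ W)
    {μ : ℕ → ℝ} (hμ : ∀ v, 0 ≤ μ v) {x y : ℕ → ℕ}
    (hx : Set.InjOn x V) (hx0 : ∀ v ∈ V, 0 < x v)
    (hy : Set.InjOn y W) (hy0 : ∀ w ∈ W, 0 < y w) {F : ℕ → ℝ} {C : ℝ}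
    (hF : ∀ X : ℕ, ∑ n ∈ Icc 1 X, F n ^ 4 / √n ≤ C * √X) (hC : 0 ≤ C)
    {T₁ T₂ : ℝ} (hT₁ : 0 ≤ T₁) (hT₂ : 0 ≤ T₂)
    (h₁ : ∀ e ∈ E, μ e.1 * y e.2 ≤ T₁) (h₂ : ∀ e ∈ E, μ e.2 * x e.1 ≤ T₂) :
    ∑ e ∈ E, μ e.1 * μ e.2 * (F (x e.1) * F (y e.2)) ≤
      √C * root4 (T₁ * T₂) * (root4 (∑ v ∈ V, μ v) ^ 3 * root4 (∑ w ∈ W, μ w) ^ 3) := by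
  have h := sum_edges_le_sqrt hE hμ hx hx0 hy hy0 (G := fun n => F n ^ 2) (C := C)
    (by simpa only [← pow_mul] using hF) hC hT₁ hT₂ h₁ h₂
  set V' := ∑ v ∈ V, μ v with hV'
  set W' := ∑ w ∈ W, μ w with hW'
  have hV0 : 0 ≤ V' := sum_nonneg fun v _ => hμ v
  have hW0 : 0 ≤ W' := sum_nonneg fun v _ => hμ v
  have := root4_nonneg (T₁ * T₂)
  have := root4_nonneg V'
  have := root4_nonneg W'
  have hEVW : ∑ e ∈ E, μ e.1 * μ e.2 ≤ V' * W' := by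
    rw [hV', hW', sum_mul_sum, ← sum_product']
    exact sum_le_sum_of_subset_of_nonneg hE fun e _ _ => mul_nonneg (hμ _) (hμ _)
  apply le_of_pow_le_pow_left₀ two_ne_zero (by positivity)
  have hCS := sum_mul_sq_le_sq_mul_sq E (fun e => √(μ e.1 * μ e.2))
    (fun e => √(μ e.1 * μ e.2) * (F (x e.1) * F (y e.2)))
  have e1 : ∀ e ∈ E, √(μ e.1 * μ e.2) * (√(μ e.1 * μ e.2) * (F (x e.1) * F (y e.2))) =
      μ e.1 * μ e.2 * (F (x e.1) * F (y e.2)) := fun e _ => by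
    rw [← mul_assoc, Real.mul_self_sqrt (mul_nonneg (hμ _) (hμ _))]
  have e2 : ∀ e ∈ E, √(μ e.1 * μ e.2) ^ 2 = μ e.1 * μ e.2 := fun e _ =>
    Real.sq_sqrt (mul_nonneg (hμ _) (hμ _))
  have e3 : ∀ e ∈ E, (√(μ e.1 * μ e.2) * (F (x e.1) * F (y e.2))) ^ 2 =
      μ e.1 * μ e.2 * (F (x e.1) ^ 2 * F (y e.2) ^ 2) := fun e _ => by
    rw [mul_pow, Real.sq_sqrt (mul_nonneg (hμ _) (hμ _))]; ring
  rw [sum_congr rfl e1, sum_congr rfl e2, sum_congr rfl e3] at hCS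
  refine hCS.trans ?_
  calc _ ≤ (V' * W') * (C * (√T₁ * √T₂) * (√V' * √W')) := by
        refine mul_le_mul hEVW h (sum_nonneg fun e _ => ?_) (by positivity)
        have := hμ e.1
        have := hμ e.2
        positivity
    _ = √C ^ 2 * (root4 (T₁ * T₂) ^ 2) * ((root4 V' ^ 4 * root4 V' ^ 2) *
          (root4 W' ^ 4 * root4 W' ^ 2)) := by
        rw [root4_pow hV0, root4_pow hW0, root4_sq, root4_sq, root4_sq, Real.sq_sqrt hC,
          Real.sqrt_mul hT₁]
        ring
    _ = _ := by ring

/-- The density `φ(n) / n`. -/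
noncomputable def rho (n : ℕ) : ℝ := (n.totient : ℝ) / n

lemma rho_nonneg (n : ℕ) : 0 ≤ rho n := by unfold rho; positivity

lemma rho_eq_prod {n : ℕ} (hn : n ≠ 0) : rho n = ∏ p ∈ n.primeFactors, (1 - (p : ℝ)⁻¹) := by
  have h := Nat.totient_eq_mul_prod_factors n
  have h' : (n.totient : ℝ) = n * ∏ p ∈ n.primeFactors, (1 - (p : ℝ)⁻¹) := by
    have := congrArg (Rat.cast : ℚ → ℝ) h
    push_cast at this
    exact this
  rw [rho, h', mul_div_cancel_left₀ _ (by positivity)]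

lemma one_sub_inv_nonneg {p : ℕ} (hp : p.Prime) : 0 ≤ 1 - (p : ℝ)⁻¹ := by
  have : (p : ℝ)⁻¹ ≤ 1 := inv_le_one_of_one_le₀ (by exact_mod_cast hp.one_lt.le)
  linarith

lemma one_sub_inv_le_one (p : ℕ) : 1 - (p : ℝ)⁻¹ ≤ 1 := by
  have : 0 ≤ (p : ℝ)⁻¹ := by positivity
  linarith

lemma rho_le_rho_of_dvd {a v : ℕ} (hv : v ≠ 0) (h : a ∣ v) : rho v ≤ rho a := by
  have ha : a ≠ 0 := ne_zero_of_dvd_ne_zero hv h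
  rw [rho_eq_prod hv, rho_eq_prod ha, ← prod_sdiff (Nat.primeFactors_mono h hv)]
  refine mul_le_of_le_one_left (prod_nonneg fun p hp => ?_) (prod_le_one (fun p hp => ?_) fun p _ =>
    one_sub_inv_le_one p)
  · exact one_sub_inv_nonneg (Nat.prime_of_mem_primeFactors hp)
  · exact one_sub_inv_nonneg (Nat.prime_of_mem_primeFactors (mem_sdiff.1 hp).1)

/-- The multiplicative weight `∏_{p ∣ n} f p`. -/
noncomputable def wt (f : ℕ → ℝ) (n : ℕ) : ℝ := ∏ p ∈ n.primeFactors, f p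

lemma one_le_wt {f : ℕ → ℝ} (hf : ∀ p, 1 ≤ f p) (n : ℕ) : 1 ≤ wt f n := by
  unfold wt
  induction n.primeFactors using Finset.induction_on with
  | empty => simp
  | insert a s ha ih => rw [prod_insert ha]; exact one_le_mul_of_one_le_of_one_le (hf a) ih

lemma wt_nonneg {f : ℕ → ℝ} (hf : ∀ p, 1 ≤ f p) (n : ℕ) : 0 ≤ wt f n :=
  zero_le_one.trans (one_le_wt hf n)

lemma wt_mul_le {f : ℕ → ℝ} (hf : ∀ p, 1 ≤ f p) {x y : ℕ} (hx : x ≠ 0) (hy : y ≠ 0) :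
    wt f (x * y) ≤ wt f x * wt f y := by
  unfold wt
  rw [Nat.primeFactors_mul hx hy, ← prod_union_inter]
  refine le_mul_of_one_le_right (prod_nonneg fun p _ => zero_le_one.trans (hf p)) ?_
  induction x.primeFactors ∩ y.primeFactors using Finset.induction_on with
  | empty => simp
  | insert a s ha ih => rw [prod_insert ha]; exact one_le_mul_of_one_le_of_one_le (hf a) ih

/-- The mass `ψ(v) φ(v) / v`. -/
noncomputable def mass (ψ : ℕ → ℝ) (v : ℕ) : ℝ := ψ v * rho v

lemma mass_nonneg {ψ : ℕ → ℝ} (hψ : ∀ v, 0 ≤ ψ v) (v : ℕ) : 0 ≤ mass ψ v :=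
  mul_nonneg (hψ v) (rho_nonneg v)

lemma gcd_mul_pow {a b p : ℕ} (hp : p.Prime) (hpa : ¬ p ∣ a) (hpb : ¬ p ∣ b) (i j : ℕ) :
    Nat.gcd (a * p ^ i) (b * p ^ j) = Nat.gcd a b * p ^ min i j := by
  have h1 : ∀ k, Nat.Coprime a (p ^ k) := fun k =>
    ((Nat.Prime.coprime_iff_not_dvd hp).2 hpa).symm.pow_right k
  have h2 : ∀ k, Nat.Coprime b (p ^ k) := fun k =>
    ((Nat.Prime.coprime_iff_not_dvd hp).2 hpb).symm.pow_right k
  rw [Nat.Coprime.gcd_mul _ (h2 j), Nat.Coprime.gcd_mul_right_cancel _ (h2 i).symm,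
    Nat.Coprime.gcd_mul_left_cancel _ (h1 j)]
  congr 1
  rcases le_total i j with h | h
  · rw [min_eq_left h, Nat.gcd_eq_left (pow_dvd_pow p h)]
  · rw [min_eq_right h, Nat.gcd_eq_right (pow_dvd_pow p h)]

lemma totient_prime_pow_div {p : ℕ} (hp : p.Prime) (m : ℕ) :
    (((p ^ m).totient : ℕ) : ℝ) = p ^ m * (if m = 0 then 1 else 1 - (p : ℝ)⁻¹) := by
  have hp0 : (p : ℝ) ≠ 0 := by exact_mod_cast hp.ne_zero
  rcases m with _ | m
  · simp
  · rw [Nat.totient_prime_pow_succ hp, if_neg (Nat.succ_ne_zero m)]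
    push_cast [hp.one_lt.le]
    field_simp
    ring

/-- The constant attached to a pair `(a, b)` in the induction over primes. -/
noncomputable def pairBound (f : ℕ → ℝ) (t : ℝ) (a b : ℕ) : ℝ :=
  root4 (t ^ 2 * (Nat.gcd a b).totient ^ 2 / (a * b)) * wt f (a * b / Nat.gcd a b ^ 2)

lemma pairBound_nonneg {f : ℕ → ℝ} (hf : ∀ p, 1 ≤ f p) (t : ℝ) (a b : ℕ) :
    0 ≤ pairBound f t a b := mul_nonneg (root4_nonneg _) (wt_nonneg hf _)

lemma wt_prime_pow (f : ℕ → ℝ) {p : ℕ} (hp : p.Prime) (d : ℕ) :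
    wt f (p ^ d) = if d = 0 then 1 else f p := by
  rcases d with _ | d
  · simp [wt]
  · simp [wt, Nat.primeFactors_prime_pow (Nat.succ_ne_zero d) hp]

lemma gcd_sq_dvd_mul (a b : ℕ) : Nat.gcd a b ^ 2 ∣ a * b := by
  rw [sq]; exact Nat.mul_dvd_mul (Nat.gcd_dvd_left a b) (Nat.gcd_dvd_right a b)

lemma div_gcd_sq_ne_zero {a b : ℕ} (ha : a ≠ 0) (hb : b ≠ 0) : a * b / Nat.gcd a b ^ 2 ≠ 0 := by
  have h := Nat.div_mul_cancel (gcd_sq_dvd_mul a b)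
  intro h0
  rw [h0, zero_mul] at h
  exact mul_ne_zero ha hb h.symm

lemma pairBound_mul_pow_le {f : ℕ → ℝ} (hf : ∀ p, 1 ≤ f p) {t : ℝ} {a b p : ℕ}
    (ha : a ≠ 0) (hb : b ≠ 0) (hp : p.Prime) (hpa : ¬ p ∣ a) (hpb : ¬ p ∣ b) (i j : ℕ) :
    pairBound f t (a * p ^ i) (b * p ^ j) ≤ pairBound f t a b *
      ((if min i j = 0 then 1 else √(1 - (p : ℝ)⁻¹)) *
        ((if i = j then 1 else f p) * decay (root4 (p : ℝ)⁻¹) i j)) := by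
  set g := Nat.gcd a b with hg
  set m := min i j with hm
  set d := (i - j) + (j - i) with hd
  have hij : i + j = 2 * m + d := by omega
  have hp0 : (p : ℝ) ≠ 0 := by exact_mod_cast hp.ne_zero
  have hg' := gcd_mul_pow hp hpa hpb i j
  rw [← hg, ← hm] at hg'
  have hpg : Nat.Coprime g (p ^ m) :=
    (((Nat.Prime.coprime_iff_not_dvd hp).2 fun h => hpa (h.trans (Nat.gcd_dvd_left a b))).symm).pow_right m
  have hσ : 0 ≤ 1 - (p : ℝ)⁻¹ := one_sub_inv_nonneg hp
  have h1 : t ^ 2 * (((g * p ^ m).totient : ℕ) : ℝ) ^ 2 / ((a * p ^ i : ℕ) * (b * p ^ j : ℕ)) =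
      (t ^ 2 * (g.totient : ℝ) ^ 2 / (a * b)) *
        ((if m = 0 then 1 else √(1 - (p : ℝ)⁻¹)) ^ 4 * (root4 (p : ℝ)⁻¹ ^ d) ^ 4) := by
    have h2 : (root4 (p : ℝ)⁻¹ ^ d) ^ 4 = ((p : ℝ) ^ d)⁻¹ := by
      rw [← pow_mul, mul_comm d 4, pow_mul, root4_pow (by positivity), inv_pow]
    have h3 : (if m = 0 then 1 else √(1 - (p : ℝ)⁻¹)) ^ 4 =
        (if m = 0 then 1 else 1 - (p : ℝ)⁻¹) ^ 2 := by
      split_ifs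
      · norm_num
      · rw [show 4 = 2 * 2 by norm_num, pow_mul, Real.sq_sqrt hσ]
    rw [h2, h3, Nat.totient_mul hpg]
    push_cast
    rw [totient_prime_pow_div hp]
    have h4 : (a : ℝ) * p ^ i * (b * p ^ j) = a * b * (p ^ m * p ^ m * p ^ d) := by
      rw [← pow_add, ← pow_add, show m + m + d = i + j by omega, pow_add]; ring
    rw [h4]
    have : (a : ℝ) ≠ 0 := by exact_mod_cast ha
    have : (b : ℝ) ≠ 0 := by exact_mod_cast hb
    field_simp
  have h5 : a * p ^ i * (b * p ^ j) / (g * p ^ m) ^ 2 = a * b / g ^ 2 * p ^ d := by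
    have hgpos : 0 < g := Nat.gcd_pos_of_pos_left _ (Nat.pos_of_ne_zero ha)
    have hpp := hp.pos
    apply Nat.div_eq_of_eq_mul_left (by positivity)
    have h6 := Nat.div_mul_cancel (gcd_sq_dvd_mul a b)
    rw [← hg] at h6
    have h7 : p ^ i * p ^ j = p ^ m * p ^ m * p ^ d := by
      rw [← pow_add, ← pow_add, ← pow_add, show m + m + d = i + j by omega]
    calc _ = a * b * (p ^ i * p ^ j) := by ring
      _ = (a * b / g ^ 2 * g ^ 2) * (p ^ m * p ^ m * p ^ d) := by rw [h6, h7]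
      _ = _ := by ring
  have hs : 0 ≤ (if m = 0 then 1 else √(1 - (p : ℝ)⁻¹)) := by
    split_ifs
    exacts [zero_le_one, Real.sqrt_nonneg _]
  have h8 : root4 (((if m = 0 then 1 else √(1 - (p : ℝ)⁻¹)) ^ 4 * (root4 (p : ℝ)⁻¹ ^ d) ^ 4)) =
      (if m = 0 then 1 else √(1 - (p : ℝ)⁻¹)) * root4 (p : ℝ)⁻¹ ^ d := by
    rw [← mul_pow]
    exact (eq_root4_of_pow (mul_nonneg hs (pow_nonneg (root4_nonneg _) _)) rfl).symm
  have h9 : wt f (a * b / g ^ 2 * p ^ d) ≤ wt f (a * b / g ^ 2) * (if i = j then 1 else f p) := by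
    refine (wt_mul_le hf (div_gcd_sq_ne_zero ha hb) (pow_ne_zero _ hp.ne_zero)).trans (le_of_eq ?_)
    rw [wt_prime_pow f hp]
    congr 1
    simp only [show d = 0 ↔ i = j by omega]
  unfold pairBound
  rw [hg', h1, h5, root4_mul (by positivity), h8, ← hg]
  have := root4_nonneg (t ^ 2 * (g.totient : ℝ) ^ 2 / (a * b))
  have hr := pow_nonneg (root4_nonneg (p : ℝ)⁻¹) d
  calc _ ≤ root4 (t ^ 2 * (g.totient : ℝ) ^ 2 / (a * b)) *
        ((if m = 0 then 1 else √(1 - (p : ℝ)⁻¹)) * root4 (p : ℝ)⁻¹ ^ d) *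
          (wt f (a * b / g ^ 2) * (if i = j then 1 else f p)) := by gcongr
    _ = _ := by unfold decay; ring

/-- The constant in the local inequality. -/
noncomputable def localConst : ℝ := local_inequality.choose

lemma localConst_pos : 0 < localConst := local_inequality.choose_spec.1

/-- The factor lost at the prime `p`. -/
noncomputable def localFactor (f : ℕ → ℝ) (p : ℕ) : ℝ :=
  1 + localConst * (root4 (p : ℝ)⁻¹ ^ 5 + (f p - 1) * root4 (p : ℝ)⁻¹ ^ 4)

lemma localFactor_nonneg {f : ℕ → ℝ} (hf : ∀ p, 1 ≤ f p) (p : ℕ) : 0 ≤ localFactor f p := by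
  have h1 := localConst_pos
  have h2 := root4_nonneg (p : ℝ)⁻¹
  have h3 : 0 ≤ f p - 1 := by linarith [hf p]
  unfold localFactor
  positivity

/-- The weighted count of the edges. -/
noncomputable def edgeSum (ψ f : ℕ → ℝ) (E : Finset (ℕ × ℕ)) : ℝ :=
  ∑ e ∈ E, mass ψ e.1 * mass ψ e.2 * wt f (e.1 * e.2 / Nat.gcd e.1 e.2 ^ 2)

lemma edgeSum_nonneg {ψ f : ℕ → ℝ} (hψ : ∀ v, 0 ≤ ψ v) (hf : ∀ p, 1 ≤ f p)
    (E : Finset (ℕ × ℕ)) : 0 ≤ edgeSum ψ f E :=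
  sum_nonneg fun _ _ => mul_nonneg (mul_nonneg (mass_nonneg hψ _) (mass_nonneg hψ _))
    (wt_nonneg hf _)

/-- The pairs in `E` are exactly aligned with `(a, b)` at all primes outside `P`. -/
structure Aligned (ψ : ℕ → ℝ) (t : ℝ) (P : Finset ℕ) (a b : ℕ) (V W : Finset ℕ)
    (E : Finset (ℕ × ℕ)) : Prop where
  ha : a ≠ 0
  hb : b ≠ 0
  hPa : ∀ p ∈ P, ¬ p ∣ a
  hPb : ∀ p ∈ P, ¬ p ∣ b
  hV : ∀ v ∈ V, v ≠ 0 ∧ a ∣ v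
  hW : ∀ w ∈ W, w ≠ 0 ∧ b ∣ w
  hE : E ⊆ V ×ˢ W
  hgcd : ∀ e ∈ E, ∀ q, q.Prime → q ∉ P →
    (Nat.gcd e.1 e.2).factorization q = (Nat.gcd a b).factorization q
  ht₁ : ∀ e ∈ E, ψ e.1 * e.2 ≤ t * Nat.gcd e.1 e.2
  ht₂ : ∀ e ∈ E, ψ e.2 * e.1 ≤ t * Nat.gcd e.1 e.2

lemma Aligned.edgeSum_le_of_empty {ψ f : ℕ → ℝ} (hψ : ∀ v, 0 ≤ ψ v) (hf : ∀ p, 1 ≤ f p)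
    {t : ℝ} (ht : 0 ≤ t) {C : ℝ} (hC : 0 ≤ C)
    (hF : ∀ X : ℕ, ∑ n ∈ Icc 1 X, wt f n ^ 4 / √n ≤ C * √X)
    {a b : ℕ} {V W : Finset ℕ} {E : Finset (ℕ × ℕ)} (h : Aligned ψ t ∅ a b V W E) :
    edgeSum ψ f E ≤ √C * pairBound f t a b *
      (root4 (∑ v ∈ V, mass ψ v) ^ 3 * root4 (∑ w ∈ W, mass ψ w) ^ 3) := by
  obtain ⟨ha, hb, -, -, hV, hW, hE, hgcd, ht₁, ht₂⟩ := h
  set g := Nat.gcd a b with hg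
  have ha' : (a : ℝ) ≠ 0 := by exact_mod_cast ha
  have hb' : (b : ℝ) ≠ 0 := by exact_mod_cast hb
  have hgpos : 0 < g := Nat.gcd_pos_of_pos_left _ (Nat.pos_of_ne_zero ha)
  have hmem : ∀ e ∈ E, e.1 ∈ V ∧ e.2 ∈ W := fun e he => mem_product.1 (hE he)
  have hgcd' : ∀ e ∈ E, Nat.gcd e.1 e.2 = g := by
    intro e he
    refine Nat.eq_of_factorization_eq (Nat.gcd_ne_zero_left (hV _ (hmem e he).1).1)
      hgpos.ne' fun q => ?_
    by_cases hq : q.Prime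
    · exact hgcd e he q hq (notMem_empty q)
    · rw [Nat.factorization_eq_zero_of_not_prime _ hq, Nat.factorization_eq_zero_of_not_prime _ hq]
  have key := sum_edges_le_root4 hE (mass_nonneg hψ) (x := fun v => v / a) (y := fun w => w / b)
    (fun v hv v' hv' hvv' => by
      have := Nat.div_mul_cancel (hV v hv).2
      rw [← this, ← Nat.div_mul_cancel (hV v' hv').2]
      exact congrArg (· * a) hvv')
    (fun v hv => Nat.div_pos (Nat.le_of_dvd (Nat.pos_of_ne_zero (hV v hv).1) (hV v hv).2)
      (Nat.pos_of_ne_zero ha))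
    (fun v hv v' hv' hvv' => by
      have := Nat.div_mul_cancel (hW v hv).2
      rw [← this, ← Nat.div_mul_cancel (hW v' hv').2]
      exact congrArg (· * b) hvv')
    (fun v hv => Nat.div_pos (Nat.le_of_dvd (Nat.pos_of_ne_zero (hW v hv).1) (hW v hv).2)
      (Nat.pos_of_ne_zero hb)) hF hC (T₁ := t * g / b * rho a) (T₂ := t * g / a * rho b)
    (mul_nonneg (by positivity) (rho_nonneg a)) (mul_nonneg (by positivity) (rho_nonneg b))
    (fun e he => by
      have h1 := ht₁ e he
      rw [hgcd' e he] at h1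
      have h2 := rho_le_rho_of_dvd (hV _ (hmem e he).1).1 (hV _ (hmem e he).1).2
      have h3 : ((e.2 / b : ℕ) : ℝ) = e.2 / b := Nat.cast_div (hW _ (hmem e he).2).2 hb'
      rw [h3]
      unfold mass
      calc _ = ψ e.1 * e.2 / b * rho e.1 := by ring
        _ ≤ _ := by
          have := rho_nonneg e.1
          gcongr)
    (fun e he => by
      have h1 := ht₂ e he
      rw [hgcd' e he] at h1
      have h2 := rho_le_rho_of_dvd (hW _ (hmem e he).2).1 (hW _ (hmem e he).2).2
      have h3 : ((e.1 / a : ℕ) : ℝ) = e.1 / a := Nat.cast_div (hV _ (hmem e he).1).2 ha'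
      rw [h3]
      unfold mass
      calc _ = ψ e.2 * e.1 / a * rho e.2 := by ring
        _ ≤ _ := by
          have := rho_nonneg e.2
          gcongr)
  have hw0 := wt_nonneg hf (a * b / g ^ 2)
  have h4 : edgeSum ψ f E ≤ wt f (a * b / g ^ 2) *
      ∑ e ∈ E, mass ψ e.1 * mass ψ e.2 * (wt f (e.1 / a) * wt f (e.2 / b)) := by
    rw [mul_sum]
    refine sum_le_sum fun e he => ?_
    obtain ⟨h1, h2⟩ := hV _ (hmem e he).1
    obtain ⟨h3, h4⟩ := hW _ (hmem e he).2
    obtain ⟨x, hx⟩ := h2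
    obtain ⟨y, hy⟩ := h4
    have hxa : e.1 / a = x := by rw [hx]; exact Nat.mul_div_cancel_left _ (Nat.pos_of_ne_zero ha)
    have hyb : e.2 / b = y := by rw [hy]; exact Nat.mul_div_cancel_left _ (Nat.pos_of_ne_zero hb)
    have hx0 : x ≠ 0 := by rintro rfl; simp at hx; exact h1 hx
    have hy0 : y ≠ 0 := by rintro rfl; simp at hy; exact h3 hy
    have h5 : e.1 * e.2 / g ^ 2 = a * b / g ^ 2 * (x * y) := by
      apply Nat.div_eq_of_eq_mul_left (by positivity)
      have h6 := Nat.div_mul_cancel (gcd_sq_dvd_mul a b)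
      rw [← hg] at h6
      calc e.1 * e.2 = a * b * (x * y) := by rw [hx, hy]; ring
        _ = (a * b / g ^ 2 * g ^ 2) * (x * y) := by rw [h6]
        _ = _ := by ring
    rw [hgcd' e he, h5, hxa, hyb]
    have h6 : wt f (a * b / g ^ 2 * (x * y)) ≤ wt f (a * b / g ^ 2) * (wt f x * wt f y) :=
      (wt_mul_le hf (div_gcd_sq_ne_zero ha hb) (mul_ne_zero hx0 hy0)).trans
        (mul_le_mul_of_nonneg_left (wt_mul_le hf hx0 hy0) hw0)
    have := mass_nonneg hψ e.1
    have := mass_nonneg hψ e.2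
    calc _ ≤ mass ψ e.1 * mass ψ e.2 * (wt f (a * b / g ^ 2) * (wt f x * wt f y)) := by gcongr
      _ = _ := by ring
  have h5 : root4 (t * g / b * rho a * (t * g / a * rho b)) ≤
      root4 (t ^ 2 * g.totient ^ 2 / (a * b)) := by
    apply root4_le_root4
    have h6 := rho_le_rho_of_dvd ha (Nat.gcd_dvd_left a b)
    have h7 := rho_le_rho_of_dvd hb (Nat.gcd_dvd_right a b)
    rw [← hg] at h6 h7
    have h8 : (g.totient : ℝ) = g * rho g := by
      unfold rho; field_simp
    rw [h8]
    have := rho_nonneg a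
    have := rho_nonneg b
    have := rho_nonneg g
    calc _ = t * g / b * (t * g / a) * (rho a * rho b) := by ring
      _ ≤ t * g / b * (t * g / a) * (rho g * rho g) := by gcongr
      _ = _ := by field_simp
  refine h4.trans ((mul_le_mul_of_nonneg_left key hw0).trans ?_)
  have hr1 := root4_nonneg (∑ v ∈ V, mass ψ v)
  have hr2 := root4_nonneg (∑ v ∈ W, mass ψ v)
  calc _ ≤ wt f (a * b / g ^ 2) * (√C * root4 (t ^ 2 * g.totient ^ 2 / (a * b)) *
      (root4 (∑ v ∈ V, mass ψ v) ^ 3 * root4 (∑ w ∈ W, mass ψ w) ^ 3)) := by gcongr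
    _ = _ := by unfold pairBound; ring

lemma Aligned.refine {ψ : ℕ → ℝ} {t : ℝ} {p : ℕ} {P : Finset ℕ} (hp : p.Prime) (hpP : p ∉ P)
    (hP : ∀ q ∈ P, q.Prime) {a b : ℕ} {V W V' W' : Finset ℕ}
    {E E' : Finset (ℕ × ℕ)} (h : Aligned ψ t (insert p P) a b V W E) {i j : ℕ}
    (hV' : ∀ v ∈ V', v ∈ V ∧ i ≤ v.factorization p) (hW' : ∀ w ∈ W', w ∈ W ∧ j ≤ w.factorization p)
    (hE : E' ⊆ E) (hE' : E' ⊆ V' ×ˢ W')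
    (hmin : ∀ e ∈ E', min (e.1.factorization p) (e.2.factorization p) = min i j) :
    Aligned ψ t P (a * p ^ i) (b * p ^ j) V' W' E' := by
  have hpa := h.hPa p (mem_insert_self _ _)
  have hpb := h.hPb p (mem_insert_self _ _)
  have hdvd : ∀ (a v i : ℕ), ¬ p ∣ a → v ≠ 0 → a ∣ v → i ≤ v.factorization p → a * p ^ i ∣ v := by
    intro a v i hpa hv hav hi
    refine Nat.Coprime.mul_dvd_of_dvd_of_dvd ?_ hav
      ((Nat.Prime.pow_dvd_iff_le_factorization hp hv).2 hi)
    exact (((Nat.Prime.coprime_iff_not_dvd hp).2 hpa).symm).pow_right i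
  have hnd : ∀ (a i q : ℕ), q ∈ P → ¬ q ∣ a → ¬ q ∣ a * p ^ i := by
    intro a i q hq hqa hqd
    rcases (hP q hq).dvd_mul.1 hqd with h1 | h1
    · exact hqa h1
    · have := (Nat.prime_dvd_prime_iff_eq (hP q hq) hp).1 ((hP q hq).dvd_of_dvd_pow h1)
      exact hpP (this ▸ hq)
  refine ⟨mul_ne_zero h.ha (pow_ne_zero _ hp.ne_zero), mul_ne_zero h.hb (pow_ne_zero _ hp.ne_zero),
    fun q hq => hnd a i q hq (h.hPa q (mem_insert_of_mem hq)),
    fun q hq => hnd b j q hq (h.hPb q (mem_insert_of_mem hq)),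
    fun v hv => ?_, fun w hw => ?_, hE', fun e he q hq hqP => ?_,
    fun e he => h.ht₁ e (hE he), fun e he => h.ht₂ e (hE he)⟩
  · obtain ⟨h1, h2⟩ := hV' v hv
    exact ⟨(h.hV v h1).1, hdvd a v i hpa (h.hV v h1).1 (h.hV v h1).2 h2⟩
  · obtain ⟨h1, h2⟩ := hW' w hw
    exact ⟨(h.hW w h1).1, hdvd b w j hpb (h.hW w h1).1 (h.hW w h1).2 h2⟩
  · rw [gcd_mul_pow hp hpa hpb, Nat.factorization_mul
      (Nat.gcd_ne_zero_left h.ha) (pow_ne_zero _ hp.ne_zero), hp.factorization_pow,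
      Finsupp.add_apply]
    by_cases hqp : q = p
    · subst hqp
      have h1 := mem_product.1 (h.hE (hE he))
      rw [Nat.factorization_gcd (h.hV _ h1.1).1 (h.hW _ h1.2).1, Finsupp.inf_apply,
        Finsupp.single_eq_same, hmin e he,
        Nat.factorization_eq_zero_of_not_dvd fun h2 => hpa (h2.trans (Nat.gcd_dvd_left a b)),
        zero_add]
    · rw [Finsupp.single_eq_of_ne hqp, add_zero]
      exact h.hgcd e (hE he) q hq (by simp [hqp, hqP])

lemma sum_eq_sum_sum_fiber {β : Type*} (E : Finset β) (x y : β → ℕ) (R : ℕ)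
    (hx : ∀ e ∈ E, x e < R) (hy : ∀ e ∈ E, y e < R) (F : β → ℝ) :
    ∑ e ∈ E, F e = ∑ i ∈ range R, ∑ j ∈ range R, ∑ e ∈ E with x e = i ∧ y e = j, F e := by
  rw [← sum_fiberwise_of_maps_to (s := E) (t := range R) (g := x) (fun e he => by simpa using hx e he)]
  refine sum_congr rfl fun i _ => ?_
  rw [← sum_fiberwise_of_maps_to (s := E.filter (fun e => x e = i)) (t := range R) (g := y)
    (fun e he => by simpa using hy e (mem_filter.1 he).1)]
  refine sum_congr rfl fun j _ => ?_
  rw [filter_filter]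

lemma sum_min_eq_sum {β : Type*} (E : Finset β) (x y : β → ℕ) (R m : ℕ)
    (hx : ∀ e ∈ E, x e < R) (hy : ∀ e ∈ E, y e < R) (F : β → ℝ) :
    ∑ i ∈ range R, ∑ j ∈ range R,
      (if min i j = m then ∑ e ∈ E with x e = i ∧ y e = j, F e else 0) =
      ∑ e ∈ E with min (x e) (y e) = m, F e := by
  rw [sum_eq_sum_sum_fiber (E.filter _) x y R (fun e he => hx e (mem_filter.1 he).1)
    (fun e he => hy e (mem_filter.1 he).1)]
  refine sum_congr rfl fun i _ => sum_congr rfl fun j _ => ?_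
  rw [filter_filter]
  split_ifs with h
  · refine sum_congr (filter_congr fun e _ => ?_) fun _ _ => rfl
    constructor
    · rintro ⟨rfl, rfl⟩; exact ⟨h, rfl, rfl⟩
    · exact fun h => h.2
  · symm
    rw [filter_false_of_mem, sum_empty]
    rintro e _ ⟨h1, rfl, rfl⟩
    exact h h1

lemma sum_fiber_range (V : Finset ℕ) (x : ℕ → ℕ) (R m : ℕ) (hx : ∀ v ∈ V, x v < R) (F : ℕ → ℝ) :
    ∑ i ∈ Ico m R, ∑ v ∈ V with x v = i, F v = ∑ v ∈ V with m ≤ x v, F v := by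
  rw [← sum_fiberwise_of_maps_to (s := V.filter (fun v => m ≤ x v)) (t := Ico m R) (g := x)
    (fun v hv => by
      rw [mem_filter] at hv
      exact mem_Ico.2 ⟨hv.2, hx v hv.1⟩)]
  refine sum_congr rfl fun i hi => ?_
  rw [filter_filter]
  refine sum_congr (filter_congr fun v _ => ?_) fun _ _ => rfl
  rw [mem_Ico] at hi
  constructor
  · rintro rfl; exact ⟨hi.1, rfl⟩
  · exact fun h => h.2

theorem Aligned.edgeSum_le {ψ f : ℕ → ℝ} (hψ : ∀ v, 0 ≤ ψ v) (hf : ∀ p, 1 ≤ f p)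
    (hf8 : ∀ p, p.Prime → f p ≤ 8) {t : ℝ} (ht : 0 ≤ t) {C : ℝ} (hC : 0 ≤ C)
    (hF : ∀ X : ℕ, ∑ n ∈ Icc 1 X, wt f n ^ 4 / √n ≤ C * √X)
    {P : Finset ℕ} (hP : ∀ p ∈ P, p.Prime) {a b : ℕ} {V W : Finset ℕ} {E : Finset (ℕ × ℕ)}
    (h : Aligned ψ t P a b V W E) :
    edgeSum ψ f E ≤ (∏ p ∈ P, localFactor f p) * (√C * pairBound f t a b *
      (root4 (∑ v ∈ V, mass ψ v) ^ 3 * root4 (∑ w ∈ W, mass ψ w) ^ 3)) := by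
  induction P using Finset.induction_on generalizing a b V W E with
  | empty => simpa using h.edgeSum_le_of_empty hψ hf ht hC hF
  | insert p P hpP ih =>
    have hp : p.Prime := hP p (mem_insert_self _ _)
    have hP' : ∀ q ∈ P, q.Prime := fun q hq => hP q (mem_insert_of_mem hq)
    have hpa := h.hPa p (mem_insert_self _ _)
    have hpb := h.hPb p (mem_insert_self _ _)
    set vp : ℕ → ℕ := fun v => v.factorization p with hvp
    set R := (V ∪ W).sup id with hR
    have hVR : ∀ v ∈ V, vp v < R := fun v hv =>
      (Nat.factorization_lt p (h.hV v hv).1).trans_le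
        (le_sup (f := id) (mem_union_left W hv))
    have hWR : ∀ v ∈ W, vp v < R := fun v hv =>
      (Nat.factorization_lt p (h.hW v hv).1).trans_le
        (le_sup (f := id) (mem_union_right V hv))
    have hmem : ∀ e ∈ E, e.1 ∈ V ∧ e.2 ∈ W := fun e he => mem_product.1 (h.hE he)
    set Q := ∏ q ∈ P, localFactor f q with hQ
    have hQ0 : 0 ≤ Q := prod_nonneg fun q _ => localFactor_nonneg hf q
    set K := Q * (√C * pairBound f t a b) with hK
    have hK0 : 0 ≤ K := mul_nonneg hQ0 (mul_nonneg (Real.sqrt_nonneg _) (pairBound_nonneg hf _ _ _))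
    have step : ∀ (i j : ℕ) (V' W' : Finset ℕ) (E' : Finset (ℕ × ℕ)),
        (∀ v ∈ V', v ∈ V ∧ i ≤ vp v) → (∀ w ∈ W', w ∈ W ∧ j ≤ vp w) → E' ⊆ E → E' ⊆ V' ×ˢ W' →
        (∀ e ∈ E', min (vp e.1) (vp e.2) = min i j) →
        edgeSum ψ f E' ≤ K * ((if min i j = 0 then 1 else √(1 - (p : ℝ)⁻¹)) *
          ((if i = j then 1 else f p) * decay (root4 (p : ℝ)⁻¹) i j) *
            (root4 (∑ v ∈ V', mass ψ v) ^ 3 * root4 (∑ w ∈ W', mass ψ w) ^ 3)) := by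
      intro i j V' W' E' hV' hW' hE hE' hmin
      refine (ih hP' (h.refine hp hpP hP' hV' hW' hE hE' hmin)).trans ?_
      have h1 := pairBound_mul_pow_le hf (t := t) h.ha h.hb hp hpa hpb i j
      have h2 := root4_nonneg (∑ v ∈ V', mass ψ v)
      have h3 := root4_nonneg (∑ v ∈ W', mass ψ v)
      calc _ ≤ Q * (√C * (pairBound f t a b *
              ((if min i j = 0 then 1 else √(1 - (p : ℝ)⁻¹)) *
                ((if i = j then 1 else f p) * decay (root4 (p : ℝ)⁻¹) i j))) *
              (root4 (∑ v ∈ V', mass ψ v) ^ 3 * root4 (∑ w ∈ W', mass ψ w) ^ 3)) := by gcongr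
        _ = _ := by rw [hK]; ring
    have hr4 : root4 (p : ℝ)⁻¹ ^ 4 = (p : ℝ)⁻¹ := root4_pow (by positivity)
    have hr0 := root4_nonneg (p : ℝ)⁻¹
    have hmass : ∀ S : Finset ℕ, 0 ≤ ∑ v ∈ S, mass ψ v := fun S =>
      sum_nonneg fun v _ => mass_nonneg hψ v
    set u : ℕ → ℝ := fun i => root4 (∑ v ∈ V with vp v = i, mass ψ v) with hu
    set w : ℕ → ℝ := fun i => root4 (∑ v ∈ W with vp v = i, mass ψ v) with hw
    have hu4 : ∀ i, u i ^ 4 = ∑ v ∈ V with vp v = i, mass ψ v := fun i => root4_pow (hmass _)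
    have hw4 : ∀ i, w i ^ 4 = ∑ v ∈ W with vp v = i, mass ψ v := fun i => root4_pow (hmass _)
    set B : ℕ → ℕ → ℝ := fun i j => edgeSum ψ f (E.filter fun e => vp e.1 = i ∧ vp e.2 = j) with hB
    have hlocal := local_inequality.choose_spec.2 (root4 (p : ℝ)⁻¹) (f p) K
      (root4 (∑ v ∈ V, mass ψ v)) (root4 (∑ v ∈ W, mass ψ v)) R u w B hr0
      (by
        rw [hr4, one_div]
        exact inv_anti₀ two_pos (by exact_mod_cast hp.two_le))
      (hf p) (hf8 p hp) hK0 (root4_nonneg _) (root4_nonneg _) (fun i => root4_nonneg _)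
      (fun i => root4_nonneg _)
      (by
        simp_rw [hu4]
        rw [root4_pow (hmass _), range_eq_Ico, sum_fiber_range V vp R 0 hVR]
        simp)
      (by
        simp_rw [hw4]
        rw [root4_pow (hmass _), range_eq_Ico, sum_fiber_range W vp R 0 hWR]
        simp)
      (fun i j => edgeSum_nonneg hψ hf _)
      (fun i j => by
        refine (step i j (V.filter fun v => vp v = i) (W.filter fun v => vp v = j) _
          (fun v hv => ?_) (fun v hv => ?_) (filter_subset _ _) (fun e he => ?_)
          (fun e he => ?_)).trans ?_
        · rw [mem_filter] at hv; exact ⟨hv.1, hv.2.ge⟩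
        · rw [mem_filter] at hv; exact ⟨hv.1, hv.2.ge⟩
        · rw [mem_filter] at he
          simp [hmem e he.1, he.2]
        · rw [mem_filter] at he
          rw [he.2.1, he.2.2]
        · have h1 : (if min i j = 0 then 1 else √(1 - (p : ℝ)⁻¹)) ≤ 1 := by
            split_ifs
            · exact le_rfl
            · exact Real.sqrt_le_one.2 (one_sub_inv_le_one p)
          have h2 : 0 ≤ (if i = j then 1 else f p) * decay (root4 (p : ℝ)⁻¹) i j *
              (u i ^ 3 * w j ^ 3) := by
            have := decay_nonneg hr0 i j
            have h3 : 0 ≤ u i := root4_nonneg _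
            have h4 : 0 ≤ w j := root4_nonneg _
            have h5 : 0 ≤ if i = j then 1 else f p := by
              split_ifs
              exacts [zero_le_one, zero_le_one.trans (hf p)]
            positivity
          refine mul_le_mul_of_nonneg_left ?_ hK0
          rw [mul_assoc]
          refine (mul_le_of_le_one_left h2 h1).trans (le_of_eq ?_)
          ring)
      (fun m a' b' ha' hb' hua hwb => by
        have h1 := sum_min_eq_sum E (fun e => vp e.1) (fun e => vp e.2) R m
          (fun e he => hVR _ (hmem e he).1) (fun e he => hWR _ (hmem e he).2)
          (fun e => mass ψ e.1 * mass ψ e.2 * wt f (e.1 * e.2 / Nat.gcd e.1 e.2 ^ 2))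
        refine h1.le.trans ((step m m (V.filter fun v => m ≤ vp v) (W.filter fun v => m ≤ vp v) _
          (fun v hv => ?_) (fun v hv => ?_) (filter_subset _ _) (fun e he => ?_)
          (fun e he => ?_)).trans ?_)
        · rwa [mem_filter] at hv
        · rwa [mem_filter] at hv
        · rw [mem_filter] at he
          have := hmem e he.1
          simp only [mem_product, mem_filter]
          exact ⟨⟨this.1, by omega⟩, ⟨this.2, by omega⟩⟩
        · rw [mem_filter] at he
          rw [he.2, min_self]
        · simp_rw [hu4] at hua
          simp_rw [hw4] at hwb
          rw [sum_fiber_range V vp R m hVR] at hua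
          rw [sum_fiber_range W vp R m hWR] at hwb
          rw [← eq_root4_of_pow ha' hua, ← eq_root4_of_pow hb' hwb, hr4]
          simp [decay])
    have hsum : edgeSum ψ f E = ∑ i ∈ range R, ∑ j ∈ range R, B i j :=
      sum_eq_sum_sum_fiber E (fun e => vp e.1) (fun e => vp e.2) R
          (fun e he => hVR _ (hmem e he).1) (fun e he => hWR _ (hmem e he).2) _
    rw [hsum, prod_insert hpP]
    refine hlocal.trans (le_of_eq ?_)
    rw [hK, ← hQ, localFactor, localConst]
    ring

lemma sum_inv_sqrt_le (N : ℕ) : ∑ n ∈ Icc 1 N, 1 / √(n : ℝ) ≤ 2 * √N := by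
  induction N with
  | zero => simp
  | succ N ih =>
    rw [sum_Icc_succ_top (by omega)]
    have h1 : 0 < √((N + 1 : ℕ) : ℝ) := Real.sqrt_pos.2 (by positivity)
    have h2 : 0 ≤ √(N : ℝ) := Real.sqrt_nonneg _
    have h3 : √((N + 1 : ℕ) : ℝ) ^ 2 = N + 1 := by rw [Real.sq_sqrt (by positivity)]; push_cast; ring
    have h4 : √(N : ℝ) ^ 2 = N := Real.sq_sqrt (by positivity)
    have h5 : 1 / √((N + 1 : ℕ) : ℝ) ≤ 2 * √((N + 1 : ℕ) : ℝ) - 2 * √(N : ℝ) := by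
      rw [div_le_iff₀ h1]
      nlinarith [sq_nonneg (√((N + 1 : ℕ) : ℝ) - √(N : ℝ))]
    linarith

lemma sum_multiples_inv_sqrt_le {d : ℕ} (hd : 0 < d) (X : ℕ) :
    ∑ n ∈ Icc 1 X with d ∣ n, 1 / √(n : ℝ) ≤ 2 * √X * (1 / d) := by
  have h1 : (Icc 1 X).filter (d ∣ ·) = (Icc 1 (X / d)).image (d * ·) := by
    ext n
    simp only [mem_filter, mem_Icc, mem_image]
    constructor
    · rintro ⟨⟨h1, h2⟩, k, rfl⟩
      refine ⟨k, ⟨Nat.pos_of_ne_zero (by rintro rfl; simp at h1), ?_⟩, rfl⟩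
      exact (Nat.le_div_iff_mul_le hd).2 (by linarith [mul_comm k d])
    · rintro ⟨k, ⟨h1, h2⟩, rfl⟩
      refine ⟨⟨Nat.mul_pos hd h1, ?_⟩, dvd_mul_right _ _⟩
      have := (Nat.le_div_iff_mul_le hd).1 h2
      linarith [mul_comm k d]
  rw [h1, sum_image (fun x _ y _ h => Nat.eq_of_mul_eq_mul_left hd h)]
  have hd' : (0 : ℝ) < d := by exact_mod_cast hd
  have h2 : ∀ k ∈ Icc 1 (X / d), 1 / √((d * k : ℕ) : ℝ) = 1 / √d * (1 / √k) := by
    intro k _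
    push_cast
    rw [Real.sqrt_mul hd'.le]; field_simp
  rw [sum_congr rfl h2, ← mul_sum]
  calc _ ≤ 1 / √d * (2 * √((X / d : ℕ) : ℝ)) := by
        have := sum_inv_sqrt_le (X / d)
        gcongr
    _ ≤ 1 / √d * (2 * √((X : ℝ) / d)) := by
        have : ((X / d : ℕ) : ℝ) ≤ (X : ℝ) / d := Nat.cast_div_le
        gcongr
    _ = _ := by
        rw [Real.sqrt_div (by positivity)]
        have h3 := Real.mul_self_sqrt hd'.le
        have h4 : √(d : ℝ) ≠ 0 := (Real.sqrt_pos.2 hd').ne'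
        field_simp
        rw [sq, h3]
        ring

lemma prod_primes_dvd_iff {T : Finset ℕ} (hT : ∀ p ∈ T, p.Prime) {n : ℕ} (hn : n ≠ 0) :
    ∏ p ∈ T, p ∣ n ↔ T ⊆ n.primeFactors := by
  constructor
  · intro h p hp
    exact Nat.mem_primeFactors.2 ⟨hT p hp, (dvd_prod_of_mem _ hp).trans h, hn⟩
  · intro h
    exact (prod_dvd_prod_of_subset _ _ _ h).trans (Nat.prod_primeFactors_dvd n)

lemma sum_wt_div_sqrt_le {h : ℕ → ℝ} (hh : ∀ p, 0 ≤ h p) (X : ℕ) :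
    ∑ n ∈ Icc 1 X, wt (fun p => 1 + h p) n / √n ≤
      2 * √X * Real.exp (∑ p ∈ Icc 1 X with p.Prime, h p / p) := by
  set Q := (Icc 1 X).filter Nat.Prime with hQ
  have hQp : ∀ p ∈ Q, p.Prime := fun p hp => (mem_filter.1 hp).2
  have h1 : ∀ n ∈ Icc 1 X, wt (fun p => 1 + h p) n / √n =
      ∑ T ∈ Q.powerset, if ∏ p ∈ T, p ∣ n then (∏ p ∈ T, h p) * (1 / √n) else 0 := by
    intro n hn
    rw [mem_Icc] at hn
    have hn0 : n ≠ 0 := by omega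
    have hsub : n.primeFactors ⊆ Q := fun p hp => by
      have hp' := Nat.prime_of_mem_primeFactors hp
      rw [hQ, mem_filter, mem_Icc]
      exact ⟨⟨hp'.one_lt.le, (Nat.le_of_mem_primeFactors hp).trans hn.2⟩, hp'⟩
    rw [wt, prod_one_add, sum_div, ← sum_filter]
    refine sum_congr ?_ fun T _ => by ring
    ext T
    simp only [mem_powerset, mem_filter]
    constructor
    · intro hT
      exact ⟨hT.trans hsub, (prod_primes_dvd_iff (fun p hp => hQp p (hsub (hT hp))) hn0).2 hT⟩
    · rintro ⟨hT, hd⟩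
      exact (prod_primes_dvd_iff (fun p hp => hQp p (hT hp)) hn0).1 hd
  rw [sum_congr rfl h1, sum_comm]
  have h2 : ∀ T ∈ Q.powerset, ∑ n ∈ Icc 1 X,
      (if ∏ p ∈ T, p ∣ n then (∏ p ∈ T, h p) * (1 / √(n : ℝ)) else 0) ≤
      2 * √X * ∏ p ∈ T, (h p / p) := by
    intro T hT
    rw [mem_powerset] at hT
    have hd : 0 < ∏ p ∈ T, p := prod_pos fun p hp => (hQp p (hT hp)).pos
    rw [← sum_filter, ← mul_sum]
    calc _ ≤ (∏ p ∈ T, h p) * (2 * √X * (1 / (∏ p ∈ T, p : ℕ))) := by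
          have := sum_multiples_inv_sqrt_le hd X
          have h3 : 0 ≤ ∏ p ∈ T, h p := prod_nonneg fun p _ => hh p
          gcongr
      _ = _ := by
          rw [prod_div_distrib]; push_cast; ring
  refine (sum_le_sum h2).trans ?_
  rw [← mul_sum, ← prod_one_add, Real.exp_sum]
  refine mul_le_mul_of_nonneg_left (prod_le_prod (fun p _ => ?_) fun p _ => ?_) (by positivity)
  · have := hh p
    positivity
  · rw [add_comm]; exact Real.add_one_le_exp _

/-- The weight `(p / (p - 1)) ^ (j + 1)` on the primes larger than `j`. -/
noncomputable def primeWeight (j p : ℕ) : ℝ :=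
  if p.Prime ∧ j < p then (1 - (p : ℝ)⁻¹)⁻¹ ^ (j + 1) else 1

lemma inv_one_sub_inv_le {p : ℕ} (hp : p.Prime) :
    (1 - (p : ℝ)⁻¹)⁻¹ ≤ Real.exp (1 / (p - 1)) := by
  have h1 : (1 : ℝ) < p := by exact_mod_cast hp.one_lt
  have h2 : (1 - (p : ℝ)⁻¹)⁻¹ = 1 / (p - 1) + 1 := by
    have : (p : ℝ) - 1 ≠ 0 := by linarith
    have : (p : ℝ) ≠ 0 := by linarith
    field_simp
    ring
  rw [h2]
  exact Real.add_one_le_exp _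

lemma one_le_inv_one_sub_inv {p : ℕ} (hp : p.Prime) : 1 ≤ (1 - (p : ℝ)⁻¹)⁻¹ := by
  have h1 : (1 : ℝ) < p := by exact_mod_cast hp.one_lt
  have h2 : (p : ℝ)⁻¹ < 1 := inv_lt_one_of_one_lt₀ h1
  exact (one_le_inv₀ (by linarith)).2 (one_sub_inv_le_one p)

lemma one_le_primeWeight (j p : ℕ) : 1 ≤ primeWeight j p := by
  unfold primeWeight
  split_ifs with h
  · exact one_le_pow₀ (one_le_inv_one_sub_inv h.1)
  · exact le_rfl

lemma exp_two_le : Real.exp 2 ≤ 8 := by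
  have h1 := Real.exp_one_lt_d9
  have h2 : Real.exp 2 = Real.exp 1 ^ 2 := by rw [← Real.exp_nat_mul]; norm_num
  rw [h2]
  calc Real.exp 1 ^ 2 ≤ 2.7182818286 ^ 2 := by
        have := Real.exp_pos 1
        gcongr
    _ ≤ 8 := by norm_num

lemma exists_primeWeight_le_exp {j p : ℕ} (hp : p.Prime) (hj : j < p) :
    ∃ x : ℝ, 0 ≤ x ∧ x ≤ 2 ∧ x ≤ 2 * (j + 1) / p ∧ primeWeight j p ≤ Real.exp x := by
  have h1 : (2 : ℝ) ≤ p := by exact_mod_cast hp.two_le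
  have h2 : (j : ℝ) + 1 ≤ p := by exact_mod_cast hj
  have h3 : (0 : ℝ) < p - 1 := by linarith
  refine ⟨(j + 1) * (1 / (p - 1)), by positivity, ?_, ?_, ?_⟩
  · rw [mul_one_div, div_le_iff₀ h3]; linarith
  · rw [mul_one_div, div_le_div_iff₀ h3 (by linarith)]
    have : (0 : ℝ) ≤ j := by positivity
    nlinarith
  · rw [primeWeight, if_pos ⟨hp, hj⟩]
    have h4 : (0 : ℝ) ≤ (1 - (p : ℝ)⁻¹)⁻¹ := zero_le_one.trans (one_le_inv_one_sub_inv hp)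
    have h5 := pow_le_pow_left₀ h4 (inv_one_sub_inv_le hp) (j + 1)
    rw [← Real.exp_nat_mul] at h5
    push_cast at h5
    exact h5

lemma exp_sub_one_le {x : ℝ} : Real.exp x - 1 ≤ x * Real.exp x := by
  have h := Real.add_one_le_exp (-x)
  have h1 := Real.exp_pos x
  have h2 : Real.exp x * Real.exp (-x) = 1 := by rw [← Real.exp_add]; simp
  nlinarith [mul_le_mul_of_nonneg_left h h1.le]

lemma primeWeight_le_eight (j p : ℕ) : primeWeight j p ≤ 8 := by
  by_cases h : p.Prime ∧ j < p
  · obtain ⟨x, -, hx, -, h4⟩ := exists_primeWeight_le_exp h.1 h.2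
    exact h4.trans ((Real.exp_le_exp.2 hx).trans exp_two_le)
  · rw [primeWeight, if_neg h]; norm_num

lemma primeWeight_pow_four_sub_one_le {j p : ℕ} (hp : p.Prime) (hj : j < p) :
    primeWeight j p ^ 4 - 1 ≤ 32768 * (j + 1) / p := by
  obtain ⟨x, hx0, hx, hx', h4⟩ := exists_primeWeight_le_exp hp hj
  have h5 := pow_le_pow_left₀ (zero_le_one.trans (one_le_primeWeight j p)) h4 4
  have h6 : Real.exp x ^ 4 = Real.exp (4 * x) := by rw [← Real.exp_nat_mul]; norm_num
  have h7 : Real.exp x ^ 4 ≤ 8 ^ 4 :=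
    pow_le_pow_left₀ (Real.exp_pos x).le ((Real.exp_le_exp.2 hx).trans exp_two_le) 4
  have h8 := exp_sub_one_le (x := 4 * x)
  rw [← h6] at h8
  calc _ ≤ 4 * x * Real.exp x ^ 4 := by linarith
    _ ≤ 4 * (2 * (j + 1) / p) * 8 ^ 4 := by gcongr
    _ = _ := by ring

lemma sum_primes_inv_sq_le (Q : Finset ℕ) (j : ℕ) :
    ∑ p ∈ Q with j < p, ((p : ℝ) ^ 2)⁻¹ ≤ 2 / (j + 1) := by
  refine le_trans ?_ (sum_Ioo_inv_sq_le (α := ℝ) j (Q.sup id + 1))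
  refine sum_le_sum_of_subset_of_nonneg (fun p hp => ?_) fun p _ _ => by positivity
  rw [mem_filter] at hp
  exact mem_Ioo.2 ⟨hp.2, Nat.lt_succ_of_le (le_sup (f := id) hp.1)⟩

/-- Uniform moment bound for the weights. -/
lemma exists_moment_bound : ∃ C : ℝ, 0 ≤ C ∧ ∀ j X : ℕ,
    ∑ n ∈ Icc 1 X, wt (primeWeight j) n ^ 4 / √n ≤ C * √X := by
  refine ⟨2 * Real.exp 65536, by positivity, fun j X => ?_⟩
  have h1 : ∀ n, wt (primeWeight j) n ^ 4 = wt (fun p => 1 + (primeWeight j p ^ 4 - 1)) n := by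
    intro n
    unfold wt
    rw [← prod_pow]
    exact prod_congr rfl fun p _ => by ring
  simp_rw [h1]
  refine (sum_wt_div_sqrt_le (h := fun p => primeWeight j p ^ 4 - 1) (fun p => ?_) X).trans ?_
  · linarith [one_le_pow₀ (one_le_primeWeight j p) (n := 4)]
  have h2 : ∑ p ∈ Icc 1 X with p.Prime, (primeWeight j p ^ 4 - 1) / p ≤ 65536 := by
    calc _ ≤ ∑ p ∈ Icc 1 X with p.Prime, (if j < p then 32768 * ((j : ℝ) + 1) * ((p : ℝ) ^ 2)⁻¹ else 0) := by
          refine sum_le_sum fun p hp => ?_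
          have hp' := (mem_filter.1 hp).2
          split_ifs with hj
          · have h3 := primeWeight_pow_four_sub_one_le hp' hj
            calc _ ≤ (32768 * (j + 1) / p) / (p : ℝ) := by gcongr
              _ = _ := by rw [div_div, ← sq]; rfl
          · rw [primeWeight, if_neg (fun h => hj h.2)]; simp
      _ = 32768 * ((j : ℝ) + 1) * ∑ p ∈ (Icc 1 X).filter Nat.Prime with j < p, ((p : ℝ) ^ 2)⁻¹ := by
          rw [← sum_filter, ← mul_sum]
      _ ≤ 32768 * ((j : ℝ) + 1) * (2 / (j + 1)) := by
          have := sum_primes_inv_sq_le ((Icc 1 X).filter Nat.Prime) j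
          gcongr
      _ = 65536 := by field_simp; norm_num
  have h3 := Real.exp_le_exp.2 h2
  calc _ ≤ 2 * √X * Real.exp 65536 := by gcongr
    _ = _ := by ring

lemma root4_inv_pow_five (p : ℕ) : root4 (p : ℝ)⁻¹ ^ 5 = (p : ℝ) ^ (-(5 / 4) : ℝ) := by
  unfold root4
  rw [Real.sqrt_eq_rpow, Real.sqrt_eq_rpow, ← Real.rpow_mul (by positivity),
    ← Real.rpow_natCast, ← Real.rpow_mul (by positivity), Real.inv_rpow (by positivity),
    ← Real.rpow_neg (by positivity)]
  norm_num

/-- The product of the local factors is uniformly bounded. -/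
lemma exists_prod_localFactor_le : ∃ C : ℝ, 0 ≤ C ∧ ∀ (j : ℕ) (P : Finset ℕ),
    (∀ p ∈ P, p.Prime) → ∏ p ∈ P, localFactor (primeWeight j) p ≤ C := by
  have hs : Summable (fun n : ℕ => (n : ℝ) ^ (-(5 / 4) : ℝ)) :=
    Real.summable_nat_rpow.2 (by norm_num)
  set S := ∑' n : ℕ, (n : ℝ) ^ (-(5 / 4) : ℝ) with hS
  refine ⟨Real.exp (localConst * (S + 65536)), by positivity, fun j P hP => ?_⟩
  have hc := localConst_pos
  have h1 : ∀ p ∈ P, localFactor (primeWeight j) p ≤ Real.exp (localConst *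
      ((p : ℝ) ^ (-(5 / 4) : ℝ) + if j < p then 32768 * ((j : ℝ) + 1) * ((p : ℝ) ^ 2)⁻¹ else 0)) := by
    intro p hp
    rw [localFactor, root4_inv_pow_five, root4_pow (by positivity), add_comm]
    refine (Real.add_one_le_exp _).trans (Real.exp_le_exp.2 ?_)
    gcongr
    split_ifs with hj
    · have h3 := primeWeight_pow_four_sub_one_le (hP p hp) hj
      have h4 : primeWeight j p ≤ primeWeight j p ^ 4 :=
        le_self_pow₀ (one_le_primeWeight j p) (by norm_num)
      calc _ ≤ (32768 * (j + 1) / p) * (p : ℝ)⁻¹ := by gcongr; linarith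
        _ = _ := by rw [sq, mul_inv]; ring
    · rw [primeWeight, if_neg (fun h => hj h.2)]; simp
  refine (prod_le_prod (fun p _ => localFactor_nonneg (one_le_primeWeight j) p) h1).trans ?_
  rw [← Real.exp_sum]
  apply Real.exp_le_exp.2
  rw [← mul_sum, sum_add_distrib]
  have h2 : ∑ p ∈ P, (p : ℝ) ^ (-(5 / 4) : ℝ) ≤ S :=
    hs.sum_le_tsum _ fun p _ => by positivity
  have h3 : ∑ p ∈ P, (if j < p then 32768 * ((j : ℝ) + 1) * ((p : ℝ) ^ 2)⁻¹ else 0) ≤ 65536 := by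
    rw [← sum_filter, ← mul_sum]
    calc _ ≤ 32768 * ((j : ℝ) + 1) * (2 / (j + 1)) := by
          have := sum_primes_inv_sq_le P j
          gcongr
      _ = 65536 := by field_simp; norm_num
  gcongr

/-- The bilinear bound. -/
theorem exists_bilinear_bound : ∃ C : ℝ, 0 ≤ C ∧ ∀ (ψ : ℕ → ℝ) (j : ℕ) (t : ℝ)
    (V W : Finset ℕ) (E : Finset (ℕ × ℕ)), (∀ v, 0 ≤ ψ v) → 0 ≤ t → (∀ v ∈ V, v ≠ 0) →
    (∀ w ∈ W, w ≠ 0) → E ⊆ V ×ˢ W → (∀ e ∈ E, ψ e.1 * e.2 ≤ t * Nat.gcd e.1 e.2) →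
    (∀ e ∈ E, ψ e.2 * e.1 ≤ t * Nat.gcd e.1 e.2) →
    edgeSum ψ (primeWeight j) E ≤
      C * √t * (root4 (∑ v ∈ V, mass ψ v) ^ 3 * root4 (∑ w ∈ W, mass ψ w) ^ 3) := by
  obtain ⟨C₁, hC₁, h1⟩ := exists_moment_bound
  obtain ⟨C₂, hC₂, h2⟩ := exists_prod_localFactor_le
  refine ⟨C₂ * √C₁, by positivity, fun ψ j t V W E hψ ht hV hW hE ht₁ ht₂ => ?_⟩
  set P := (range (V.sup id + 1)).filter Nat.Prime with hP
  have hPp : ∀ p ∈ P, p.Prime := fun p hp => (mem_filter.1 hp).2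
  have hal : Aligned ψ t P 1 1 V W E := by
    refine ⟨one_ne_zero, one_ne_zero, fun p hp h => ?_, fun p hp h => ?_,
      fun v hv => ⟨hV v hv, one_dvd v⟩, fun w hw => ⟨hW w hw, one_dvd w⟩, hE,
      fun e he q hq hqP => ?_, ht₁, ht₂⟩
    · exact (hPp p hp).one_lt.ne' (Nat.dvd_one.1 h)
    · exact (hPp p hp).one_lt.ne' (Nat.dvd_one.1 h)
    · have h3 := (mem_product.1 (hE he)).1
      have h4 : ¬ q ∣ Nat.gcd e.1 e.2 := fun h => by
        have h5 := Nat.le_of_dvd (Nat.pos_of_ne_zero (hV _ h3)) (h.trans (Nat.gcd_dvd_left _ _))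
        have h6 : e.1 ≤ V.sup id := le_sup (f := id) h3
        exact hqP (mem_filter.2 ⟨mem_range.2 (by omega), hq⟩)
      rw [Nat.factorization_eq_zero_of_not_dvd h4]
      simp
  have h3 := hal.edgeSum_le hψ (one_le_primeWeight j) (fun p _ => primeWeight_le_eight j p) ht hC₁
    (h1 j) hPp
  have h4 : pairBound (primeWeight j) t 1 1 = √t := by
    simp [pairBound, wt, root4, Real.sqrt_sq ht]
  rw [h4] at h3
  have h5 := h2 j P hPp
  have h6 := root4_nonneg (∑ v ∈ V, mass ψ v)
  have h7 := root4_nonneg (∑ v ∈ W, mass ψ v)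
  calc _ ≤ C₂ * (√C₁ * √t * (root4 (∑ v ∈ V, mass ψ v) ^ 3 * root4 (∑ w ∈ W, mass ψ w) ^ 3)) :=
        h3.trans (by gcongr)
    _ = _ := by ring

lemma inv_rho_eq_wt {n : ℕ} (hn : n ≠ 0) :
    (rho n)⁻¹ = wt (fun p => 1 + 1 / ((p : ℝ) - 1)) n := by
  rw [rho_eq_prod hn, wt, ← prod_inv_distrib]
  refine prod_congr rfl fun p hp => ?_
  have h1 : (1 : ℝ) < p := by exact_mod_cast (Nat.prime_of_mem_primeFactors hp).one_lt
  have h2 : (p : ℝ) - 1 ≠ 0 := by linarith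
  have h3 : (p : ℝ) ≠ 0 := by linarith
  field_simp
  ring

lemma wt_one_add_eq_sum (h : ℕ → ℝ) {n X : ℕ} (hn : n ≠ 0) (hX : n ≤ X) :
    wt (fun p => 1 + h p) n = ∑ T ∈ ((Icc 1 X).filter Nat.Prime).powerset,
      if ∏ p ∈ T, p ∣ n then ∏ p ∈ T, h p else 0 := by
  have hsub : n.primeFactors ⊆ (Icc 1 X).filter Nat.Prime := fun p hp => by
    have hp' := Nat.prime_of_mem_primeFactors hp
    rw [mem_filter, mem_Icc]
    exact ⟨⟨hp'.one_lt.le, (Nat.le_of_mem_primeFactors hp).trans hX⟩, hp'⟩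
  rw [wt, prod_one_add, ← sum_filter]
  congr 1
  ext T
  simp only [mem_powerset, mem_filter]
  constructor
  · intro hT
    exact ⟨hT.trans hsub,
      (prod_primes_dvd_iff (fun p hp => Nat.prime_of_mem_primeFactors (hT hp)) hn).2 hT⟩
  · rintro ⟨hT, hd⟩
    exact (prod_primes_dvd_iff (fun p hp => (mem_filter.1 (hT hp)).2) hn).1 hd

lemma card_coprime_multiples_le {d m X : ℕ} (hd : 0 < d) (hm : 0 < m) (hmX : m ^ 2 ≤ X) :
    (#{n ∈ Icc 1 X | n.Coprime m ∧ d ∣ n} : ℝ) ≤ 2 * X * rho m * (1 / √d) := by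
  have hd' : (1 : ℝ) ≤ d := by exact_mod_cast hd
  have hm' : (0 : ℝ) < m := by exact_mod_cast hm
  have hmX' : (m : ℝ) ≤ √X := Real.le_sqrt_of_sq_le (by exact_mod_cast hmX)
  have hsX : √(X : ℝ) * √X = X := Real.mul_self_sqrt (by positivity)
  have hsd : √(d : ℝ) * √d = d := Real.mul_self_sqrt (by positivity)
  have hsd0 : 1 ≤ √(d : ℝ) := Real.one_le_sqrt.2 hd'
  by_cases hdX : d ≤ X
  · have h1 : #{n ∈ Icc 1 X | n.Coprime m ∧ d ∣ n} ≤ m.totient * (X / d / m + 1) := by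
      calc _ ≤ #((Ico 1 (1 + X / d)).filter (m.Coprime ·)) := by
            refine card_le_card_of_injOn (· / d) (fun n hn => ?_) fun x hx y hy hxy => ?_
            · simp only [coe_filter, Set.mem_ofPred_eq, mem_Icc] at hn
              obtain ⟨⟨h1, h2⟩, h3, k, rfl⟩ := hn
              simp only [Nat.mul_div_cancel_left k hd, coe_filter, Set.mem_ofPred_eq, mem_Ico]
              refine ⟨⟨Nat.pos_of_ne_zero (by rintro rfl; simp at h1), ?_⟩,
                (Nat.Coprime.coprime_dvd_left (dvd_mul_left k d) h3).symm⟩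
              have := (Nat.le_div_iff_mul_le hd).2 (by linarith [mul_comm k d] : k * d ≤ X)
              omega
            · simp only [coe_filter, Set.mem_ofPred_eq, mem_Icc] at hx hy
              obtain ⟨-, -, k, rfl⟩ := hx
              obtain ⟨-, -, l, rfl⟩ := hy
              simp only [Nat.mul_div_cancel_left _ hd] at hxy
              rw [hxy]
        _ ≤ _ := Nat.Ico_filter_coprime_le (a := m) 1 (X / d) hm.ne'
    have h2 : ((X / d / m : ℕ) : ℝ) ≤ X / d / m :=
      Nat.cast_div_le.trans (by gcongr; exact Nat.cast_div_le)
    calc (#{n ∈ Icc 1 X | n.Coprime m ∧ d ∣ n} : ℝ) ≤ m.totient * (X / d / m + 1) := by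
          refine (Nat.cast_le.2 h1).trans ?_
          push_cast
          gcongr
      _ ≤ m.totient * (2 * X * (1 / m) * (1 / √d)) := by
          gcongr
          have h3 : (X : ℝ) / d / m ≤ X * (1 / m) * (1 / √d) := by
            calc (X : ℝ) / d / m = X * (1 / m) * (1 / d) := by ring
              _ ≤ _ := by
                gcongr
                nlinarith
          have h4 : (1 : ℝ) ≤ X * (1 / m) * (1 / √d) := by
            rw [mul_one_div, mul_one_div, div_div, one_le_div (by positivity), ← hsX]
            have : √(d : ℝ) ≤ √X := Real.sqrt_le_sqrt (by exact_mod_cast hdX)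
            gcongr
          linarith
      _ = _ := by unfold rho; ring
  · rw [filter_false_of_mem]
    · have := rho_nonneg m
      simp only [card_empty, Nat.cast_zero]
      positivity
    · rintro n hn ⟨-, h⟩
      rw [mem_Icc] at hn
      exact hdX ((Nat.le_of_dvd hn.1 h).trans hn.2)

/-- The average of `n / φ(n)` over the integers up to `X` coprime to a small modulus. -/
lemma exists_sum_inv_rho_le : ∃ C : ℝ, 0 ≤ C ∧ ∀ m X : ℕ, 0 < m → m ^ 2 ≤ X →
    ∑ n ∈ Icc 1 X with n.Coprime m, (rho n)⁻¹ ≤ C * X * rho m := by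
  have hs : Summable (fun n : ℕ => (n : ℝ) ^ (-(3 / 2) : ℝ)) :=
    Real.summable_nat_rpow.2 (by norm_num)
  set S := ∑' n : ℕ, (n : ℝ) ^ (-(3 / 2) : ℝ) with hS
  refine ⟨2 * Real.exp (2 * S), by positivity, fun m X hm hmX => ?_⟩
  set Q := (Icc 1 X).filter Nat.Prime with hQ
  have hQp : ∀ p ∈ Q, p.Prime := fun p hp => (mem_filter.1 hp).2
  set h : ℕ → ℝ := fun p => 1 / ((p : ℝ) - 1) with hh
  have hρ := rho_nonneg m
  have h1 : ∀ n ∈ (Icc 1 X).filter (Nat.Coprime · m), (rho n)⁻¹ =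
      ∑ T ∈ Q.powerset, if ∏ p ∈ T, p ∣ n then ∏ p ∈ T, h p else 0 := by
    intro n hn
    rw [mem_filter, mem_Icc] at hn
    rw [inv_rho_eq_wt (by omega), wt_one_add_eq_sum _ (by omega) hn.1.2]
  rw [sum_congr rfl h1, sum_comm]
  have h2 : ∀ T ∈ Q.powerset, ∑ n ∈ Icc 1 X with n.Coprime m,
      (if ∏ p ∈ T, p ∣ n then ∏ p ∈ T, h p else 0) ≤
      2 * X * rho m * ∏ p ∈ T, (h p / √p) := by
    intro T hT
    rw [mem_powerset] at hT
    have hd : 0 < ∏ p ∈ T, p := prod_pos fun p hp => (hQp p (hT hp)).pos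
    have h3 : 0 ≤ ∏ p ∈ T, h p := prod_nonneg fun p hp => by
      have : (1 : ℝ) ≤ p := by exact_mod_cast (hQp p (hT hp)).one_lt.le
      exact div_nonneg zero_le_one (by linarith)
    rw [← sum_filter, filter_filter, sum_const, nsmul_eq_mul]
    have h4 := card_coprime_multiples_le hd hm hmX
    calc _ ≤ 2 * X * rho m * (1 / √(∏ p ∈ T, p : ℕ)) * ∏ p ∈ T, h p := by gcongr
      _ = _ := by
        rw [prod_div_distrib h, Nat.cast_prod, Real.sqrt_prod _ (fun p _ => by positivity)]; ring
  refine (sum_le_sum h2).trans ?_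
  rw [← mul_sum, ← prod_one_add]
  have h5 : ∏ p ∈ Q, (1 + h p / √p) ≤ Real.exp (2 * S) := by
    calc _ ≤ ∏ p ∈ Q, Real.exp (2 * (p : ℝ) ^ (-(3 / 2) : ℝ)) := by
          refine prod_le_prod (fun p hp => ?_) fun p hp => ?_
          · have : (1 : ℝ) < p := by exact_mod_cast (hQp p hp).one_lt
            have : 0 ≤ h p := div_nonneg zero_le_one (by linarith)
            positivity
          · have h6 : (2 : ℝ) ≤ p := by exact_mod_cast (hQp p hp).two_le
            have h7 : h p ≤ 2 / p := by
              rw [hh]; simp only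
              rw [div_le_div_iff₀ (by linarith) (by linarith)]; linarith
            have h8 : (p : ℝ) ^ (-(3 / 2) : ℝ) = 1 / p / √p := by
              rw [Real.sqrt_eq_rpow, Real.rpow_neg (by positivity), div_div, one_div]
              congr 1
              rw [show (3 / 2 : ℝ) = 1 + 1 / 2 by norm_num, Real.rpow_add (by linarith),
                Real.rpow_one]
            rw [add_comm]
            refine le_trans ?_ (Real.add_one_le_exp _)
            rw [h8]
            gcongr
            calc h p / √p ≤ 2 / p / √p := by gcongr
              _ = _ := by ring
      _ = Real.exp (2 * ∑ p ∈ Q, (p : ℝ) ^ (-(3 / 2) : ℝ)) := by rw [← Real.exp_sum, mul_sum]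
      _ ≤ _ := by
          have := hs.sum_le_tsum Q fun p _ => by positivity
          gcongr
  calc _ ≤ 2 * X * rho m * Real.exp (2 * S) := by gcongr
    _ = _ := by ring

/-- Upper bound sieve for a complete residue system, by the Chinese remainder theorem. -/
lemma card_sieve_le {g : ℕ} (ok : ℕ → ℕ → Prop) [∀ p, DecidablePred (ok p)]
    (hper : ∀ p k, ok p k → ok p (k % p)) :
    (#{k ∈ range g | ∀ p ∈ g.primeFactors, ok p k} : ℝ) ≤
      g * ∏ p ∈ g.primeFactors, ((#{k ∈ range p | ok p k} : ℝ) / p) := by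
  set q := ∏ p ∈ g.primeFactors, p with hq
  have hqg : q ∣ g := Nat.prod_primeFactors_dvd g
  have hq0 : 0 < q := prod_pos fun p hp => (Nat.prime_of_mem_primeFactors hp).pos
  have h1 : #{k ∈ range g | ∀ p ∈ g.primeFactors, ok p k} ≤
      g / q * ∏ p ∈ g.primeFactors, #{k ∈ range p | ok p k} := by
    rw [← card_pi, ← card_range (g / q), ← card_product]
    refine card_le_card_of_injOn (fun k => (k / q, fun p _ => k % p)) (fun k hk => ?_)
      fun k hk l hl hkl => ?_
    · simp only [coe_filter, Set.mem_ofPred_eq, mem_range] at hk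
      simp only [coe_product, Set.mem_prod, mem_coe, mem_range, Finset.mem_pi, mem_filter]
      refine ⟨Nat.div_lt_of_lt_mul (by rw [Nat.mul_div_cancel' hqg]; exact hk.1), fun p hp => ?_⟩
      exact ⟨Nat.mod_lt _ (Nat.prime_of_mem_primeFactors hp).pos, hper p k (hk.2 p hp)⟩
    · simp only [Prod.mk.injEq] at hkl
      have h2 : k ≡ l [MOD q] := by
        rw [Nat.modEq_iff_dvd, hq, Nat.cast_prod]
        refine prod_dvd_of_coprime (fun p hp r hr hpr => ?_) fun p hp => ?_
        · exact Nat.isCoprime_iff_coprime.2 ((Nat.coprime_primes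
            (Nat.prime_of_mem_primeFactors hp) (Nat.prime_of_mem_primeFactors hr)).2 hpr)
        · exact Nat.modEq_iff_dvd.1 (congr_fun (congr_fun hkl.2 p) hp)
      rw [← Nat.div_add_mod k q, ← Nat.div_add_mod l q, hkl.1, h2]
  have hq0' : (0 : ℝ) < q := by exact_mod_cast hq0
  calc _ ≤ ((g / q * ∏ p ∈ g.primeFactors, #{k ∈ range p | ok p k} : ℕ) : ℝ) := by
        exact_mod_cast h1
    _ = _ := by
        rw [prod_div_distrib, Nat.cast_mul, Nat.cast_div hqg hq0'.ne', hq, Nat.cast_prod,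
          Nat.cast_prod]
        ring

lemma exists_lt_prime_dvd {p : ℕ} (hp : p.Prime) {y : ℕ} (hy : ¬ p ∣ y) (b : ℤ) :
    ∃ k < p, (p : ℤ) ∣ b + k * y := by
  have := Fact.mk hp
  have : NeZero p := ⟨hp.ne_zero⟩
  have hy' : (y : ZMod p) ≠ 0 := by rwa [Ne, ZMod.natCast_eq_zero_iff]
  refine ⟨(-(b : ZMod p) / y).val, ZMod.val_lt _, ?_⟩
  rw [← ZMod.intCast_zmod_eq_zero_iff_dvd]
  push_cast
  rw [ZMod.natCast_zmod_val]
  field_simp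
  ring

lemma card_local_le {p : ℕ} (hp : p.Prime) {a b : ℤ} {x y : ℕ} (hxy : Nat.Coprime x y) :
    (#{k ∈ range p | ¬ (p : ℤ) ∣ a + (k : ℕ) * x ∧ ¬ (p : ℤ) ∣ b + (k : ℕ) * y} : ℝ) / p ≤
      (1 - (p : ℝ)⁻¹) * if (p : ℤ) ∣ x * y * (a * y - b * x) then 1 else 1 - (p : ℝ)⁻¹ := by
  have hp0 : (0 : ℝ) < p := by exact_mod_cast hp.pos
  have hp1 := hp.one_lt
  set S := (range p).filter fun k => ¬ (p : ℤ) ∣ a + (k : ℕ) * x ∧ ¬ (p : ℤ) ∣ b + (k : ℕ) * y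
    with hS
  have hone : ∀ k < p, k ∉ S → (#S : ℝ) / p ≤ 1 - (p : ℝ)⁻¹ := by
    intro k hk hkS
    have h1 : #S ≤ #((range p).erase k) :=
      card_le_card fun l hl => mem_erase.2 ⟨fun h => hkS (h ▸ hl), (mem_filter.1 hl).1⟩
    rw [card_erase_of_mem (mem_range.2 hk), card_range] at h1
    have h2 : (#S : ℝ) ≤ p - 1 := by
      rw [← Nat.cast_one, ← Nat.cast_sub hp1.le]; exact_mod_cast h1
    rw [div_le_iff₀ hp0, sub_mul, inv_mul_cancel₀ hp0.ne', one_mul]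
    exact h2
  by_cases hx : p ∣ x
  · have hy : ¬ p ∣ y := fun hy => hp.one_lt.ne' (Nat.dvd_one.1 (hxy ▸ Nat.dvd_gcd hx hy))
    rw [if_pos (Dvd.dvd.mul_right (Dvd.dvd.mul_right (Int.natCast_dvd_natCast.2 hx) _) _), mul_one]
    obtain ⟨k, hk, hkd⟩ := exists_lt_prime_dvd hp hy b
    exact hone k hk fun h => (mem_filter.1 h).2.2 hkd
  obtain ⟨k, hk, hkd⟩ := exists_lt_prime_dvd hp hx a
  have hkS : k ∉ S := fun h => (mem_filter.1 h).2.1 hkd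
  split_ifs with hd
  · rw [mul_one]
    exact hone k hk hkS
  have hy : ¬ p ∣ y := fun hy => hd
    (Dvd.dvd.mul_right (Dvd.dvd.mul_left (Int.natCast_dvd_natCast.2 hy) _) _)
  obtain ⟨l, hl, hld⟩ := exists_lt_prime_dvd hp hy b
  have hlS : l ∉ S := fun h => (mem_filter.1 h).2.2 hld
  have hkl : k ≠ l := by
    rintro rfl
    apply hd
    have h1 : a * y - b * x = (a + k * x) * y - (b + k * y) * x := by ring
    rw [h1]
    exact Dvd.dvd.mul_left (dvd_sub (hkd.mul_right _) (hld.mul_right _)) _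
  have h1 : #S ≤ #(((range p).erase k).erase l) :=
    card_le_card fun i hi => mem_erase.2 ⟨fun h => hlS (h ▸ hi),
      mem_erase.2 ⟨fun h => hkS (h ▸ hi), (mem_filter.1 hi).1⟩⟩
  rw [card_erase_of_mem (mem_erase.2 ⟨hkl.symm, mem_range.2 hl⟩),
    card_erase_of_mem (mem_range.2 hk), card_range] at h1
  have h2 : (#S : ℝ) ≤ p - 2 := by
    have : #S + 2 ≤ p := by omega
    have : (#S : ℝ) + 2 ≤ p := by exact_mod_cast this
    linarith
  calc (#S : ℝ) / p ≤ (p - 2) / p := by gcongr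
    _ ≤ (1 - (p : ℝ)⁻¹) * (1 - (p : ℝ)⁻¹) := by
      have h3 : ((p : ℝ) - 2) / p = 1 - 2 * (p : ℝ)⁻¹ := by field_simp
      rw [h3]
      nlinarith [sq_nonneg ((p : ℝ)⁻¹)]

open Classical in
/-- Pairs of reduced residues `a` mod `g * x` and `b` mod `g * y` with
`a / (g * x) - b / (g * y) = h / (g * x * y)` modulo one. -/
noncomputable def pairSet (g x y : ℕ) (h : ℤ) : Finset (ℕ × ℕ) :=
  (range (g * x) ×ˢ range (g * y)).filter fun e => e.1.Coprime (g * x) ∧ e.2.Coprime (g * y) ∧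
    ∃ n : ℤ, (e.1 : ℤ) * y - (e.2 + n * (g * y)) * x = h

lemma mem_pairSet {g x y : ℕ} {h : ℤ} {e : ℕ × ℕ} : e ∈ pairSet g x y h ↔
    (e.1 < g * x ∧ e.2 < g * y) ∧ e.1.Coprime (g * x) ∧ e.2.Coprime (g * y) ∧
      ∃ n : ℤ, (e.1 : ℤ) * y - (e.2 + n * (g * y)) * x = h := by
  simp only [pairSet, mem_filter, mem_product, mem_range]

lemma not_dvd_of_coprime_of_modEq {p n : ℕ} {a : ℕ} {z : ℤ} (hp : p.Prime) (hpn : p ∣ n)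
    (han : a.Coprime n) (hz : (p : ℤ) ∣ a - z) : ¬ (p : ℤ) ∣ z := by
  intro h
  have h1 : (p : ℤ) ∣ a := by have := dvd_add hz h; rwa [sub_add_cancel] at this
  exact hp.one_lt.ne' (Nat.dvd_one.1 (han ▸ Nat.dvd_gcd (Int.natCast_dvd_natCast.1 h1) hpn))

lemma coprime_of_mem_pairSet {g x y : ℕ} (hxy : Nat.Coprime x y) {h : ℤ} {e : ℕ × ℕ}
    (he : e ∈ pairSet g x y h) : h.natAbs.Coprime (x * y) := by
  obtain ⟨-, h1, h2, n, hn⟩ := mem_pairSet.1 he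
  refine Nat.Coprime.symm (Nat.coprime_of_dvd fun p hp hpd hph => ?_)
  have hph' : (p : ℤ) ∣ h := Int.natCast_dvd.2 hph
  have hpp : Prime (p : ℤ) := Nat.prime_iff_prime_int.1 hp
  rcases (hp.dvd_mul).1 hpd with hx | hy
  · have hx' : (p : ℤ) ∣ x := Int.natCast_dvd_natCast.2 hx
    have h3 : (p : ℤ) ∣ e.1 * y := by
      have := dvd_add hph' (hx'.mul_left (e.2 + n * (g * y)))
      rwa [← hn, sub_add_cancel] at this
    rcases hpp.dvd_or_dvd h3 with h4 | h4
    · exact hp.one_lt.ne' (Nat.dvd_one.1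
        (h1 ▸ Nat.dvd_gcd (Int.natCast_dvd_natCast.1 h4) (hx.mul_left g)))
    · exact hp.one_lt.ne' (Nat.dvd_one.1 (hxy ▸ Nat.dvd_gcd hx (Int.natCast_dvd_natCast.1 h4)))
  · have hy' : (p : ℤ) ∣ y := Int.natCast_dvd_natCast.2 hy
    have h3 : (p : ℤ) ∣ (e.2 + n * (g * y)) * x := by
      have := dvd_sub (hy'.mul_left (e.1 : ℤ)) hph'
      rwa [← hn, sub_sub_cancel] at this
    rcases hpp.dvd_or_dvd h3 with h4 | h4
    · have h5 : (p : ℤ) ∣ e.2 := by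
        have := dvd_sub h4 (hy'.mul_left (n * g))
        rwa [show (e.2 : ℤ) + n * (g * y) - n * g * y = e.2 by ring] at this
      exact hp.one_lt.ne' (Nat.dvd_one.1
        (h2 ▸ Nat.dvd_gcd (Int.natCast_dvd_natCast.1 h5) (hy.mul_left g)))
    · exact hp.one_lt.ne' (Nat.dvd_one.1 (hxy ▸ Nat.dvd_gcd (Int.natCast_dvd_natCast.1 h4) hy))

lemma card_pairSet_le_prod {g x y : ℕ} (hg : g ≠ 0) (hx : x ≠ 0) (hy : y ≠ 0)
    (hxy : Nat.Coprime x y) (h : ℤ) :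
    (#(pairSet g x y h) : ℝ) ≤ g * ∏ p ∈ g.primeFactors,
      ((1 - (p : ℝ)⁻¹) * if (p : ℤ) ∣ x * y * h then 1 else 1 - (p : ℝ)⁻¹) := by
  obtain ⟨s, t, hst⟩ := Nat.isCoprime_iff_coprime.2 hxy
  set a : ℤ := h * t with ha
  set b : ℤ := -(h * s) with hb
  have hab : a * y - b * x = h := by
    rw [ha, hb]; linear_combination h * hst
  have hx' : (x : ℤ) ≠ 0 := by exact_mod_cast hx
  have hy' : (y : ℤ) ≠ 0 := by exact_mod_cast hy
  have hg' : (g : ℤ) ≠ 0 := by exact_mod_cast hg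
  have hkey : ∀ e ∈ pairSet g x y h, ∃ k : ℕ, k < g ∧ ((g * x : ℕ) : ℤ) ∣ e.1 - (a + k * x) ∧
      ((g * y : ℕ) : ℤ) ∣ e.2 - (b + k * y) := by
    intro e he
    obtain ⟨-, -, -, n, hn⟩ := mem_pairSet.1 he
    have h1 : ((e.1 : ℤ) - a) * y = (e.2 + n * (g * y) - b) * x := by
      linear_combination hn - hab
    have h2 : (x : ℤ) ∣ (e.1 : ℤ) - a :=
      (Nat.isCoprime_iff_coprime.2 hxy).dvd_of_dvd_mul_right (h1 ▸ Dvd.intro_left _ rfl)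
    obtain ⟨k, hk⟩ := h2
    have h3 : (e.2 : ℤ) + n * (g * y) - b = k * y := by
      have : ((e.2 : ℤ) + n * (g * y) - b) * x = k * y * x := by rw [← h1, hk]; ring
      exact mul_right_cancel₀ hx' this
    have h4 : 0 ≤ k % g := Int.emod_nonneg _ hg'
    have h5 : ((k % g).toNat : ℤ) = k % g := Int.toNat_of_nonneg h4
    have h6 := Int.emod_add_mul_ediv k g
    refine ⟨(k % g).toNat, ?_, ⟨k / g, ?_⟩, ⟨k / g - n, ?_⟩⟩
    · have := Int.emod_lt_of_pos k (by positivity : (0 : ℤ) < g)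
      omega
    · rw [h5]; push_cast
      linear_combination hk - x * h6
    · rw [h5]; push_cast
      linear_combination h3 - y * h6
  choose! κ hκ using hkey
  have h1 : #(pairSet g x y h) ≤ #{k ∈ range g | ∀ p ∈ g.primeFactors,
      (¬ (p : ℤ) ∣ a + (k : ℕ) * x ∧ ¬ (p : ℤ) ∣ b + (k : ℕ) * y)} := by
    refine card_le_card_of_injOn κ (fun e he => ?_) fun e he e' he' hee => ?_
    · obtain ⟨h2, h3, h4⟩ := hκ e he
      obtain ⟨-, h5, h6, -⟩ := mem_pairSet.1 he
      refine mem_coe.2 (mem_filter.2 ⟨mem_range.2 h2, fun p hp => ?_⟩)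
      have hp' := Nat.prime_of_mem_primeFactors hp
      have hpg := Nat.dvd_of_mem_primeFactors hp
      exact ⟨not_dvd_of_coprime_of_modEq hp' (hpg.mul_right x) h5
          ((Int.natCast_dvd_natCast.2 (hpg.mul_right x)).trans h3),
        not_dvd_of_coprime_of_modEq hp' (hpg.mul_right y) h6
          ((Int.natCast_dvd_natCast.2 (hpg.mul_right y)).trans h4)⟩
    · obtain ⟨-, h3, h4⟩ := hκ e he
      obtain ⟨-, h3', h4'⟩ := hκ e' he'
      rw [← hee] at h3' h4'
      obtain ⟨h5, h6⟩ := (mem_pairSet.1 he).1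
      obtain ⟨h5', h6'⟩ := (mem_pairSet.1 he').1
      have h7 : e.1 ≡ e'.1 [MOD g * x] := by
        rw [Nat.modEq_iff_dvd]; have := dvd_sub h3' h3; rwa [sub_sub_sub_cancel_right] at this
      have h8 : e.2 ≡ e'.2 [MOD g * y] := by
        rw [Nat.modEq_iff_dvd]; have := dvd_sub h4' h4; rwa [sub_sub_sub_cancel_right] at this
      exact Prod.ext (h7.eq_of_lt_of_lt h5 h5') (h8.eq_of_lt_of_lt h6 h6')
  refine (Nat.cast_le.2 h1).trans ((card_sieve_le
    (fun p k => ¬ (p : ℤ) ∣ a + (k : ℕ) * x ∧ ¬ (p : ℤ) ∣ b + (k : ℕ) * y) ?_).trans ?_)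
  · rintro p k ⟨h2, h3⟩
    have h4 : (p : ℤ) ∣ k - (k % p : ℕ) := by
      push_cast; exact Int.dvd_self_sub_emod
    refine ⟨fun h5 => h2 ?_, fun h5 => h3 ?_⟩
    · rw [show a + (k : ℤ) * x = a + (k % p : ℕ) * x + (k - (k % p : ℕ)) * x by ring]
      exact dvd_add h5 (h4.mul_right _)
    · rw [show b + (k : ℤ) * y = b + (k % p : ℕ) * y + (k - (k % p : ℕ)) * y by ring]
      exact dvd_add h5 (h4.mul_right _)
  · gcongr with p hp
    have := card_local_le (Nat.prime_of_mem_primeFactors hp) (a := a) (b := b) hxy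
    rwa [hab] at this

lemma prod_mul_prod_le_prod_union {f : ℕ → ℝ} {S T : Finset ℕ}
    (h0 : ∀ p ∈ S ∪ T, 0 ≤ f p) (h1 : ∀ p ∈ S ∪ T, f p ≤ 1) :
    (∏ p ∈ S, f p) * ∏ p ∈ T, f p ≤ ∏ p ∈ S ∪ T, f p := by
  rw [← prod_union_inter]
  have h2 : 0 ≤ ∏ p ∈ S ∪ T, f p := prod_nonneg h0
  refine mul_le_of_le_one_right h2 (prod_le_one (fun p hp => ?_) fun p hp => ?_)
  · exact h0 p (mem_union_left _ (mem_inter.1 hp).1)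
  · exact h1 p (mem_union_left _ (mem_inter.1 hp).1)

lemma rho_pos {n : ℕ} (hn : n ≠ 0) : 0 < rho n := by
  have := Nat.totient_pos.2 (Nat.pos_of_ne_zero hn)
  unfold rho
  positivity

lemma card_pairSet_le {g x y : ℕ} (hg : g ≠ 0) (hx : x ≠ 0) (hy : y ≠ 0)
    (hxy : Nat.Coprime x y) {h : ℤ} (hh : h ≠ 0) :
    (#(pairSet g x y h) : ℝ) ≤
      g * rho (g * x) * rho (g * y) * (rho (x * y))⁻¹ * (rho h.natAbs)⁻¹ := by
  refine (card_pairSet_le_prod hg hx hy hxy h).trans ?_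
  have hxy0 : x * y ≠ 0 := mul_ne_zero hx hy
  have hh0 : h.natAbs ≠ 0 := Int.natAbs_ne_zero.2 hh
  have hρ1 := rho_pos hxy0
  have hρ2 := rho_pos hh0
  set f : ℕ → ℝ := fun p => 1 - (p : ℝ)⁻¹ with hf
  have hf1 : ∀ p, f p ≤ 1 := one_sub_inv_le_one
  have h1 : rho (g * x) * rho (g * y) = rho (g * x * y) * rho g := by
    rw [rho_eq_prod (mul_ne_zero hg hx), rho_eq_prod (mul_ne_zero hg hy),
      rho_eq_prod (mul_ne_zero (mul_ne_zero hg hx) hy), rho_eq_prod hg, ← prod_union_inter]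
    congr 1
    · congr 1
      rw [Nat.primeFactors_mul hg hx, Nat.primeFactors_mul hg hy,
        Nat.primeFactors_mul (mul_ne_zero hg hx) hy, Nat.primeFactors_mul hg hx]
      ext p; simp only [mem_union]; tauto
    · congr 1
      rw [Nat.primeFactors_mul hg hx, Nat.primeFactors_mul hg hy, ← union_inter_distrib_left,
        disjoint_iff_inter_eq_empty.1 hxy.disjoint_primeFactors, union_empty]
  set R := g.primeFactors.filter fun p : ℕ => ¬ (p : ℤ) ∣ x * y * h with hR
  have h2 : ∏ p ∈ g.primeFactors, (f p * if (p : ℤ) ∣ x * y * h then 1 else f p) =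
      rho g * ∏ p ∈ R, f p := by
    rw [prod_mul_distrib, rho_eq_prod hg, hR, prod_filter]
    congr 1
    exact prod_congr rfl fun p _ => by split_ifs <;> rfl
  rw [h2]
  have hmem : ∀ p ∈ R ∪ (x * y).primeFactors ∪ h.natAbs.primeFactors, p.Prime := by
    intro p hp
    simp only [mem_union, hR, mem_filter, Nat.mem_primeFactors] at hp
    tauto
  have hf0 : ∀ p ∈ R ∪ (x * y).primeFactors ∪ h.natAbs.primeFactors, 0 ≤ f p :=
    fun p hp => one_sub_inv_nonneg (hmem p hp)
  have h3 : (∏ p ∈ R, f p) * rho (x * y) * rho h.natAbs ≤ rho (g * x * y) := by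
    rw [rho_eq_prod hxy0, rho_eq_prod hh0, rho_eq_prod (mul_ne_zero (mul_ne_zero hg hx) hy)]
    have h4 : 0 ≤ ∏ p ∈ h.natAbs.primeFactors, f p :=
      prod_nonneg fun p hp => hf0 p (mem_union_right _ hp)
    calc _ ≤ (∏ p ∈ R ∪ (x * y).primeFactors, f p) * ∏ p ∈ h.natAbs.primeFactors, f p := by
          refine mul_le_mul_of_nonneg_right (prod_mul_prod_le_prod_union (fun p hp => ?_)
            fun p _ => hf1 p) h4
          exact hf0 p (mem_union_left _ hp)
      _ ≤ ∏ p ∈ R ∪ (x * y).primeFactors ∪ h.natAbs.primeFactors, f p :=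
          prod_mul_prod_le_prod_union hf0 fun p _ => hf1 p
      _ ≤ _ := by
          refine prod_le_prod_of_subset_of_le_one ?_ hf0 (fun p _ _ => hf1 p)
          intro p hp
          rw [mul_assoc, Nat.primeFactors_mul hg hxy0, mem_union] at hp
          simp only [mem_union, hR, mem_filter]
          rcases hp with hp | hp
          · have hp' := Nat.prime_of_mem_primeFactors hp
            by_cases hd : (p : ℤ) ∣ x * y * h
            · have : p ∣ x * y * h.natAbs := by
                have := Int.natCast_dvd.1 hd
                rwa [Int.natAbs_mul, Int.natAbs_mul, Int.natAbs_natCast, Int.natAbs_natCast] at this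
              rcases hp'.dvd_mul.1 this with h5 | h5
              · exact Or.inl (Or.inr (Nat.mem_primeFactors.2 ⟨hp', h5, hxy0⟩))
              · exact Or.inr (Nat.mem_primeFactors.2 ⟨hp', h5, hh0⟩)
            · exact Or.inl (Or.inl ⟨hp, hd⟩)
          · exact Or.inl (Or.inr hp)
  have h5 : (∏ p ∈ R, f p) ≤ rho (g * x * y) * (rho (x * y))⁻¹ * (rho h.natAbs)⁻¹ := by
    rw [← div_eq_mul_inv, ← div_eq_mul_inv, le_div_iff₀ hρ2, le_div_iff₀ hρ1]
    linarith
  have h6 := rho_nonneg g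
  calc (g : ℝ) * (rho g * ∏ p ∈ R, f p) ≤
        g * (rho g * (rho (g * x * y) * (rho (x * y))⁻¹ * (rho h.natAbs)⁻¹)) := by gcongr
    _ = g * (rho (g * x * y) * rho g) * (rho (x * y))⁻¹ * (rho h.natAbs)⁻¹ := by ring
    _ = _ := by rw [← h1]; ring

/-- The part of `n / φ(n)` coming from the primes larger than `j`. -/
noncomputable def tailFactor (j n : ℕ) : ℝ :=
  ∏ p ∈ n.primeFactors with j < p, (1 - (p : ℝ)⁻¹)⁻¹

lemma tailFactor_nonneg (j n : ℕ) : 0 ≤ tailFactor j n :=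
  prod_nonneg fun _ hp => zero_le_one.trans
    (one_le_inv_one_sub_inv (Nat.prime_of_mem_primeFactors (mem_filter.1 hp).1))

lemma tailFactor_pow (j n : ℕ) : tailFactor j n ^ (j + 1) = wt (primeWeight j) n := by
  rw [tailFactor, ← prod_pow, wt, prod_filter]
  refine prod_congr rfl fun p hp => ?_
  simp [primeWeight, Nat.prime_of_mem_primeFactors hp]

/-- The product of the prime factors of `n` up to `j`. -/
def smoothPart (j n : ℕ) : ℕ := ∏ p ∈ n.primeFactors with ¬ j < p, p

lemma smoothPart_dvd (j n : ℕ) : smoothPart j n ∣ n :=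
  (prod_dvd_prod_of_subset _ _ _ (filter_subset _ _)).trans (Nat.prod_primeFactors_dvd n)

lemma smoothPart_pos (j n : ℕ) : 0 < smoothPart j n :=
  prod_pos fun _ hp => (Nat.prime_of_mem_primeFactors (mem_filter.1 hp).1).pos

lemma smoothPart_le (j n : ℕ) : smoothPart j n ≤ 4 ^ j := by
  refine le_trans (Nat.le_of_dvd ?_ (prod_dvd_prod_of_subset _ _ _ fun p hp => ?_))
    (primorial_le_four_pow j)
  · exact prod_pos fun p hp => (mem_filter.1 hp).2.pos
  · rw [mem_filter] at hp
    exact mem_filter.2 ⟨mem_range.2 (by omega), Nat.prime_of_mem_primeFactors hp.1⟩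

lemma rho_smoothPart {n : ℕ} (hn : n ≠ 0) (j : ℕ) :
    rho (smoothPart j n) * (rho n)⁻¹ = tailFactor j n := by
  have h1 : (smoothPart j n).primeFactors = n.primeFactors.filter (¬ j < ·) :=
    Nat.primeFactors_prod fun p hp => Nat.prime_of_mem_primeFactors (mem_filter.1 hp).1
  have h2 : ∀ p ∈ n.primeFactors.filter (¬ j < ·), (1 - (p : ℝ)⁻¹) ≠ 0 := fun p hp => by
    have := one_le_inv_one_sub_inv (Nat.prime_of_mem_primeFactors (mem_filter.1 hp).1)
    intro h; rw [h] at this; norm_num at this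
  rw [rho_eq_prod (smoothPart_pos j n).ne', h1, rho_eq_prod hn, tailFactor, ← prod_inv_distrib,
    ← prod_filter_mul_prod_filter_not n.primeFactors (j < ·), mul_left_comm, ← prod_mul_distrib,
    prod_eq_one fun p hp => mul_inv_cancel₀ (h2 p hp), mul_one]

/-- The reduced residues modulo `v`. -/
def reduced (v : ℕ) : Finset ℕ := (range v).filter (v.Coprime ·)

lemma card_reduced (v : ℕ) : #(reduced v) = v.totient := rfl

lemma mem_reduced {v a : ℕ} : a ∈ reduced v ↔ a < v ∧ v.Coprime a := by
  rw [reduced, mem_filter, mem_range]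

/-- The arc of radius `ψ v / v` about `a / v`. -/
def arc (ψ : ℕ → ℝ) (v a : ℕ) : Set UnitAddCircle :=
  Metric.ball ((((a : ℝ) / v : ℝ)) : UnitAddCircle) (ψ v / v)

lemma volume_real_ball (x : UnitAddCircle) {ε : ℝ} (hε : 0 ≤ ε) :
    volume.real (Metric.ball x ε) = min 1 (2 * ε) := by
  rw [Measure.real, ← measure_congr (AddCircle.closedBall_ae_eq_ball (x := x) (ε := ε)),
    AddCircle.volume_closedBall, ENNReal.toReal_ofReal (by positivity)]

lemma volume_real_arc_le {ψ : ℕ → ℝ} (hψ : ∀ n, 0 ≤ ψ n) (v a : ℕ) :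
    volume.real (arc ψ v a) ≤ 2 * (ψ v / v) := by
  rw [arc, volume_real_ball _ (by have := hψ v; positivity)]
  exact min_le_right _ _

lemma volume_real_arc_inter_le {ψ : ℕ → ℝ} (hψ : ∀ n, 0 ≤ ψ n) (v a w b : ℕ) :
    volume.real (arc ψ v a ∩ arc ψ w b) ≤ 2 * min (ψ v / v) (ψ w / w) := by
  rw [mul_min_of_nonneg _ _ zero_le_two]
  exact le_min ((measureReal_mono Set.inter_subset_left).trans (volume_real_arc_le hψ v a))
    ((measureReal_mono Set.inter_subset_right).trans (volume_real_arc_le hψ w b))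

lemma exists_mem_pairSet {ψ : ℕ → ℝ} {g x y a b : ℕ} (hg : g ≠ 0) (hx : x ≠ 0) (hy : y ≠ 0)
    (ha : a ∈ reduced (g * x)) (hb : b ∈ reduced (g * y))
    (hne : (arc ψ (g * x) a ∩ arc ψ (g * y) b).Nonempty) :
    ∃ h : ℤ, (a, b) ∈ pairSet g x y h ∧ |(h : ℝ)| ≤ ψ (g * x) * y + ψ (g * y) * x := by
  obtain ⟨z, hz1, hz2⟩ := hne
  rw [mem_reduced] at ha hb
  rw [arc, Metric.mem_ball, dist_comm] at hz1
  rw [arc, Metric.mem_ball] at hz2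
  have h1 := (dist_triangle _ z _).trans_lt (add_lt_add hz1 hz2)
  rw [dist_eq_norm, ← AddCircle.coe_sub, UnitAddCircle.norm_eq] at h1
  set t : ℝ := (a : ℝ) / (g * x : ℕ) - (b : ℝ) / (g * y : ℕ) with ht
  refine ⟨(a : ℤ) * y - (b + round t * (g * y)) * x, mem_pairSet.2
    ⟨⟨ha.1, hb.1⟩, ha.2.symm, hb.2.symm, round t, rfl⟩, ?_⟩
  have hg' : (0 : ℝ) < g := by exact_mod_cast Nat.pos_of_ne_zero hg
  have hx' : (0 : ℝ) < x := by exact_mod_cast Nat.pos_of_ne_zero hx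
  have hy' : (0 : ℝ) < y := by exact_mod_cast Nat.pos_of_ne_zero hy
  have h2 : (((a : ℤ) * y - (b + round t * (g * y)) * x : ℤ) : ℝ) =
      g * x * y * (t - round t) := by
    have h3 : t * (g * x * y) = a * y - b * x := by rw [ht]; push_cast; field_simp
    push_cast
    linear_combination -h3
  rw [h2, abs_mul, abs_of_pos (by positivity)]
  calc _ ≤ g * x * y * (ψ (g * x) / (g * x : ℕ) + ψ (g * y) / (g * y : ℕ)) := by gcongr
    _ = _ := by push_cast; field_simp

/-- The total overlap of the arcs with denominators `v` and `w`. -/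
noncomputable def overlap (ψ : ℕ → ℝ) (v w : ℕ) : ℝ :=
  ∑ a ∈ reduced v, ∑ b ∈ reduced w, volume.real (arc ψ v a ∩ arc ψ w b)

lemma overlap_le_sum_card {ψ : ℕ → ℝ} (hψ : ∀ n, 0 ≤ ψ n) {g x y : ℕ} (hg : g ≠ 0) (hx : x ≠ 0)
    (hy : y ≠ 0) (hxy : Nat.Coprime x y) (hne : x * y ≠ 1) :
    overlap ψ (g * x) (g * y) ≤
      2 * min (ψ (g * x) / (g * x : ℕ)) (ψ (g * y) / (g * y : ℕ)) *
        ∑ n ∈ Icc 1 ⌊ψ (g * x) * y + ψ (g * y) * x⌋₊, ∑ ε ∈ ({1, -1} : Finset ℤ),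
          (#(pairSet g x y (ε * n)) : ℝ) := by
  set X := ⌊ψ (g * x) * y + ψ (g * y) * x⌋₊ with hX
  set μ := 2 * min (ψ (g * x) / (g * x : ℕ)) (ψ (g * y) / (g * y : ℕ)) with hμ
  have h1 := hψ (g * x)
  have h2 := hψ (g * y)
  have hμ0 : 0 ≤ μ := by positivity
  have hterm : ∀ a ∈ reduced (g * x), ∀ b ∈ reduced (g * y),
      volume.real (arc ψ (g * x) a ∩ arc ψ (g * y) b) ≤
        ∑ n ∈ Icc 1 X, ∑ ε ∈ ({1, -1} : Finset ℤ),
          if (a, b) ∈ pairSet g x y (ε * n) then μ else 0 := by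
    intro a ha b hb
    have hnn : ∀ n ∈ Icc 1 X, 0 ≤ ∑ ε ∈ ({1, -1} : Finset ℤ),
        if (a, b) ∈ pairSet g x y (ε * n) then μ else 0 :=
      fun n _ => sum_nonneg fun ε _ => by split_ifs <;> simp [hμ0]
    by_cases hemp : (arc ψ (g * x) a ∩ arc ψ (g * y) b).Nonempty
    · obtain ⟨h, hmem, hle⟩ := exists_mem_pairSet hg hx hy ha hb hemp
      have hcop := coprime_of_mem_pairSet hxy hmem
      have h0 : h.natAbs ≠ 0 := fun h0 => hne (by rwa [h0, Nat.coprime_zero_left] at hcop)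
      have hX : h.natAbs ∈ Icc 1 X := by
        refine mem_Icc.2 ⟨Nat.pos_of_ne_zero h0, Nat.le_floor ?_⟩
        rwa [Nat.cast_natAbs, Int.cast_abs]
      refine (volume_real_arc_inter_le hψ _ a _ b).trans ?_
      refine le_trans ?_ (single_le_sum hnn hX)
      have hsign : h.sign ∈ ({1, -1} : Finset ℤ) := by
        rcases lt_trichotomy h 0 with h3 | h3 | h3
        · simp [Int.sign_eq_neg_one_of_neg h3]
        · simp [h3] at h0
        · simp [Int.sign_eq_one_of_pos h3]
      refine le_trans ?_ (single_le_sum (f := fun ε : ℤ =>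
        if (a, b) ∈ pairSet g x y (ε * h.natAbs) then μ else 0)
        (fun ε _ => by split_ifs <;> simp [hμ0]) hsign)
      simp only [Int.sign_mul_natAbs, if_pos hmem]
      exact le_rfl
    · rw [Set.not_nonempty_iff_eq_empty.1 hemp, measureReal_empty]
      exact sum_nonneg hnn
  have hcard : ∀ h : ℤ, ∑ a ∈ reduced (g * x), ∑ b ∈ reduced (g * y),
      (if (a, b) ∈ pairSet g x y h then μ else 0) ≤ μ * #(pairSet g x y h) := by
    intro h
    rw [← sum_product' (f := fun a b => if (a, b) ∈ pairSet g x y h then μ else 0), ← sum_filter,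
      sum_const, nsmul_eq_mul, mul_comm]
    gcongr
    exact fun e he => (mem_filter.1 he).2
  calc overlap ψ (g * x) (g * y) ≤ ∑ a ∈ reduced (g * x), ∑ b ∈ reduced (g * y),
        ∑ n ∈ Icc 1 X, ∑ ε ∈ ({1, -1} : Finset ℤ),
          if (a, b) ∈ pairSet g x y (ε * n) then μ else 0 :=
        sum_le_sum fun a ha => sum_le_sum fun b hb => hterm a ha b hb
    _ = ∑ n ∈ Icc 1 X, ∑ ε ∈ ({1, -1} : Finset ℤ), ∑ a ∈ reduced (g * x),
        ∑ b ∈ reduced (g * y), if (a, b) ∈ pairSet g x y (ε * n) then μ else 0 := by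
        rw [sum_congr rfl fun a _ => sum_comm, sum_comm]
        refine sum_congr rfl fun n _ => ?_
        rw [sum_congr rfl fun a _ => sum_comm, sum_comm]
    _ ≤ ∑ n ∈ Icc 1 X, ∑ ε ∈ ({1, -1} : Finset ℤ), μ * #(pairSet g x y (ε * n)) :=
        sum_le_sum fun n _ => sum_le_sum fun ε _ => hcard _
    _ = _ := by simp_rw [← mul_sum]

lemma sum_card_pairSet_le {g x y : ℕ} (hg : g ≠ 0) (hx : x ≠ 0)
    (hy : y ≠ 0) (hxy : Nat.Coprime x y) {m : ℕ} (hm : m ∣ x * y) (X : ℕ) :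
    ∑ n ∈ Icc 1 X, ∑ ε ∈ ({1, -1} : Finset ℤ), (#(pairSet g x y (ε * n)) : ℝ) ≤
      2 * (g * rho (g * x) * rho (g * y) * (rho (x * y))⁻¹) *
        ∑ n ∈ Icc 1 X with n.Coprime m, (rho n)⁻¹ := by
  rw [mul_sum, sum_filter]
  refine sum_le_sum fun n hn => ?_
  have hn0 : n ≠ 0 := by have := (mem_Icc.1 hn).1; omega
  have habs : ∀ ε ∈ ({1, -1} : Finset ℤ), (ε * (n : ℤ)).natAbs = n := by
    intro ε hε
    simp only [mem_insert, mem_singleton] at hε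
    rcases hε with rfl | rfl <;> simp
  split_ifs with hc
  · have : ∀ ε ∈ ({1, -1} : Finset ℤ), (#(pairSet g x y (ε * n)) : ℝ) ≤
        g * rho (g * x) * rho (g * y) * (rho (x * y))⁻¹ * (rho n)⁻¹ := by
      intro ε hε
      have h1 := card_pairSet_le hg hx hy hxy (h := ε * n)
        (fun h => hn0 (by have := habs ε hε; rw [h] at this; simpa using this.symm))
      rwa [habs ε hε] at h1
    refine (sum_le_card_nsmul _ _ _ this).trans_eq ?_
    rw [card_pair (by norm_num), nsmul_eq_mul]
    push_cast
    ring
  · refine (sum_eq_zero fun ε hε => ?_).le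
    rw [Nat.cast_eq_zero, card_eq_zero, eq_empty_iff_forall_notMem]
    intro e he
    have := coprime_of_mem_pairSet hxy he
    rw [habs ε hε] at this
    exact hc (this.coprime_dvd_right hm)

/-- Overlap estimate for two different denominators. -/
lemma exists_overlap_le : ∃ C : ℝ, 0 ≤ C ∧ ∀ (ψ : ℕ → ℝ) (v w : ℕ), (∀ n, 0 ≤ ψ n) → v ≠ 0 →
    w ≠ 0 → v ≠ w → ∀ X : ℕ, X = ⌊(ψ v * w + ψ w * v) / Nat.gcd v w⌋₊ →
    overlap ψ v w ≤ C * if X = 0 then 0 else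
      mass ψ v * mass ψ w * tailFactor (Nat.log 16 X) (v * w / Nat.gcd v w ^ 2) := by
  obtain ⟨C, hC, hsum⟩ := exists_sum_inv_rho_le
  refine ⟨8 * C, by positivity, fun ψ v w hψ hv hw hvw X hX => ?_⟩
  obtain ⟨x, y, hxy, hvx, hwy⟩ := Nat.exists_coprime v w
  have hg : Nat.gcd v w ≠ 0 := Nat.gcd_ne_zero_left hv
  set g := Nat.gcd v w with hgdef
  clear_value g
  rw [mul_comm] at hvx hwy
  subst hvx hwy
  have hx : x ≠ 0 := right_ne_zero_of_mul hv
  have hy : y ≠ 0 := right_ne_zero_of_mul hw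
  have hxy1 : x * y ≠ 1 := fun h => hvw (by
    rw [Nat.eq_one_of_mul_eq_one_right h, Nat.eq_one_of_mul_eq_one_left h])
  have hg' : (0 : ℝ) < g := by exact_mod_cast Nat.pos_of_ne_zero hg
  have hx' : (0 : ℝ) < x := by exact_mod_cast Nat.pos_of_ne_zero hx
  have hy' : (0 : ℝ) < y := by exact_mod_cast Nat.pos_of_ne_zero hy
  have hdiv : g * x * (g * y) / g ^ 2 = x * y := by
    rw [show g * x * (g * y) = x * y * g ^ 2 by ring]
    exact Nat.mul_div_cancel _ (by positivity)
  have hX' : X = ⌊ψ (g * x) * y + ψ (g * y) * x⌋₊ := by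
    rw [hX]; congr 1; push_cast; field_simp
  have h1 := hψ (g * x)
  have h2 := hψ (g * y)
  have hover := overlap_le_sum_card hψ hg hx hy hxy hxy1
  rw [← hX'] at hover
  rw [hdiv]
  split_ifs with hX0
  · rw [hX0] at hover
    simpa using hover
  set j := Nat.log 16 X with hj
  have hm : smoothPart j (x * y) ^ 2 ≤ X := by
    calc smoothPart j (x * y) ^ 2 ≤ (4 ^ j) ^ 2 := Nat.pow_le_pow_left (smoothPart_le _ _) 2
      _ = 16 ^ j := by rw [← pow_mul, mul_comm, pow_mul]; norm_num
      _ ≤ X := Nat.pow_log_le_self 16 hX0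
  have h3 := hsum _ X (smoothPart_pos j (x * y)) hm
  have h4 := sum_card_pairSet_le hg hx hy hxy (smoothPart_dvd j (x * y)) X
  have h5 : (X : ℝ) ≤ ψ (g * x) * y + ψ (g * y) * x := by
    rw [hX']; exact Nat.floor_le (by positivity)
  have hρ1 := rho_nonneg (g * x)
  have hρ2 := rho_nonneg (g * y)
  have hρ3 := rho_nonneg (x * y)
  have hρ4 := rho_nonneg (smoothPart j (x * y))
  set r := ψ (g * x) / (g * x : ℕ) with hr
  set s := ψ (g * y) / (g * y : ℕ) with hs
  have hr0 : 0 ≤ r := by positivity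
  have hs0 : 0 ≤ s := by positivity
  have hψr : ψ (g * x) = g * x * r := by rw [hr]; push_cast; field_simp
  have hψs : ψ (g * y) = g * y * s := by rw [hs]; push_cast; field_simp
  have hmin : min r s * (r + s) ≤ 2 * (r * s) := by
    rcases le_total r s with h | h
    · rw [min_eq_left h]; nlinarith
    · rw [min_eq_right h]; nlinarith
  have hmin0 : 0 ≤ min r s := le_min hr0 hs0
  calc overlap ψ (g * x) (g * y) ≤ 2 * min r s *
        (2 * (g * rho (g * x) * rho (g * y) * (rho (x * y))⁻¹) *
          (C * (ψ (g * x) * y + ψ (g * y) * x) * rho (smoothPart j (x * y)))) := by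
        refine hover.trans (mul_le_mul_of_nonneg_left (h4.trans ?_) (by positivity))
        refine mul_le_mul_of_nonneg_left (h3.trans ?_) (by positivity)
        gcongr
    _ = 4 * C * (rho (g * x) * rho (g * y)) * (g ^ 2 * x * y * (min r s * (r + s))) *
        (rho (smoothPart j (x * y)) * (rho (x * y))⁻¹) := by
        rw [hψr, hψs]; ring
    _ ≤ 4 * C * (rho (g * x) * rho (g * y)) * (g ^ 2 * x * y * (2 * (r * s))) *
        (rho (smoothPart j (x * y)) * (rho (x * y))⁻¹) := by gcongr
    _ = _ := by
        rw [rho_smoothPart (mul_ne_zero hx hy), mass, mass, hψr, hψs]; ring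

lemma le_eight_add_pow_div {u : ℝ} (hu : 0 ≤ u) (j : ℕ) : u ≤ 8 + u ^ (j + 1) / 8 ^ j := by
  rcases le_total u 8 with h | h
  · have : 0 ≤ u ^ (j + 1) / 8 ^ j := by positivity
    linarith
  · have h1 : u ≤ u ^ (j + 1) / 8 ^ j := by
      rw [le_div_iff₀ (by positivity), pow_succ, mul_comm]
      gcongr
    linarith

/-- Total overlap of distinct denominators in a window of bounded mass. -/
lemma exists_sum_overlap_le : ∃ C : ℝ, 0 ≤ C ∧ ∀ (ψ : ℕ → ℝ) (V : Finset ℕ), (∀ n, 0 ≤ ψ n) →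
    (∀ v ∈ V, v ≠ 0) → ∑ v ∈ V, mass ψ v ≤ 2 →
    ∑ e ∈ V ×ˢ V with e.1 ≠ e.2, overlap ψ e.1 e.2 ≤ C := by
  obtain ⟨C₀, hC₀, hover⟩ := exists_overlap_le
  obtain ⟨C₁, hC₁, hbil⟩ := exists_bilinear_bound
  set K := root4 2 ^ 3 * root4 2 ^ 3 with hK
  have hr := root4_nonneg 2
  have hK0 : 0 ≤ K := by positivity
  refine ⟨C₀ * (32 + 8 * (C₁ * K)), by positivity, fun ψ V hψ hV hS => ?_⟩
  have hm := mass_nonneg hψ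
  have hS0 : 0 ≤ ∑ v ∈ V, mass ψ v := sum_nonneg fun v _ => hm v
  set X : ℕ × ℕ → ℕ := fun e => ⌊(ψ e.1 * e.2 + ψ e.2 * e.1) / Nat.gcd e.1 e.2⌋₊ with hX
  set E := (V ×ˢ V).filter fun e => X e ≠ 0 with hE
  set J : ℕ × ℕ → ℕ := fun e => Nat.log 16 (X e) with hJ
  set F : ℕ × ℕ → ℝ := fun e =>
    mass ψ e.1 * mass ψ e.2 * tailFactor (J e) (e.1 * e.2 / Nat.gcd e.1 e.2 ^ 2) with hF
  have hF0 : ∀ e, 0 ≤ F e := fun e =>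
    mul_nonneg (mul_nonneg (hm _) (hm _)) (tailFactor_nonneg _ _)
  have h1 : ∑ e ∈ V ×ˢ V with e.1 ≠ e.2, overlap ψ e.1 e.2 ≤ C₀ * ∑ e ∈ E, F e := by
    calc _ ≤ ∑ e ∈ V ×ˢ V with e.1 ≠ e.2, C₀ * (if X e = 0 then 0 else F e) := by
          refine sum_le_sum fun e he => ?_
          obtain ⟨he, hne⟩ := mem_filter.1 he
          obtain ⟨hv, hw⟩ := mem_product.1 he
          exact hover ψ e.1 e.2 hψ (hV _ hv) (hV _ hw) hne _ rfl
      _ ≤ ∑ e ∈ V ×ˢ V, C₀ * (if X e = 0 then 0 else F e) :=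
          sum_le_sum_of_subset_of_nonneg (filter_subset _ _) fun e _ _ => by
            have := hF0 e
            split_ifs <;> positivity
      _ = _ := by
          rw [← mul_sum, hE, sum_filter]
          congr 1
          exact sum_congr rfl fun e _ => by by_cases h : X e = 0 <;> simp only [h, ne_eq, not_true_eq_false, not_false_eq_true, if_true, if_false]
  refine h1.trans (mul_le_mul_of_nonneg_left ?_ hC₀)
  set Jmax := E.sup J + 1 with hJmax
  have hmaps : ∀ e ∈ E, J e ∈ range Jmax := fun e he =>
    mem_range.2 (Nat.lt_succ_of_le (le_sup (f := J) he))
  have hj : ∀ j, ∑ e ∈ E with J e = j, F e ≤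
      8 * ∑ e ∈ E with J e = j, mass ψ e.1 * mass ψ e.2 + 4 * (C₁ * K) * (1 / 2) ^ j := by
    intro j
    set Ej := E.filter (J · = j) with hEj
    have h2 : ∑ e ∈ Ej, F e ≤ 8 * ∑ e ∈ Ej, mass ψ e.1 * mass ψ e.2 +
        edgeSum ψ (primeWeight j) Ej / 8 ^ j := by
      rw [edgeSum, mul_sum, sum_div, ← sum_add_distrib]
      refine sum_le_sum fun e he => ?_
      have hJe : J e = j := (mem_filter.1 he).2
      rw [hF]
      simp only [hJe]
      have h3 := le_eight_add_pow_div (tailFactor_nonneg j (e.1 * e.2 / Nat.gcd e.1 e.2 ^ 2)) j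
      rw [tailFactor_pow] at h3
      calc _ ≤ mass ψ e.1 * mass ψ e.2 * (8 + wt (primeWeight j)
            (e.1 * e.2 / Nat.gcd e.1 e.2 ^ 2) / 8 ^ j) :=
            mul_le_mul_of_nonneg_left h3 (mul_nonneg (hm _) (hm _))
        _ = _ := by ring
    have hbd : ∀ e ∈ Ej, (ψ e.1 * e.2 + ψ e.2 * e.1) ≤ 16 ^ (j + 1) * Nat.gcd e.1 e.2 := by
      intro e he
      obtain ⟨he, hJe⟩ := mem_filter.1 he
      obtain ⟨he, hX0⟩ := mem_filter.1 he
      obtain ⟨hv, hw⟩ := mem_product.1 he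
      have hg : (0 : ℝ) < Nat.gcd e.1 e.2 := by
        exact_mod_cast Nat.gcd_pos_of_pos_left _ (Nat.pos_of_ne_zero (hV _ hv))
      rw [← div_le_iff₀ hg]
      have h3 : X e + 1 ≤ 16 ^ (j + 1) := by
        rw [← hJe]; exact Nat.lt_pow_succ_log_self (by norm_num) _
      refine (Nat.lt_floor_add_one _).le.trans ?_
      exact_mod_cast h3
    have h4 := hbil ψ j (16 ^ (j + 1)) V V Ej hψ (by positivity) hV hV
      ((filter_subset _ _).trans (filter_subset _ _))
      (fun e he => by
        have := hbd e he
        have h5 := hψ e.2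
        have : 0 ≤ ψ e.2 * e.1 := by positivity
        linarith)
      (fun e he => by
        have := hbd e he
        have h5 := hψ e.1
        have : 0 ≤ ψ e.1 * e.2 := by positivity
        linarith)
    have h5 : root4 (∑ v ∈ V, mass ψ v) ≤ root4 2 := root4_le_root4 hS
    have h6 := root4_nonneg (∑ v ∈ V, mass ψ v)
    have h7 : √((16 : ℝ) ^ (j + 1)) = 4 ^ (j + 1) := by
      rw [show (16 : ℝ) ^ (j + 1) = (4 ^ (j + 1)) ^ 2 by
        rw [← pow_mul, mul_comm, pow_mul]; norm_num]
      exact Real.sqrt_sq (by positivity)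
    have h8 : edgeSum ψ (primeWeight j) Ej / 8 ^ j ≤ 4 * (C₁ * K) * (1 / 2) ^ j := by
      rw [div_le_iff₀ (by positivity)]
      calc _ ≤ C₁ * 4 ^ (j + 1) * K := by
            rw [h7] at h4
            refine h4.trans ?_
            rw [hK]
            gcongr
        _ = 4 * (C₁ * K) * 4 ^ j := by ring
        _ = _ := by
            rw [mul_assoc _ ((1 / 2 : ℝ) ^ j), ← mul_pow]; norm_num
    linarith
  calc ∑ e ∈ E, F e = ∑ j ∈ range Jmax, ∑ e ∈ E with J e = j, F e :=
        (sum_fiberwise_of_maps_to hmaps F).symm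
    _ ≤ ∑ j ∈ range Jmax, (8 * ∑ e ∈ E with J e = j, mass ψ e.1 * mass ψ e.2 +
          4 * (C₁ * K) * (1 / 2) ^ j) := sum_le_sum fun j _ => hj j
    _ = 8 * ∑ e ∈ E, mass ψ e.1 * mass ψ e.2 + 4 * (C₁ * K) * ∑ j ∈ range Jmax, (1 / 2) ^ j := by
        rw [sum_add_distrib, ← mul_sum, ← mul_sum,
          sum_fiberwise_of_maps_to hmaps fun e => mass ψ e.1 * mass ψ e.2]
    _ ≤ 8 * 4 + 4 * (C₁ * K) * 2 := by
        have h2 : ∑ e ∈ E, mass ψ e.1 * mass ψ e.2 ≤ 4 := by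
          calc _ ≤ ∑ e ∈ V ×ˢ V, mass ψ e.1 * mass ψ e.2 :=
                sum_le_sum_of_subset_of_nonneg (filter_subset _ _)
                  fun e _ _ => mul_nonneg (hm _) (hm _)
            _ = (∑ v ∈ V, mass ψ v) * ∑ v ∈ V, mass ψ v := by rw [sum_mul_sum, sum_product]
            _ ≤ 2 * 2 := by gcongr
            _ = 4 := by norm_num
        have h3 := sum_geometric_two_le Jmax
        gcongr
    _ = _ := by ring

/-- The second moment method for a finite family of events. -/
lemma two_mul_sub_le_measureReal_biUnion {α ι : Type*} [MeasurableSpace α] {μ : Measure α}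
    [IsFiniteMeasure μ] (I : Finset ι) (B : ι → Set α) (hB : ∀ i ∈ I, MeasurableSet (B i))
    (c : ℝ) : 2 * c * ∑ i ∈ I, μ.real (B i) - c ^ 2 * ∑ i ∈ I, ∑ j ∈ I, μ.real (B i ∩ B j) ≤
      μ.real (⋃ i ∈ I, B i) := by
  set f : α → ℝ := fun x => ∑ i ∈ I, (B i).indicator 1 x with hf
  have hU : MeasurableSet (⋃ i ∈ I, B i) := I.measurableSet_biUnion hB
  have hint : ∀ s : Set α, MeasurableSet s → Integrable (s.indicator (1 : α → ℝ)) μ :=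
    fun s hs => (integrable_const (1 : ℝ)).indicator hs
  have h1 : ∀ i ∈ I, Integrable ((B i).indicator (1 : α → ℝ)) μ := fun i hi => hint _ (hB i hi)
  have h2 : ∀ i ∈ I, ∀ j ∈ I, Integrable ((B i ∩ B j).indicator (1 : α → ℝ)) μ :=
    fun i hi j hj => hint _ ((hB i hi).inter (hB j hj))
  have hfsq : ∀ x, f x ^ 2 = ∑ i ∈ I, ∑ j ∈ I, (B i ∩ B j).indicator (1 : α → ℝ) x := by
    intro x
    rw [hf, sq, sum_mul_sum]
    refine sum_congr rfl fun i _ => sum_congr rfl fun j _ => ?_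
    rw [Set.inter_indicator_one]; rfl
  have hf1 : Integrable f μ := integrable_finsetSum _ h1
  have hf2 : Integrable (fun x => f x ^ 2) μ := by
    simp_rw [hfsq]
    exact integrable_finsetSum _ fun i hi => integrable_finsetSum _ fun j hj => h2 i hi j hj
  have e1 : ∫ x, f x ∂μ = ∑ i ∈ I, μ.real (B i) := by
    rw [integral_finsetSum _ h1]
    exact sum_congr rfl fun i hi => integral_indicator_one (hB i hi)
  have e2 : ∫ x, f x ^ 2 ∂μ = ∑ i ∈ I, ∑ j ∈ I, μ.real (B i ∩ B j) := by
    simp_rw [hfsq]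
    rw [integral_finsetSum _ fun i hi => integrable_finsetSum _ fun j hj => h2 i hi j hj]
    refine sum_congr rfl fun i hi => ?_
    rw [integral_finsetSum _ fun j hj => h2 i hi j hj]
    exact sum_congr rfl fun j hj => integral_indicator_one ((hB i hi).inter (hB j hj))
  rw [← e1, ← e2, ← integral_indicator_one hU, ← integral_const_mul, ← integral_const_mul,
    ← integral_sub (hf1.const_mul _) (hf2.const_mul _)]
  refine integral_mono ((hf1.const_mul _).sub (hf2.const_mul _)) (hint _ hU) fun x => ?_
  simp only
  by_cases hx : x ∈ ⋃ i ∈ I, B i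
  · rw [Set.indicator_of_mem hx, Pi.one_apply]
    nlinarith [sq_nonneg (c * f x - 1)]
  · have : f x = 0 := sum_eq_zero fun i hi =>
      Set.indicator_of_notMem (fun h => hx (Set.mem_biUnion hi h)) _
    rw [this, Set.indicator_of_notMem hx]
    simp

lemma arc_disjoint {ψ : ℕ → ℝ} {v a b : ℕ} (hψ : ψ v ≤ 1 / 2) (ha : a ∈ reduced v)
    (hb : b ∈ reduced v) (hab : a ≠ b) : Disjoint (arc ψ v a) (arc ψ v b) := by
  rw [mem_reduced] at ha hb
  have hv : (0 : ℝ) < v := by exact_mod_cast (by omega : 0 < v)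
  apply Metric.ball_disjoint_ball
  have h1 : ψ v / v + ψ v / v ≤ 1 / v := by
    rw [← add_div]; gcongr; linarith
  refine h1.trans (le_of_not_gt fun h => hab ?_)
  rw [dist_eq_norm, ← AddCircle.coe_sub, UnitAddCircle.norm_eq] at h
  set n := round ((a : ℝ) / v - (b : ℝ) / v)
  have h2 : |((a : ℤ) - b - v * n : ℤ)| < 1 := by
    have h3 : (((a : ℤ) - b - v * n : ℤ) : ℝ) = v * ((a : ℝ) / v - (b : ℝ) / v - n) := by
      push_cast; field_simp
    have h4 : (|((a : ℤ) - b - v * n : ℤ)| : ℝ) < 1 := by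
      rw [h3, abs_mul, abs_of_pos hv, mul_comm]
      rwa [lt_div_iff₀ hv] at h
    exact_mod_cast h4
  rw [Int.abs_lt_one_iff] at h2
  have h3 : b ≡ a [MOD v] := by
    rw [Nat.modEq_iff_dvd]; exact ⟨n, by linarith⟩
  exact (h3.eq_of_lt_of_lt hb.1 ha.1).symm

lemma sum_volume_real_arc {ψ : ℕ → ℝ} (hψ0 : ∀ n, 0 ≤ ψ n) {v : ℕ} (hv : v ≠ 0)
    (hψ : ψ v ≤ 1 / 2) : ∑ a ∈ reduced v, volume.real (arc ψ v a) = 2 * mass ψ v := by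
  have h0 := hψ0 v
  have hv' : (1 : ℝ) ≤ v := by exact_mod_cast Nat.pos_of_ne_zero hv
  have h1 : ψ v / v ≤ 1 / 2 := (div_le_self h0 hv').trans hψ
  have h2 : ∀ a ∈ reduced v, volume.real (arc ψ v a) = 2 * (ψ v / v) := fun a _ => by
    rw [arc, volume_real_ball _ (by positivity), min_eq_right (by linarith)]
  rw [sum_congr rfl h2, sum_const, card_reduced, nsmul_eq_mul, mass, rho]
  ring

lemma overlap_self_le {ψ : ℕ → ℝ} (hψ0 : ∀ n, 0 ≤ ψ n) {v : ℕ} (hv : v ≠ 0)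
    (hψ : ψ v ≤ 1 / 2) : overlap ψ v v ≤ 2 * mass ψ v := by
  rw [← sum_volume_real_arc hψ0 hv hψ]
  refine sum_le_sum fun a ha => ?_
  rw [sum_eq_single_of_mem a ha fun b hb hba => ?_, Set.inter_self]
  rw [(arc_disjoint hψ ha hb hba.symm).inter_eq, measureReal_empty]

lemma arc_subset_approxAddOrderOf {ψ : ℕ → ℝ} {v a : ℕ} (ha : a ∈ reduced v) :
    arc ψ v a ⊆ approxAddOrderOf UnitAddCircle v (ψ v / v) := by
  rw [mem_reduced] at ha
  intro x hx
  rw [arc, Metric.mem_ball, dist_eq_norm] at hx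
  exact (UnitAddCircle.mem_approxAddOrderOf_iff (by omega)).2 ⟨a, ha.1, ha.2.symm, hx⟩

/-- The approximable points for a window of bounded mass have measure bounded below. -/
lemma exists_le_volume_biUnion : ∃ c : ℝ, 0 < c ∧ ∀ (ψ : ℕ → ℝ) (V : Finset ℕ),
    (∀ n, 0 ≤ ψ n) → (∀ n, ψ n ≤ 1 / 2) → (∀ v ∈ V, v ≠ 0) → 1 ≤ ∑ v ∈ V, mass ψ v →
    ∑ v ∈ V, mass ψ v ≤ 2 →
    c ≤ volume.real (⋃ v ∈ V, approxAddOrderOf UnitAddCircle v (ψ v / v)) := by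
  obtain ⟨C, hC, hover⟩ := exists_sum_overlap_le
  refine ⟨3 / (4 + C), by positivity, fun ψ V hψ hψ' hV hS1 hS2 => ?_⟩
  set I := V.sigma reduced with hI
  set B : (_ : ℕ) × ℕ → Set UnitAddCircle := fun i => arc ψ i.1 i.2 with hB
  have h1 : ∑ i ∈ I, volume.real (B i) = 2 * ∑ v ∈ V, mass ψ v := by
    rw [hI, sum_sigma, mul_sum]
    exact sum_congr rfl fun v hv => sum_volume_real_arc hψ (hV v hv) (hψ' v)
  have h2 : ∑ i ∈ I, ∑ j ∈ I, volume.real (B i ∩ B j) ≤ 4 + C := by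
    have h3 : ∑ i ∈ I, ∑ j ∈ I, volume.real (B i ∩ B j) =
        ∑ e ∈ V ×ˢ V, overlap ψ e.1 e.2 := by
      rw [hI, sum_sigma, sum_product]
      refine sum_congr rfl fun v _ => ?_
      simp_rw [sum_sigma]
      exact sum_comm
    have h4 : ∑ e ∈ V ×ˢ V with ¬ e.1 ≠ e.2, overlap ψ e.1 e.2 ≤ 4 := by
      have h5 : (V ×ˢ V).filter (fun e => ¬ e.1 ≠ e.2) = V.image fun v => (v, v) := by
        ext ⟨v, w⟩
        simp only [mem_filter, mem_product, mem_image, Prod.mk.injEq, not_not]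
        constructor
        · rintro ⟨⟨h, -⟩, rfl⟩; exact ⟨v, h, rfl, rfl⟩
        · rintro ⟨u, h, rfl, rfl⟩; exact ⟨⟨h, h⟩, rfl⟩
      rw [h5, sum_image fun x _ y _ h => (Prod.mk.inj h).1]
      calc _ ≤ ∑ v ∈ V, 2 * mass ψ v :=
            sum_le_sum fun v hv => overlap_self_le hψ (hV v hv) (hψ' v)
        _ ≤ 4 := by rw [← mul_sum]; linarith
    rw [h3, ← sum_filter_add_sum_filter_not _ fun e => e.1 ≠ e.2]
    linarith [hover ψ V hψ hV hS2]
  have h3 := two_mul_sub_le_measureReal_biUnion (μ := volume) I B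
    (fun i _ => Metric.isOpen_ball.measurableSet) (1 / (4 + C))
  have h4 : volume.real (⋃ i ∈ I, B i) ≤
      volume.real (⋃ v ∈ V, approxAddOrderOf UnitAddCircle v (ψ v / v)) := by
    have hsub : ∀ i ∈ I, B i ⊆ ⋃ v ∈ V, approxAddOrderOf UnitAddCircle v (ψ v / v) := fun i hi => by
      rw [hI, mem_sigma] at hi
      exact (arc_subset_approxAddOrderOf hi.2).trans (Set.subset_biUnion_of_mem
        (u := fun v => approxAddOrderOf UnitAddCircle v (ψ v / v)) hi.1)
    exact measureReal_mono (Set.iUnion₂_subset hsub) (measure_ne_top _ _)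
  refine le_trans ?_ (h3.trans h4)
  rw [h1]
  have h5 : (0 : ℝ) < 4 + C := by positivity
  calc 3 / (4 + C) = 2 * (1 / (4 + C)) * 2 - (1 / (4 + C)) ^ 2 * (4 + C) := by field_simp; norm_num
    _ ≤ _ := by gcongr; linarith

lemma rho_le_one (n : ℕ) : rho n ≤ 1 :=
  div_le_one_of_le₀ (by exact_mod_cast n.totient_le) n.cast_nonneg

/-- A divergent series of non-negative terms at most `1 / 2` has windows with sum in `[1, 2]`. -/
lemma exists_window {f : ℕ → ℝ} (hf0 : ∀ n, 0 ≤ f n) (hf1 : ∀ n, f n ≤ 1 / 2)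
    (hf : ¬ Summable f) (M : ℕ) :
    ∃ N, 1 ≤ ∑ n ∈ Ico M N, f n ∧ ∑ n ∈ Ico M N, f n ≤ 2 := by
  have hT : Tendsto (fun N => ∑ n ∈ range N, f n) atTop atTop :=
    (not_summable_iff_tendsto_nat_atTop_of_nonneg hf0).1 hf
  have hex : ∃ N, 1 ≤ ∑ n ∈ Ico M N, f n := by
    obtain ⟨N, hN, hMN⟩ := ((hT.eventually_ge_atTop (1 + ∑ n ∈ range M, f n)).and
      (eventually_ge_atTop M)).exists
    exact ⟨N, by rw [sum_Ico_eq_sub _ hMN]; linarith⟩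
  classical
  refine ⟨Nat.find hex, Nat.find_spec hex, ?_⟩
  rcases h : Nat.find hex with _ | N
  · simp
  · have h1 : ∑ n ∈ Ico M N, f n < 1 := not_le.1 (Nat.find_min hex (h ▸ N.lt_succ_self))
    by_cases hMN : M ≤ N
    · rw [sum_Ico_succ_top hMN]
      linarith [hf1 N]
    · rw [Ico_eq_empty (by omega)]; simp

/-- The **Duffin–Schaeffer theorem** for approximation functions bounded by `1 / 2`. -/
theorem ae_mem_addWellApproximable {ψ : ℕ → ℝ} (hψ : ∀ n, 0 ≤ ψ n) (hψ' : ∀ n, ψ n ≤ 1 / 2)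
    (hdiv : ¬ Summable (mass ψ)) :
    ∀ᵐ x, x ∈ addWellApproximable UnitAddCircle fun n => ψ n / n := by
  obtain ⟨c, hc, hlow⟩ := exists_le_volume_biUnion
  have hδ : Tendsto (fun n : ℕ => ψ n / n) atTop (𝓝 0) :=
    squeeze_zero (fun n => div_nonneg (hψ n) n.cast_nonneg)
      (fun n => div_le_div_of_nonneg_right (hψ' n) n.cast_nonneg)
      (tendsto_const_div_atTop_nhds_zero_nat _)
  refine (AddCircle.addWellApproximable_ae_empty_or_univ _ hδ).resolve_left fun h => ?_
  set A : ℕ → Set UnitAddCircle := fun n => approxAddOrderOf UnitAddCircle n (ψ n / n) with hA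
  have hAm : ∀ n, MeasurableSet (A n) := fun n => Metric.isOpen_thickening.measurableSet
  set U : ℕ → Set UnitAddCircle := fun M => ⋃ n, ⋃ _ : 0 < n ∧ M ≤ n, A n with hU
  have hanti : Antitone U := fun M N hMN =>
    Set.biUnion_mono (fun n (hn : 0 < n ∧ N ≤ n) => ⟨hn.1, hMN.trans hn.2⟩) fun _ _ => subset_rfl
  have hUc : ∀ M, ENNReal.ofReal c ≤ volume (U M) := fun M => by
    have hm := mass_nonneg hψ
    have hm1 : ∀ n, mass ψ n ≤ 1 / 2 := fun n =>
      (mul_le_of_le_one_right (hψ n) (rho_le_one n)).trans (hψ' n)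
    obtain ⟨N, h1, h2⟩ := exists_window hm hm1 hdiv (M + 1)
    have h3 := hlow ψ (Ico (M + 1) N) hψ hψ'
      (fun v hv => by have := (mem_Ico.1 hv).1; omega) h1 h2
    rw [measureReal_def, ← ENNReal.ofReal_le_iff_le_toReal (measure_ne_top _ _)] at h3
    refine h3.trans (measure_mono (Set.iUnion₂_subset fun n hn => ?_))
    have := (mem_Ico.1 hn).1
    exact Set.subset_iUnion₂_of_subset n ⟨by omega, by omega⟩ subset_rfl
  have hlim := tendsto_measure_iInter_atTop (μ := volume)
    (fun M => (MeasurableSet.iUnion fun n => MeasurableSet.iUnion fun _ =>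
      hAm n : MeasurableSet (U M)).nullMeasurableSet) hanti ⟨0, measure_ne_top _ _⟩
  have h0 : volume (⋂ M, U M) = 0 := by
    rw [← measure_eq_zero_iff_ae_notMem] at h
    rw [← h, addWellApproximable, blimsup_eq_iInf_biSup_of_nat]
    congr 1
  rw [h0] at hlim
  have := ge_of_tendsto' hlim hUc
  exact absurd (ENNReal.ofReal_pos.2 hc) (not_lt.2 this)

lemma nint_eq_norm (x : ℝ) : nint x = ‖(x : UnitAddCircle)‖ := UnitAddCircle.norm_eq.symm

lemma nint_nonneg (x : ℝ) : 0 ≤ nint x := abs_nonneg _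

lemma nint_natCast_mul_le (b : ℕ) (x : ℝ) : nint (b * x) ≤ b * nint x := by
  rw [nint_eq_norm, nint_eq_norm, ← nsmul_eq_mul, AddCircle.coe_nsmul]
  exact norm_nsmul_le

lemma nint_mul_le {k : ℕ} (hk : k ≠ 0) (m : ℕ) (x : ℝ) :
    nint (k * x) ≤ k * ‖(x : UnitAddCircle) - ↑((m : ℝ) / k)‖ := by
  have hk' : (k : ℝ) ≠ 0 := by exact_mod_cast hk
  have h1 : ((k * x : ℝ) : UnitAddCircle) = k • ((x : UnitAddCircle) - ↑((m : ℝ) / k)) := by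
    have h0 : ((m : ℝ) : UnitAddCircle) = 0 := by
      rw [AddCircle.coe_eq_zero_iff]
      exact ⟨m, by simp⟩
    rw [← AddCircle.coe_sub, ← AddCircle.coe_nsmul, nsmul_eq_mul, mul_sub, mul_div_cancel₀ _ hk',
      AddCircle.coe_sub, h0, sub_zero]
  rw [nint_eq_norm, h1]
  exact norm_nsmul_le

lemma deltaMin_le (a : ℕ → ℕ) (α : ℝ) {m n N : ℕ} (hm : 1 ≤ m) (hmN : m ≤ N) (hn : 1 ≤ n)
    (hnN : n ≤ N) (hmn : m ≠ n) : deltaMin a α N ≤ nint (((a m : ℝ) - a n) * α) := by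
  refine csInf_le ⟨0, ?_⟩ ⟨m, n, hm, hmN, hn, hnN, hmn, rfl⟩
  rintro _ ⟨m, n, -, -, -, -, -, rfl⟩
  exact nint_nonneg _

lemma tsum_succ_ne_top {f : ℕ → ℝ≥0∞} {g : ℕ → ℝ} {K : ℕ} (hf : ∀ k, k ≠ 0 → f k ≠ ⊤)
    (hg : Summable g) (hfg : ∀ k, K < k → f k = ENNReal.ofReal (g k)) :
    ∑' k, f (k + 1) ≠ ⊤ := by
  have h : ∑ k ∈ range K, f (k + 1) + ∑' k, f (k + K + 1) = ∑' k, f (k + 1) :=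
    ENNReal.summable.sum_add_tsum_nat_add' (f := fun k => f (k + 1))
  rw [← h, tsum_congr fun k => hfg (k + K + 1) (by omega)]
  exact ENNReal.add_ne_top.2 ⟨ENNReal.sum_ne_top.2 fun k _ => hf _ k.succ_ne_zero,
    ((summable_nat_add_iff (K + 1)).2 hg).tsum_ofReal_lt_top.ne⟩

/-- The approximation function `k * sup_b (sup_{ℓ ≥ 𝒩(bk)} η ℓ) / (bk)`. -/
noncomputable def diffRadius (a : ℕ → ℕ) (η : ℕ → ℝ) (k : ℕ) : ℝ≥0∞ :=
  k * ⨆ (b : ℕ) (_ : 1 ≤ b),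
      (⨆ (ℓ : ℕ) (_ : calN a (b * k) ≤ (ℓ : ℕ∞)), ENNReal.ofReal (η ℓ)) /
        ((b * k : ℕ) : ℝ≥0∞)

lemma seriesTerm_eq (a : ℕ → ℕ) (η : ℕ → ℝ) {k : ℕ} (hk : k ≠ 0) :
    seriesTerm a η k = k.totient / k * diffRadius a η k := by
  rw [seriesTerm, diffRadius, ← mul_assoc, ENNReal.div_mul_cancel (by exact_mod_cast hk)
    (ENNReal.natCast_ne_top k)]

lemma diffRadius_eq (a : ℕ → ℕ) (η : ℕ → ℝ) {k : ℕ} (hk : k ≠ 0) :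
    diffRadius a η k = ⨆ (b : ℕ) (_ : 1 ≤ b) (ℓ : ℕ) (_ : calN a (b * k) ≤ (ℓ : ℕ∞)),
      ENNReal.ofReal (η ℓ) / b := by
  have hk0 : (k : ℝ≥0∞) ≠ 0 := by exact_mod_cast hk
  rw [diffRadius]
  simp only [ENNReal.mul_iSup, ENNReal.iSup_div]
  refine iSup_congr fun b => iSup_congr fun _ => iSup_congr fun ℓ => iSup_congr fun _ => ?_
  rw [Nat.cast_mul, mul_comm (b : ℝ≥0∞), ← mul_div_assoc,
    ENNReal.mul_div_mul_left _ _ hk0 (ENNReal.natCast_ne_top k)]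

lemma diffRadius_le {a : ℕ → ℕ} {η : ℕ → ℝ} {B : ℝ} (hB : ∀ ℓ, η ℓ ≤ B) {k : ℕ} (hk : k ≠ 0) :
    diffRadius a η k ≤ ENNReal.ofReal B := by
  rw [diffRadius_eq a η hk]
  refine iSup₂_le fun b hb => iSup₂_le fun ℓ _ => ?_
  refine (ENNReal.div_le_of_le_mul ?_).trans (ENNReal.ofReal_le_ofReal (hB ℓ))
  exact le_mul_of_one_le_right' (by exact_mod_cast hb)

lemma exists_deltaMin_le_of_lt_diffRadius {a : ℕ → ℕ} (hmono : ∀ m n, 1 ≤ m → m < n → a m < a n)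
    {η : ℕ → ℝ} {k : ℕ} (hk : k ≠ 0) {t : ℝ} (ht : 0 ≤ t)
    (h : ENNReal.ofReal t < diffRadius a η k) :
    ∃ ℓ b : ℕ, 1 ≤ ℓ ∧ 1 ≤ b ∧ k ≤ a ℓ ∧ (∀ α, deltaMin a α ℓ ≤ b * nint (k * α)) ∧
      b * t < η ℓ := by
  rw [diffRadius_eq a η hk] at h
  simp only [lt_iSup_iff] at h
  obtain ⟨b, hb, ℓ, hℓ, h⟩ := h
  have hb' : (0 : ℝ) < b := by exact_mod_cast hb
  have hex : ∃ M, (1 ≤ M ∧ inDiffPos a (b * k) M) ∧ M ≤ ℓ := by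
    by_contra! hcon
    have : ((ℓ + 1 : ℕ) : ℕ∞) ≤ calN a (b * k) :=
      le_iInf₂ fun M hM => by exact_mod_cast hcon M hM
    have := this.trans hℓ
    norm_cast at this
    omega
  obtain ⟨M, ⟨-, m, n, hm, hmM, hn, hnM, hmn⟩, hMℓ⟩ := hex
  have hbk : k ≤ b * k := Nat.le_mul_of_pos_left k hb
  have hle : a m ≤ a ℓ := by
    rcases (hmM.trans hMℓ).lt_or_eq with h | rfl
    · exact (hmono m ℓ hm h).le
    · exact le_rfl
  refine ⟨ℓ, b, by omega, hb, by omega, fun α => ?_, ?_⟩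
  · have hne : m ≠ n := by rintro rfl; omega
    refine (deltaMin_le a α hm (hmM.trans hMℓ) hn (hnM.trans hMℓ) hne).trans ?_
    have h1 : (a m : ℝ) - a n = b * k := by
      rw [← hmn]; push_cast; ring
    rw [h1, mul_assoc]
    exact nint_natCast_mul_le b _
  · rw [← ENNReal.ofReal_natCast, ← ENNReal.ofReal_div_of_pos hb',
      ENNReal.ofReal_lt_ofReal_iff_of_nonneg ht, lt_div_iff₀ hb'] at h
    linarith

end DuffinSchaeffer

open DuffinSchaeffer in
theorem stmt5 (a : ℕ → ℕ)
    (hpos : ∀ n, 1 ≤ n → 0 < a n)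
    (hmono : ∀ m n, 1 ≤ m → m < n → a m < a n)
    (η : ℕ → ℝ) (hη : ∀ N, 0 ≤ η N)
    (hdiv : (∑' k : ℕ, seriesTerm a η (k + 1)) = ⊤) :
    volume {α : ℝ | α ∈ Set.Icc (0 : ℝ) 1 ∧
      (∃ᶠ N in atTop, deltaMin a α N ≤ η N)} = 1 := by
  refine le_antisymm ((measure_mono fun α h => h.1).trans_eq (by simp)) ?_
  suffices h : ∀ᵐ α : ℝ, α ∈ Set.Ioc (0 : ℝ) 1 → ∃ᶠ N in atTop, deltaMin a α N ≤ η N by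
    calc (1 : ℝ≥0∞) = volume (Set.Ioc (0 : ℝ) 1) := by simp
      _ ≤ _ := measure_mono_ae (h.mono fun α hα hmem => ⟨Set.Ioc_subset_Icc_self hmem, hα hmem⟩)
  by_cases hbig : ∃ᶠ ℓ in atTop, 1 / 2 ≤ η ℓ
  · refine Eventually.of_forall fun α _ =>
      (hbig.and_eventually (eventually_ge_atTop 2)).mono fun ℓ ⟨hℓ, h2⟩ => ?_
    exact (deltaMin_le a α one_le_two h2 le_rfl (by omega) (by norm_num)).trans
      ((abs_sub_round _).trans hℓ)
  rw [not_frequently] at hbig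
  obtain ⟨N₀, hN₀⟩ := eventually_atTop.1 hbig
  have hlarge : ∀ N ℓ, 1 ≤ ℓ → a (N + 1) < a ℓ → N < ℓ := fun N ℓ hℓ h => by
    by_contra! hcon
    exact absurd (hmono ℓ (N + 1) hℓ (by omega)) (by omega)
  have hsmall : ∀ k, a (N₀ + 1) < k → diffRadius a η k ≤ ENNReal.ofReal (1 / 2) := fun k hk => by
    by_contra! hcon
    obtain ⟨ℓ, b, hℓ, hb, hkℓ, -, h⟩ :=
      exists_deltaMin_le_of_lt_diffRadius hmono (by omega) (by norm_num) hcon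
    have hb' : (1 : ℝ) ≤ b := by exact_mod_cast hb
    have := hN₀ ℓ (hlarge N₀ ℓ hℓ (hk.trans_le hkℓ)).le
    linarith
  obtain ⟨B, hB⟩ : ∃ B, ∀ ℓ, η ℓ ≤ B := by
    refine ⟨∑ ℓ ∈ Finset.range N₀, η ℓ + 1 / 2, fun ℓ => ?_⟩
    rcases lt_or_ge ℓ N₀ with h | h
    · have := Finset.single_le_sum (fun i _ => hη i) (Finset.mem_range.2 h)
      linarith
    · have := hN₀ ℓ h
      have := Finset.sum_nonneg fun i (_ : i ∈ Finset.range N₀) => hη i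
      linarith
  have hfin : ∀ k, k ≠ 0 → diffRadius a η k ≠ ⊤ := fun k hk =>
    ne_top_of_le_ne_top ENNReal.ofReal_ne_top (diffRadius_le hB hk)
  set K := a (N₀ + 1) with hK
  set ψ : ℕ → ℝ := fun k => if K < k then (diffRadius a η k).toReal else 0 with hψ
  have hψ0 : ∀ k, 0 ≤ ψ k := fun k => by
    rw [hψ]; dsimp only; split_ifs <;> positivity
  have hψ1 : ∀ k, ψ k ≤ 1 / 2 := fun k => by
    rw [hψ]; dsimp only; split_ifs with h
    · exact ENNReal.toReal_le_of_le_ofReal (by norm_num) (hsmall k h)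
    · norm_num
  have hterm : ∀ k, K < k → seriesTerm a η k = ENNReal.ofReal (mass ψ k) := fun k hk => by
    have hk0 : k ≠ 0 := by omega
    have hk' : (0 : ℝ) < k := by exact_mod_cast (by omega : 0 < k)
    rw [seriesTerm_eq a η hk0, mass, rho, mul_comm (ψ k), ENNReal.ofReal_mul (by positivity),
      ENNReal.ofReal_div_of_pos hk', ENNReal.ofReal_natCast, ENNReal.ofReal_natCast, hψ]
    simp only [if_pos hk]
    rw [ENNReal.ofReal_toReal (hfin k hk0)]
  have hns : ¬ Summable (mass ψ) := fun hs => by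
    refine absurd hdiv ?_
    refine tsum_succ_ne_top (fun k hk => ?_) hs hterm
    rw [seriesTerm_eq a η hk]
    exact ENNReal.mul_ne_top (ENNReal.div_ne_top (ENNReal.natCast_ne_top _)
      (by exact_mod_cast hk)) (hfin k hk)
  have hae := (UnitAddCircle.measurePreserving_mk 0).quasiMeasurePreserving.ae
    (ae_mem_addWellApproximable hψ0 hψ1 hns)
  rw [zero_add, ae_restrict_iff' measurableSet_Ioc] at hae
  refine hae.mono fun α hα hmem => frequently_atTop.2 fun N => ?_
  have hinf := (UnitAddCircle.mem_addWellApproximable_iff _ _).1 (hα hmem)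
  obtain ⟨k, ⟨m, hm, -, hlt⟩, hk⟩ := hinf.exists_gt (a (N + 1))
  have hk0 : k ≠ 0 := by omega
  have hk' : (0 : ℝ) < k := by exact_mod_cast (by omega : 0 < k)
  have h1 : nint (k * α) < ψ k :=
    (nint_mul_le hk0 m α).trans_lt (by rwa [lt_div_iff₀' hk'] at hlt)
  have h2 : ENNReal.ofReal (nint (k * α)) < diffRadius a η k := by
    rw [ENNReal.ofReal_lt_iff_lt_toReal (nint_nonneg _) (hfin k hk0)]
    refine h1.trans_le ?_
    rw [hψ]; dsimp only; split_ifs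
    · exact le_rfl
    · exact ENNReal.toReal_nonneg
  obtain ⟨ℓ, b, hℓ, hb, hkℓ, hδ, hlt'⟩ :=
    exists_deltaMin_le_of_lt_diffRadius hmono hk0 (nint_nonneg _) h2
  exact ⟨ℓ, (hlarge N ℓ hℓ (hk.trans_le hkℓ)).le, (hδ α).trans hlt'.le⟩
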